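/- arXiv:2409.10886 — 4 statements merged into one kernel-verified Lean document; each statement's English description precedes it below -/
import Mathlib

section
/- Fix an integer d ≥ 1. There exists a constant C(d) > 0, depending only on d, such that for every integer n ≥ 1 and every function f : {-1,1}^n → ℝ of degree at most d, one has (∑_{S ⊆ [n]} |f̂(S)|^{2d/(d+1)})^{(d+1)/(2d)} ≤ C(d) · max_{x ∈ {-1,1}^n} |f(x)|. Moreover, there is a universal constant C > 0 such that C(d) can be taken at most C^{√(d log d)}. -/
open Finset
open scoped BigOperators

theorem sum_rpow_mul_rpow_le {ι : Type*} (s : Finset ι) {f g : ι → ℝ} {a b : ℝ}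
    (hf : ∀ i ∈ s, 0 ≤ f i) (hg : ∀ i ∈ s, 0 ≤ g i) (ha : 0 < a) (hb : 0 < b) (hab : a + b = 1) :
    ∑ i ∈ s, f i ^ a * g i ^ b ≤ (∑ i ∈ s, f i) ^ a * (∑ i ∈ s, g i) ^ b := by
  have hpq : (1 / a).HolderConjugate (1 / b) := by
    rw [Real.holderConjugate_iff]
    refine ⟨?_, by simpa using hab⟩
    rw [lt_div_iff₀ ha]; linarith
  have h := Real.inner_le_Lp_mul_Lq_of_nonneg s hpq (f := fun i => f i ^ a)
    (g := fun i => g i ^ b) (fun i hi => Real.rpow_nonneg (hf i hi) _)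
    (fun i hi => Real.rpow_nonneg (hg i hi) _)
  have e1 : ∑ i ∈ s, (f i ^ a) ^ (1 / a) = ∑ i ∈ s, f i := Finset.sum_congr rfl fun i hi => by
    rw [← Real.rpow_mul (hf i hi), mul_one_div_cancel ha.ne', Real.rpow_one]
  have e2 : ∑ i ∈ s, (g i ^ b) ^ (1 / b) = ∑ i ∈ s, g i := Finset.sum_congr rfl fun i hi => by
    rw [← Real.rpow_mul (hg i hi), mul_one_div_cancel hb.ne', Real.rpow_one]
  simp only [e1, e2, one_div_one_div] at h
  exact h

theorem Lp_sum_le_sum_Lp {ι κ : Type*} (s : Finset ι) (t : Finset κ) {w : ι → κ → ℝ} {p : ℝ}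
    (hp : 1 ≤ p) (hw : ∀ i ∈ s, ∀ j ∈ t, 0 ≤ w i j) :
    (∑ j ∈ t, (∑ i ∈ s, w i j) ^ p) ^ (1 / p) ≤ ∑ i ∈ s, (∑ j ∈ t, w i j ^ p) ^ (1 / p) := by
  classical
  induction s using Finset.induction_on with
  | empty =>
    have hp0 : p ≠ 0 := by linarith
    simp [Real.zero_rpow hp0, hp0]
  | insert i s hi ih =>
    have hw' : ∀ i ∈ s, ∀ j ∈ t, 0 ≤ w i j := fun k hk => hw k (mem_insert_of_mem hk)
    simp only [sum_insert hi]
    refine (Real.Lp_add_le_of_nonneg t hp (hw i (mem_insert_self i s))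
      fun j hj => sum_nonneg fun k hk => hw' k hk j hj).trans ?_
    gcongr
    exact ih hw'

section Blei

variable {α : Type*}

section Link

variable [DecidableEq α]

/-- The restriction of a function to the sets containing `x`, indexed by their other elements. -/
def link (x : α) (F : Finset α → ℝ) : Finset α → ℝ :=
  fun S => if x ∈ S then 0 else F (insert x S)

theorem link_nonneg {b : Finset α → ℝ} (hb : ∀ S, 0 ≤ b S) (x : α) (S : Finset α) :
    0 ≤ link x b S := by
  unfold link; split_ifs <;> simp [hb]

theorem link_rpow {b : Finset α → ℝ} (x : α) {p : ℝ} (hp : p ≠ 0) :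
    link x (fun S => b S ^ p) = fun S => link x b S ^ p := by
  funext S
  unfold link; split_ifs <;> simp [Real.zero_rpow hp]

end Link

variable [Fintype α]

/-- The sum of `F` over all injective `m`-tuples, seen as `m`-element sets. -/
noncomputable def orderedSum (m : ℕ) (F : Finset α → ℝ) : ℝ :=
  (m.factorial : ℝ) * ∑ S ∈ powersetCard m univ, F S

theorem orderedSum_zero (F : Finset α → ℝ) : orderedSum 0 F = F ∅ := by
  simp [orderedSum]

theorem orderedSum_nonneg {m : ℕ} {F : Finset α → ℝ} (hF : ∀ S, 0 ≤ F S) : 0 ≤ orderedSum m F :=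
  mul_nonneg (by positivity) (sum_nonneg fun S _ => hF S)

theorem orderedSum_rpow_mul_rpow_le (m : ℕ) {f g : Finset α → ℝ} {a b : ℝ}
    (hf : ∀ S, 0 ≤ f S) (hg : ∀ S, 0 ≤ g S) (ha : 0 < a) (hb : 0 < b) (hab : a + b = 1) :
    orderedSum m (fun S => f S ^ a * g S ^ b) ≤ orderedSum m f ^ a * orderedSum m g ^ b := by
  have hm : (0 : ℝ) < (m.factorial : ℝ) := by positivity
  unfold orderedSum
  rw [Real.mul_rpow hm.le (sum_nonneg fun S _ => hf S),
    Real.mul_rpow hm.le (sum_nonneg fun S _ => hg S)]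
  have := sum_rpow_mul_rpow_le (powersetCard m univ) (fun S _ => hf S) (fun S _ => hg S) ha hb hab
  calc _ ≤ (m.factorial : ℝ) * ((∑ S ∈ powersetCard m univ, f S) ^ a
        * (∑ S ∈ powersetCard m univ, g S) ^ b) := by gcongr
    _ = ((m.factorial : ℝ) ^ a * (m.factorial : ℝ) ^ b) * ((∑ S ∈ powersetCard m univ, f S) ^ a
        * (∑ S ∈ powersetCard m univ, g S) ^ b) := by
      rw [← Real.rpow_add hm, hab, Real.rpow_one]
    _ = _ := by ring

/-- Minkowski's inequality for `ℓ²(ℓ^q) ≤ ℓ^q(ℓ²)`, `q ≤ 2`. -/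
theorem sum_orderedSum_rpow_le (m : ℕ) {q : ℝ} (hq : 0 < q) (hq2 : q ≤ 2)
    {b : α → Finset α → ℝ} (hb : ∀ x S, 0 ≤ b x S) :
    ∑ x, orderedSum m (fun S => b x S ^ q) ^ (2 / q)
      ≤ orderedSum m (fun S => (∑ x, b x S ^ 2) ^ (q / 2)) ^ (2 / q) := by
  have hm : (0 : ℝ) < (m.factorial : ℝ) := by positivity
  have hs : 1 ≤ 2 / q := by rw [le_div_iff₀ hq]; linarith
  have h := Lp_sum_le_sum_Lp (powersetCard m (univ : Finset α)) (univ : Finset α)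
    (w := fun S x => b x S ^ q) hs (fun S _ x _ => Real.rpow_nonneg (hb x S) _)
  have e : ∀ S x, (b x S ^ q) ^ (2 / q) = b x S ^ 2 := fun S x => by
    rw [← Real.rpow_mul (hb x S), mul_div_cancel₀ _ hq.ne', Real.rpow_two]
  simp only [e, one_div_div] at h
  have hA : 0 ≤ ∑ x : α, (∑ S ∈ powersetCard m univ, b x S ^ q) ^ (2 / q) :=
    sum_nonneg fun x _ => Real.rpow_nonneg (sum_nonneg fun S _ => Real.rpow_nonneg (hb x S) _) _
  have h' := Real.rpow_le_rpow (Real.rpow_nonneg hA _) h (by positivity : 0 ≤ 2 / q)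
  rw [← Real.rpow_mul hA, show q / 2 * (2 / q) = 1 by field_simp, Real.rpow_one] at h'
  unfold orderedSum
  rw [Real.mul_rpow hm.le (sum_nonneg fun S _ => Real.rpow_nonneg
    (sum_nonneg fun x _ => sq_nonneg _) _)]
  calc _ = ∑ x : α, (m.factorial : ℝ) ^ (2 / q)
        * (∑ S ∈ powersetCard m univ, b x S ^ q) ^ (2 / q) := by
        refine sum_congr rfl fun x _ => ?_
        rw [Real.mul_rpow hm.le (sum_nonneg fun S _ => Real.rpow_nonneg (hb x S) _)]
    _ ≤ _ := by
      rw [← mul_sum]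
      gcongr

variable [DecidableEq α]

theorem orderedSum_succ (m : ℕ) (F : Finset α → ℝ) :
    orderedSum (m + 1) F = ∑ x, orderedSum m (link x F) := by
  have key : ((m + 1 : ℕ) : ℝ) * ∑ S ∈ powersetCard (m + 1) univ, F S
      = ∑ x : α, ∑ S ∈ powersetCard m univ, link x F S := by
    have h1 : ∀ x : α, ∑ S ∈ powersetCard m univ, link x F S
        = ∑ S ∈ powersetCard (m + 1) univ, if x ∈ S then F S else 0 := by
      intro x
      have e : ∀ S : Finset α, link x F S = if x ∉ S then F (insert x S) else 0 := by
        intro S; simp [link, ite_not]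
      simp only [e]
      rw [← sum_filter, ← sum_filter]
      refine sum_nbij' (fun S => insert x S) (fun S => S.erase x) ?_ ?_ ?_ ?_ ?_
      · intro S hS
        simp only [mem_filter, mem_powersetCard_univ] at hS ⊢
        exact ⟨by rw [card_insert_of_notMem hS.2, hS.1], mem_insert_self _ _⟩
      · intro S hS
        simp only [mem_filter, mem_powersetCard_univ] at hS ⊢
        exact ⟨by rw [card_erase_of_mem hS.2, hS.1]; rfl, notMem_erase _ _⟩
      · intro S hS
        simp only [mem_filter] at hS
        exact erase_insert hS.2
      · intro S hS
        simp only [mem_filter] at hS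
        exact insert_erase hS.2
      · intro S _
        rfl
    simp only [h1]
    rw [sum_comm, mul_sum]
    refine sum_congr rfl fun S hS => ?_
    rw [mem_powersetCard_univ] at hS
    simp [hS]
  simp only [orderedSum, ← mul_sum, ← key]
  rw [Nat.factorial_succ]
  push_cast
  ring

theorem sum_link_sq_rpow {b : Finset α → ℝ} (x : α) {p : ℝ} (hp : p ≠ 0) :
    link x (fun S => (∑ y, link y b S ^ 2) ^ p) = fun S => (∑ y, link y (link x b) S ^ 2) ^ p := by
  funext S
  by_cases hx : x ∈ S
  · simp [Real.zero_rpow hp, link, hx]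
  · simp only [link, hx, if_false]
    congr 1
    refine sum_congr rfl fun y _ => ?_
    by_cases hxy : y = x
    · subst hxy; simp
    · by_cases hy : y ∈ S
      · simp [hy]
      · simp [hy, hxy, Ne.symm hxy, hx, Finset.insert_comm]

/-- Blei's inequality for symmetric forms: the exponent `p` satisfies
`1 / p = (m / q + 1 / 2) / (m + 1)`. -/
theorem orderedSum_rpow_le_of_mixed {q : ℝ} (hq : 0 < q) (hq2 : q ≤ 2) (m : ℕ) :
    ∀ (p : ℝ), 0 < p → (m + 1 : ℝ) / p = m / q + 1 / 2 →
    ∀ b : Finset α → ℝ, (∀ S, 0 ≤ b S) →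
      orderedSum (m + 1) (fun S => b S ^ p)
        ≤ orderedSum m (fun S => (∑ x, link x b S ^ 2) ^ (q / 2)) ^ (p / q) := by
  induction m with
  | zero =>
    intro p hp hpq b hb
    have hp2 : p = 2 := by
      have h : (1 : ℝ) / p = 1 / 2 := by simpa using hpq
      field_simp at h; linarith
    subst hp2
    rw [orderedSum_succ]
    simp only [orderedSum_zero]
    rw [← Real.rpow_mul (sum_nonneg fun _ _ => sq_nonneg _), show q / 2 * (2 / q) = 1 by field_simp,
      Real.rpow_one]
    refine (sum_congr rfl fun x _ => ?_).le
    rw [link_rpow x two_ne_zero]; simp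
  | succ m ih =>
    intro p hp hpq b hb
    push_cast at hpq
    have hm : (0 : ℝ) ≤ m := Nat.cast_nonneg m
    obtain ⟨r, hr, hrq⟩ : ∃ r : ℝ, 0 < r ∧ (m + 1 : ℝ) / r = m / q + 1 / 2 :=
      ⟨(m + 1) / (m / q + 1 / 2), by positivity, by field_simp⟩
    set G : Finset α → ℝ := fun S => (∑ x, link x b S ^ 2) ^ (q / 2) with hG
    have hGn : ∀ S, 0 ≤ G S := fun S => Real.rpow_nonneg (sum_nonneg fun _ _ => sq_nonneg _) _
    set Q := orderedSum (m + 1) G with hQ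
    have hQn : 0 ≤ Q := orderedSum_nonneg hGn
    have hln : ∀ x S, 0 ≤ link x b S := link_nonneg hb
    set A : α → ℝ := fun x => orderedSum (m + 1) (fun S => link x b S ^ q) with hA
    set B : α → ℝ := fun x => orderedSum (m + 1) (fun S => link x b S ^ r) with hB
    have hAn : ∀ x, 0 ≤ A x := fun x => orderedSum_nonneg fun S => Real.rpow_nonneg (hln x S) _
    have hBn : ∀ x, 0 ≤ B x := fun x => orderedSum_nonneg fun S => Real.rpow_nonneg (hln x S) _
    have hu : ∑ x, A x ^ (2 / q) ≤ Q ^ (2 / q) := sum_orderedSum_rpow_le (m + 1) hq hq2 hln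
    have hv : ∑ x, B x ^ (q / r) ≤ Q := by
      rw [hQ, orderedSum_succ]
      refine sum_le_sum fun x _ => ?_
      have h := ih r hr hrq (link x b) (hln x)
      rw [hG, sum_link_sq_rpow x (by positivity)]
      set E := orderedSum m fun S => (∑ y, link y (link x b) S ^ 2) ^ (q / 2)
      have hE : 0 ≤ E :=
        orderedSum_nonneg fun S => Real.rpow_nonneg (sum_nonneg fun _ _ => sq_nonneg _) _
      calc B x ^ (q / r) ≤ (E ^ (r / q)) ^ (q / r) :=
            Real.rpow_le_rpow (hBn x) h (by positivity)
        _ = E := by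
          rw [← Real.rpow_mul hE, show r / q * (q / r) = 1 by field_simp, Real.rpow_one]
    set θ : ℝ := p / ((m + 2) * q) with hθ
    set η : ℝ := p * (m + 1) / ((m + 2) * r) with hη
    have hθ0 : 0 < θ := by positivity
    have hη0 : 0 < η := by positivity
    have hp' : p * (m / q + 1 / q + 1 / 2) = m + 2 := by
      field_simp at hpq ⊢; linarith
    have hr' : (m + 1 : ℝ) / r = m / q + 1 / 2 := hrq
    have hθη : θ + η = 1 := by
      have : θ + η = p * (1 / q + (m + 1) / r) / (m + 2) := by
        rw [hθ, hη]; field_simp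
      rw [this, hr', show (1 / q + (m / q + 1 / 2) : ℝ) = m / q + 1 / q + 1 / 2 by ring, hp']
      field_simp
    have hexp : q * θ + r * η = p := by
      rw [hθ, hη]; field_simp; ring
    have ha2 : θ * q / 2 + η * (r / q) = 1 := by
      have : θ * q / 2 + η * (r / q) = p * (m / q + 1 / q + 1 / 2) / (m + 2) := by
        rw [hθ, hη]; field_simp; ring
      rw [this, hp']; field_simp
    rw [orderedSum_succ]
    calc ∑ x, orderedSum (m + 1) (link x fun S => b S ^ p)
        ≤ ∑ x, A x ^ θ * B x ^ η := by
          refine sum_le_sum fun x _ => ?_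
          rw [link_rpow x hp.ne']
          have h := orderedSum_rpow_mul_rpow_le (m + 1) (f := fun S => link x b S ^ q)
            (g := fun S => link x b S ^ r) (fun S => Real.rpow_nonneg (hln x S) _)
            (fun S => Real.rpow_nonneg (hln x S) _) hθ0 hη0 hθη
          refine le_of_eq_of_le ?_ h
          congr 1
          funext S
          rw [← Real.rpow_mul (hln x S), ← Real.rpow_mul (hln x S),
            ← Real.rpow_add_of_nonneg (hln x S) (by positivity) (by positivity), hexp]
      _ = ∑ x, (A x ^ (2 / q)) ^ (θ * q / 2) * (B x ^ (q / r)) ^ (η * (r / q)) := by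
          refine sum_congr rfl fun x _ => ?_
          rw [← Real.rpow_mul (hAn x), ← Real.rpow_mul (hBn x),
            show 2 / q * (θ * q / 2) = θ by field_simp,
            show q / r * (η * (r / q)) = η by field_simp]
      _ ≤ (∑ x, A x ^ (2 / q)) ^ (θ * q / 2) * (∑ x, B x ^ (q / r)) ^ (η * (r / q)) :=
          sum_rpow_mul_rpow_le univ (fun x _ => Real.rpow_nonneg (hAn x) _)
            (fun x _ => Real.rpow_nonneg (hBn x) _) (by positivity) (by positivity) ha2
      _ ≤ (Q ^ (2 / q)) ^ (θ * q / 2) * Q ^ (η * (r / q)) := by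
          have hu0 : 0 ≤ ∑ x, A x ^ (2 / q) := sum_nonneg fun x _ => Real.rpow_nonneg (hAn x) _
          have hv0 : 0 ≤ ∑ x, B x ^ (q / r) := sum_nonneg fun x _ => Real.rpow_nonneg (hBn x) _
          exact mul_le_mul (Real.rpow_le_rpow hu0 hu (by positivity))
            (Real.rpow_le_rpow hv0 hv (by positivity)) (Real.rpow_nonneg hv0 _)
            (Real.rpow_nonneg (Real.rpow_nonneg hQn _) _)
      _ = Q ^ (p / q) := by
          rw [← Real.rpow_mul hQn, ← Real.rpow_add_of_nonneg hQn (by positivity) (by positivity)]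
          have : 2 / q * (θ * q / 2) + η * (r / q) = (q * θ + r * η) / q := by
            field_simp
          rw [this, hexp]

end Blei

section Chain

variable {α : Type*} [DecidableEq α]

/-- The restriction of a function to the supersets of `T`, indexed by their other elements. -/
def linkSet (T : Finset α) (F : Finset α → ℝ) : Finset α → ℝ :=
  fun V => if Disjoint T V then F (T ∪ V) else 0

theorem linkSet_nonneg {F : Finset α → ℝ} (hF : ∀ S, 0 ≤ F S) (T V : Finset α) :
    0 ≤ linkSet T F V := by
  unfold linkSet; split_ifs <;> simp [hF]

theorem link_linkSet {x : α} {T : Finset α} (F : Finset α → ℝ) (hx : x ∉ T) :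
    link x (linkSet T F) = linkSet (insert x T) F := by
  funext V
  by_cases hV : x ∈ V
  · simp [link, linkSet, hV]
  · simp [link, linkSet, hV, hx]

theorem link_linkSet_of_mem {x : α} {T : Finset α} (F : Finset α → ℝ) (hx : x ∈ T) :
    link x (linkSet T F) = 0 := by
  funext V
  simp [link, linkSet, hx]

theorem linkSet_eq_zero {d : ℕ} {a : Finset α → ℝ} (ha : ∀ S, d < S.card → a S = 0)
    {T V : Finset α} (h : d < T.card + V.card) : linkSet T a V = 0 := by
  unfold linkSet
  split_ifs with hd
  · exact ha _ (by rwa [card_union_of_disjoint hd])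
  · rfl

variable [Fintype α]

theorem orderedSum_linkSet_succ (j : ℕ) (F : Finset α → ℝ) (T : Finset α) :
    orderedSum (j + 1) (linkSet T F) = ∑ x, link x (fun U => orderedSum j (linkSet U F)) T := by
  rw [orderedSum_succ]
  refine sum_congr rfl fun x _ => ?_
  by_cases hx : x ∈ T
  · rw [link_linkSet_of_mem F hx]; simp [link, hx, orderedSum]
  · rw [link_linkSet F hx]; simp [link, hx]

/-- The exponent `2m / (m + 1)`. -/
noncomputable def bhExp (m : ℕ) : ℝ := 2 * (m : ℝ) / ((m : ℝ) + 1)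

theorem bhExp_pos {m : ℕ} (hm : 1 ≤ m) : 0 < bhExp m := by
  have : (1 : ℝ) ≤ m := by exact_mod_cast hm
  unfold bhExp; positivity

theorem one_le_bhExp {m : ℕ} (hm : 1 ≤ m) : 1 ≤ bhExp m := by
  have : (1 : ℝ) ≤ m := by exact_mod_cast hm
  unfold bhExp; rw [le_div_iff₀ (by positivity)]; linarith

theorem bhExp_le_two (m : ℕ) : bhExp m ≤ 2 := by
  unfold bhExp; rw [div_le_iff₀ (by positivity)]; linarith

theorem bhExp_mono {m k : ℕ} (h : m ≤ k) : bhExp m ≤ bhExp k := by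
  have h : (m : ℝ) ≤ k := by exact_mod_cast h
  unfold bhExp; rw [div_le_div_iff₀ (by positivity) (by positivity)]; nlinarith

theorem orderedSum_chain_step {k : ℕ} (hk : 1 ≤ k) (j : ℕ) {F : Finset α → ℝ} (hF : ∀ S, 0 ≤ F S)
    {N : ℝ} (hN : 0 ≤ N)
    (h : orderedSum k (fun T => orderedSum (j + 1) (linkSet T F) ^ (bhExp k / 2)) ≤ N ^ bhExp k) :
    orderedSum (k + 1) (fun T => orderedSum j (linkSet T F) ^ (bhExp (k + 1) / 2))
      ≤ N ^ bhExp (k + 1) := by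
  have hk0 : (1 : ℝ) ≤ k := by exact_mod_cast hk
  have hq := bhExp_pos hk
  have hp := bhExp_pos (Nat.le_add_left 1 k)
  have hG : ∀ T, 0 ≤ orderedSum j (linkSet T F) := fun T =>
    orderedSum_nonneg (linkSet_nonneg hF T)
  have key := orderedSum_rpow_le_of_mixed hq (bhExp_le_two k) k (bhExp (k + 1)) hp
    (by unfold bhExp; push_cast; field_simp)
    (fun T => orderedSum j (linkSet T F) ^ (1 / 2 : ℝ)) (fun T => Real.rpow_nonneg (hG T) _)
  have e1 : ∀ T, (∑ x, link x (fun T => orderedSum j (linkSet T F) ^ (1 / 2 : ℝ)) T ^ 2)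
      = orderedSum (j + 1) (linkSet T F) := fun T => by
    rw [orderedSum_linkSet_succ]
    refine sum_congr rfl fun x _ => ?_
    rw [link_rpow x (by norm_num)]
    rw [← Real.rpow_natCast, ← Real.rpow_mul (link_nonneg hG x T)]
    norm_num
  have e2 : ∀ T, (orderedSum j (linkSet T F) ^ (1 / 2 : ℝ)) ^ bhExp (k + 1)
      = orderedSum j (linkSet T F) ^ (bhExp (k + 1) / 2) := fun T => by
    rw [← Real.rpow_mul (hG T)]; congr 1; ring
  simp only [e1, e2] at key
  refine key.trans ((Real.rpow_le_rpow ?_ h (by positivity)).trans_eq ?_)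
  · exact orderedSum_nonneg fun T => Real.rpow_nonneg (orderedSum_nonneg (linkSet_nonneg hF T)) _
  · rw [← Real.rpow_mul hN, mul_div_cancel₀ _ hq.ne']

theorem orderedSum_chain (j : ℕ) {F : Finset α → ℝ} (hF : ∀ S, 0 ≤ F S) {N : ℝ} (hN : 0 ≤ N) :
    ∀ k : ℕ, 1 ≤ k →
      orderedSum k (fun T => orderedSum j (linkSet T F) ^ (bhExp k / 2)) ≤ N ^ bhExp k →
      orderedSum (k + j) (fun T => F T ^ (bhExp (k + j) / 2)) ≤ N ^ bhExp (k + j) := by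
  induction j with
  | zero =>
    intro k _ h
    simpa [orderedSum_zero, linkSet] using h
  | succ j ih =>
    intro k hk h
    have := ih (k + 1) (by omega) (orderedSum_chain_step hk j hF hN h)
    rwa [show k + 1 + j = k + (j + 1) by ring] at this

theorem sum_rpow_le_of_mixed {k m : ℕ} (hk : 1 ≤ k) (hkm : k ≤ m) (a : Finset α → ℝ) {N : ℝ}
    (hN : 0 ≤ N)
    (h : ∑ T ∈ powersetCard k univ,
      (∑ V ∈ powersetCard (m - k) univ, linkSet T (fun S => a S ^ 2) V) ^ (bhExp k / 2)
        ≤ N ^ bhExp k) :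
    ∑ S ∈ powersetCard m univ, |a S| ^ bhExp m ≤ (k.factorial * N) ^ bhExp m := by
  obtain ⟨j, rfl⟩ := Nat.exists_eq_add_of_le hkm
  rw [Nat.add_sub_cancel_left] at h
  have hq := bhExp_pos hk
  have hp := bhExp_pos (hk.trans hkm)
  have hF : ∀ S, 0 ≤ a S ^ 2 := fun S => sq_nonneg _
  have hj : (0 : ℝ) ≤ j.factorial := by positivity
  have hj1 : (1 : ℝ) ≤ j.factorial := by exact_mod_cast j.factorial_pos
  have hk1 : (1 : ℝ) ≤ k.factorial := by exact_mod_cast k.factorial_pos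
  set s : ℝ := (j.factorial : ℝ) ^ (1 / 2 : ℝ) with hs
  have hs0 : 0 ≤ s := by positivity
  have hspow : ∀ t : ℝ, (j.factorial : ℝ) ^ (t / 2) = s ^ t := fun t => by
    rw [hs, ← Real.rpow_mul hj]; congr 1; ring
  have hchain := orderedSum_chain j hF (N := k.factorial * s * N) (by positivity) k hk (by
    have e : ∀ T, orderedSum j (linkSet T fun S => a S ^ 2) ^ (bhExp k / 2)
        = s ^ bhExp k * (∑ V ∈ powersetCard j univ, linkSet T (fun S => a S ^ 2) V)
          ^ (bhExp k / 2) := fun T => by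
      rw [orderedSum, Real.mul_rpow hj (sum_nonneg fun V _ => linkSet_nonneg hF T V), hspow]
    simp only [e]
    rw [orderedSum, ← mul_sum, mul_assoc, Real.mul_rpow (by positivity) (by positivity),
      Real.mul_rpow hs0 hN]
    have h1 : (k.factorial : ℝ) ≤ (k.factorial : ℝ) ^ bhExp k :=
      Real.self_le_rpow_of_one_le hk1 (one_le_bhExp hk)
    have h2 : 0 ≤ ∑ T ∈ powersetCard k univ,
        (∑ V ∈ powersetCard j univ, linkSet T (fun S => a S ^ 2) V) ^ (bhExp k / 2) :=
      sum_nonneg fun T _ => Real.rpow_nonneg (sum_nonneg fun V _ => linkSet_nonneg hF T V) _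
    exact mul_le_mul h1 (mul_le_mul_of_nonneg_left h (by positivity))
      (mul_nonneg (by positivity) h2) (by positivity))
  have e : ∀ S, (a S ^ 2) ^ (bhExp (k + j) / 2) = |a S| ^ bhExp (k + j) := fun S => by
    rw [← sq_abs, ← Real.rpow_natCast, ← Real.rpow_mul (abs_nonneg _)]
    congr 1; push_cast; ring
  simp only [e, orderedSum] at hchain
  rw [show (k.factorial : ℝ) * s * N = s * (k.factorial * N) by ring,
    Real.mul_rpow hs0 (by positivity)] at hchain
  have h2 : s ^ bhExp (k + j) ≤ (k + j).factorial := by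
    rw [← hspow]
    calc (j.factorial : ℝ) ^ (bhExp (k + j) / 2) ≤ (j.factorial : ℝ) ^ (1 : ℝ) :=
          Real.rpow_le_rpow_of_exponent_le hj1 (by linarith [bhExp_le_two (k + j)])
      _ = j.factorial := Real.rpow_one _
      _ ≤ (k + j).factorial := by exact_mod_cast Nat.factorial_le (Nat.le_add_left j k)
  have hm : (0 : ℝ) < (k + j).factorial := by positivity
  refine le_of_mul_le_mul_left (hchain.trans ?_) hm
  gcongr

end Chain

section Cube

variable {α : Type*}

/-- The sign `±1` attached to a Boolean. -/
def boolSign (b : Bool) : ℝ := if b then 1 else -1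

theorem boolSign_sq (b : Bool) : boolSign b ^ 2 = 1 := by
  cases b <;> simp [boolSign]

theorem abs_boolSign (b : Bool) : |boolSign b| = 1 := by
  cases b <;> simp [boolSign]

theorem boolSign_not (b : Bool) : boolSign (!b) = -boolSign b := by
  cases b <;> simp [boolSign]

/-- The multilinear polynomial supported on the subsets of `s`, evaluated on the cube. -/
def partialWalsh (s : Finset α) (a : Finset α → ℝ) (x : α → Bool) : ℝ :=
  ∑ S ∈ s.powerset, a S * ∏ j ∈ S, boolSign (x j)

/-- The multilinear polynomial with coefficients `a`. -/
def walsh [Fintype α] (a : Finset α → ℝ) (z : α → ℝ) : ℝ := ∑ S, a S * ∏ j ∈ S, z j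

theorem walsh_eq_partialWalsh [Fintype α] (a : Finset α → ℝ) (x : α → Bool) :
    walsh a (fun j => boolSign (x j)) = partialWalsh univ a x := by
  simp [walsh, partialWalsh]

variable [DecidableEq α]

theorem partialWalsh_insert {i : α} {s : Finset α} (hi : i ∉ s) (a : Finset α → ℝ)
    (x : α → Bool) :
    partialWalsh (insert i s) a x
      = partialWalsh s a x + boolSign (x i) * partialWalsh s (fun S => a (insert i S)) x := by
  unfold partialWalsh
  rw [sum_powerset_insert hi, mul_sum]
  congr 1
  refine sum_congr rfl fun S hS => ?_
  rw [prod_insert fun h => hi (mem_powerset.1 hS h)]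
  ring

theorem partialWalsh_update {i : α} {s : Finset α} (hi : i ∉ s) (a : Finset α → ℝ)
    (x : α → Bool) (b : Bool) :
    partialWalsh s a (Function.update x i b) = partialWalsh s a x := by
  unfold partialWalsh
  refine sum_congr rfl fun S hS => ?_
  congr 1
  refine prod_congr rfl fun j hj => ?_
  rw [Function.update_of_ne]
  rintro rfl
  exact hi (mem_powerset.1 hS hj)

variable [Fintype α]

theorem expect_boolSign_mul (i : α) (h : (α → Bool) → ℝ)
    (hh : ∀ x, h (Function.update x i (!x i)) = h x) :
    𝔼 x, boolSign (x i) * h x = 0 := by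
  rw [Fintype.expect_eq_sum_div_card]
  rw [sum_involution (fun x _ => Function.update x i (!x i)), zero_div]
  · intro x _
    rw [hh, Function.update_self, boolSign_not]; ring
  · intro x _ _ h
    have := congrFun h i
    simp at this
  · intro x _; simp
  · intro x _; simp

theorem expect_partialWalsh_sq (s : Finset α) :
    ∀ a : Finset α → ℝ, 𝔼 x, partialWalsh s a x ^ 2 = ∑ S ∈ s.powerset, a S ^ 2 := by
  induction s using Finset.induction_on with
  | empty => intro a; simp [partialWalsh]
  | insert i s hi ih =>
    intro a
    rw [sum_powerset_insert hi, ← ih a, ← ih fun S => a (insert i S)]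
    have h0 := expect_boolSign_mul i
      (fun x => 2 * (partialWalsh s a x * partialWalsh s (fun S => a (insert i S)) x))
      (fun x => by simp only [partialWalsh_update hi])
    rw [← add_zero (_ + _), ← h0, ← expect_add_distrib, ← expect_add_distrib]
    refine expect_congr rfl fun x _ => ?_
    rw [partialWalsh_insert hi]
    linear_combination partialWalsh s (fun S => a (insert i S)) x ^ 2 * boolSign_sq (x i)

/-- Bonami's hypercontractive inequality, from degree-weighted `ℓ²` to `L⁴`. -/
theorem expect_partialWalsh_pow_four_le (s : Finset α) :
    ∀ a : Finset α → ℝ,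
      𝔼 x, partialWalsh s a x ^ 4 ≤ (∑ S ∈ s.powerset, 3 ^ S.card * a S ^ 2) ^ 2 := by
  induction s using Finset.induction_on with
  | empty => intro a; simp [partialWalsh, ← pow_mul]
  | insert i s hi ih =>
    intro a
    set a' : Finset α → ℝ := fun S => a (insert i S) with ha'
    set A := ∑ S ∈ s.powerset, 3 ^ S.card * a S ^ 2 with hA
    set B := ∑ S ∈ s.powerset, 3 ^ S.card * a' S ^ 2 with hB
    have hA0 : 0 ≤ A := sum_nonneg fun S _ => by positivity
    have hB0 : 0 ≤ B := sum_nonneg fun S _ => by positivity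
    have hsum : ∑ S ∈ (insert i s).powerset, (3 : ℝ) ^ S.card * a S ^ 2 = A + 3 * B := by
      rw [sum_powerset_insert hi, hB, mul_sum]
      congr 1
      refine sum_congr rfl fun S hS => ?_
      rw [card_insert_of_notMem fun h => hi (mem_powerset.1 hS h), pow_succ]
      ring
    rw [hsum]
    set f := partialWalsh s a with hf
    set g := partialWalsh s a' with hg
    have h4f : 𝔼 x, f x ^ 4 ≤ A ^ 2 := ih a
    have h4g : 𝔼 x, g x ^ 4 ≤ B ^ 2 := ih a'
    have hcs : 𝔼 x, f x ^ 2 * g x ^ 2 ≤ A * B := by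
      refine abs_le_of_sq_le_sq' ?_ (by positivity) |>.2
      calc (𝔼 x, f x ^ 2 * g x ^ 2) ^ 2
          ≤ (𝔼 x, (f x ^ 2) ^ 2) * 𝔼 x, (g x ^ 2) ^ 2 := expect_mul_sq_le_sq_mul_sq _ _ _
        _ = (𝔼 x, f x ^ 4) * 𝔼 x, g x ^ 4 := by simp only [← pow_mul]
        _ ≤ A ^ 2 * B ^ 2 :=
          mul_le_mul h4f h4g (expect_nonneg fun x _ => by positivity) (by positivity)
        _ = (A * B) ^ 2 := by ring
    have h0 := expect_boolSign_mul i
      (fun x => 4 * (f x ^ 3 * g x) + 4 * (f x * g x ^ 3))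
      (fun x => by simp only [hf, hg, partialWalsh_update hi])
    have hexp : 𝔼 x, partialWalsh (insert i s) a x ^ 4
        = 𝔼 x, f x ^ 4 + 6 * (𝔼 x, f x ^ 2 * g x ^ 2) + 𝔼 x, g x ^ 4 := by
      rw [← add_zero (_ + _), ← h0, mul_expect, ← expect_add_distrib, ← expect_add_distrib,
        ← expect_add_distrib]
      refine expect_congr rfl fun x _ => ?_
      rw [partialWalsh_insert hi]
      have h2 := boolSign_sq (x i)
      have h3 : boolSign (x i) ^ 3 = boolSign (x i) := by rw [pow_succ, h2, one_mul]
      have h4 : boolSign (x i) ^ 4 = 1 := by rw [show 4 = 2 * 2 by norm_num, pow_mul, h2, one_pow]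
      linear_combination 6 * f x ^ 2 * g x ^ 2 * h2 + 4 * f x * g x ^ 3 * h3 + g x ^ 4 * h4
    rw [hexp]
    nlinarith [mul_nonneg hA0 hB0, sq_nonneg B]

theorem expect_walsh_sq (a : Finset α → ℝ) :
    𝔼 x : α → Bool, walsh a (fun j => boolSign (x j)) ^ 2 = ∑ S, a S ^ 2 := by
  simpa [walsh_eq_partialWalsh] using expect_partialWalsh_sq univ a

theorem expect_walsh_pow_four_le {d : ℕ} {a : Finset α → ℝ} (ha : ∀ S, d < S.card → a S = 0) :
    𝔼 x : α → Bool, walsh a (fun j => boolSign (x j)) ^ 4 ≤ (3 ^ d * ∑ S, a S ^ 2) ^ 2 := by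
  have h := expect_partialWalsh_pow_four_le univ a
  simp only [← walsh_eq_partialWalsh, powerset_univ] at h
  refine h.trans (pow_le_pow_left₀ (sum_nonneg fun S _ => by positivity) ?_ 2)
  rw [mul_sum]
  refine sum_le_sum fun S _ => ?_
  by_cases hS : d < S.card
  · simp [ha S hS]
  · gcongr
    · norm_num
    · omega

theorem expect_rpow_mul_rpow_le {ι : Type*} [Fintype ι] [Nonempty ι] {f g : ι → ℝ} {a b : ℝ}
    (hf : ∀ i, 0 ≤ f i) (hg : ∀ i, 0 ≤ g i) (ha : 0 < a) (hb : 0 < b) (hab : a + b = 1) :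
    𝔼 i, f i ^ a * g i ^ b ≤ (𝔼 i, f i) ^ a * (𝔼 i, g i) ^ b := by
  simp only [Fintype.expect_eq_sum_div_card]
  have hN : (0 : ℝ) < Fintype.card ι := by exact_mod_cast Fintype.card_pos
  rw [Real.div_rpow (sum_nonneg fun i _ => hf i) hN.le,
    Real.div_rpow (sum_nonneg fun i _ => hg i) hN.le, div_mul_div_comm, ← Real.rpow_add hN, hab,
    Real.rpow_one]
  gcongr
  exact sum_rpow_mul_rpow_le univ (fun i _ => hf i) (fun i _ => hg i) ha hb hab

/-- A comparison of the `L²` and `L^(2k/(k+1))` norms given one of the `L⁴` and `L²` norms. -/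
theorem expect_sq_rpow_le {ι : Type*} [Fintype ι] [Nonempty ι] {k : ℕ} (hk : 1 ≤ k)
    {c : ι → ℝ} {L : ℝ} (hL : 0 ≤ L) (h4 : 𝔼 i, c i ^ 4 ≤ (L * 𝔼 i, c i ^ 2) ^ 2) :
    (𝔼 i, c i ^ 2) ^ (bhExp k / 2) ≤ L ^ (2 / ((k : ℝ) + 1)) * 𝔼 i, |c i| ^ bhExp k := by
  have hk1 : (1 : ℝ) ≤ k := by exact_mod_cast hk
  have hq := bhExp_pos hk
  set u := 𝔼 i, c i ^ 2 with hu
  set W := 𝔼 i, |c i| ^ bhExp k with hW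
  have hu0 : 0 ≤ u := expect_nonneg fun i _ => sq_nonneg _
  have hW0 : 0 ≤ W := expect_nonneg fun i _ => by positivity
  rcases hu0.eq_or_lt with h0 | hupos
  · rw [← h0, Real.zero_rpow (by positivity)]; positivity
  have h1 := expect_rpow_mul_rpow_le (f := fun i => |c i| ^ bhExp k) (g := fun i => c i ^ 4)
    (a := (k + 1) / (k + 2)) (b := 1 / (k + 2)) (fun i => by positivity) (fun i => by positivity)
    (by positivity) (by positivity) (by field_simp; ring)
  have e : ∀ i, (|c i| ^ bhExp k) ^ ((k + 1) / (k + 2) : ℝ) * (c i ^ 4) ^ (1 / (k + 2) : ℝ)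
      = c i ^ 2 := fun i => by
    have : c i ^ 4 = |c i| ^ (4 : ℝ) := by
      rw [← Even.pow_abs (by decide : Even 4)]; norm_cast
    rw [this, ← Real.rpow_mul (abs_nonneg _), ← Real.rpow_mul (abs_nonneg _),
      ← Real.rpow_add_of_nonneg (abs_nonneg _) (by positivity) (by positivity),
      show bhExp k * ((k + 1) / (k + 2)) + 4 * (1 / (k + 2)) = (2 : ℝ) by
        unfold bhExp; field_simp; ring, Real.rpow_two, sq_abs]
  simp only [e] at h1
  have h2 : u ≤ W ^ ((k + 1) / (k + 2) : ℝ) * (L ^ (2 / (k + 2) : ℝ) * u ^ (2 / (k + 2) : ℝ)) := by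
    refine h1.trans ?_
    gcongr
    calc (𝔼 i, c i ^ 4) ^ (1 / (k + 2) : ℝ) ≤ ((L * u) ^ 2) ^ (1 / (k + 2) : ℝ) :=
          Real.rpow_le_rpow (expect_nonneg fun i _ => by positivity) h4 (by positivity)
      _ = _ := by
        rw [← Real.mul_rpow hL hu0, ← Real.rpow_natCast, ← Real.rpow_mul (by positivity)]
        congr 1; push_cast; ring
  have h3 : u ^ (k / (k + 2) : ℝ) ≤ W ^ ((k + 1) / (k + 2) : ℝ) * L ^ (2 / (k + 2) : ℝ) := by
    have hpos : 0 < u ^ (2 / (k + 2) : ℝ) := by positivity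
    refine le_of_mul_le_mul_right ?_ hpos
    rw [← Real.rpow_add hupos, show (k / (k + 2) + 2 / (k + 2) : ℝ) = 1 by field_simp,
      Real.rpow_one]
    linarith
  have h4 := Real.rpow_le_rpow (by positivity) h3 (by positivity : (0 : ℝ) ≤ (k + 2) / (k + 1))
  rw [← Real.rpow_mul hu0, Real.mul_rpow (by positivity) (by positivity), ← Real.rpow_mul hW0,
    ← Real.rpow_mul hL] at h4
  convert h4 using 1
  · congr 1; unfold bhExp; field_simp
  · rw [show ((k + 1) / (k + 2) * ((k + 2) / (k + 1)) : ℝ) = 1 by field_simp, Real.rpow_one,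
      mul_comm]
    congr 2; field_simp

theorem walsh_eq_sum_cube (a : Finset α → ℝ) (z : α → ℝ) :
    walsh a z = ∑ x : α → Bool,
      (∏ j, (1 + boolSign (x j) * z j) / 2) * walsh a (fun j => boolSign (x j)) := by
  have key : ∀ w : α → Bool → ℝ, ∏ j, ∑ b, w j b = ∑ x : α → Bool, ∏ j, w j (x j) := fun w => by
    rw [prod_univ_sum, Fintype.piFinset_univ]
  simp only [walsh, mul_sum]
  rw [sum_comm]
  refine sum_congr rfl fun S _ => ?_
  have h := key fun j b => (1 + boolSign b * z j) / 2 * if j ∈ S then boolSign b else 1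
  have e : ∀ j, ∑ b, (1 + boolSign b * z j) / 2 * (if j ∈ S then boolSign b else 1)
      = if j ∈ S then z j else 1 := fun j => by
    split_ifs <;> simp [boolSign] <;> ring
  simp only [e, prod_ite_mem, univ_inter, prod_mul_distrib] at h
  rw [h, mul_sum]
  refine sum_congr rfl fun x _ => ?_
  ring

/-- A multilinear polynomial takes its extreme values on `[-1,1]^n` at the vertices. -/
theorem abs_walsh_le {a : Finset α → ℝ} {M : ℝ}
    (hM : ∀ x : α → Bool, |walsh a (fun j => boolSign (x j))| ≤ M) {z : α → ℝ}
    (hz : ∀ j, |z j| ≤ 1) : |walsh a z| ≤ M := by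
  have hw : ∀ x : α → Bool, 0 ≤ ∏ j, (1 + boolSign (x j) * z j) / 2 := fun x =>
    prod_nonneg fun j _ => by
      have : |boolSign (x j) * z j| ≤ 1 := by rw [abs_mul, abs_boolSign, one_mul]; exact hz j
      have := (abs_le.1 this).1
      linarith
  have h1 : ∑ x : α → Bool, ∏ j, (1 + boolSign (x j) * z j) / 2 = 1 := by
    have := walsh_eq_sum_cube (fun S => if S = ∅ then 1 else 0) z
    simpa [walsh] using this.symm
  rw [walsh_eq_sum_cube]
  calc _ ≤ ∑ x : α → Bool, |(∏ j, (1 + boolSign (x j) * z j) / 2)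
          * walsh a (fun j => boolSign (x j))| := abs_sum_le_sum_abs _ _
    _ ≤ ∑ x : α → Bool, (∏ j, (1 + boolSign (x j) * z j) / 2) * M := by
      refine sum_le_sum fun x _ => ?_
      rw [abs_mul, abs_of_nonneg (hw x)]
      exact mul_le_mul_of_nonneg_left (hM x) (hw x)
    _ = M := by rw [← sum_mul, h1, one_mul]

end Cube

section Extraction

open Polynomial in
/-- V. A. Markov's inequality for the Taylor coefficients at the end point `1`. -/
theorem factorial_mul_abs_coeff_le {d k : ℕ} (hk : k ≤ d) {b : ℕ → ℝ} {M : ℝ} (hM : 0 < M)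
    (hb : ∀ t ∈ Set.Icc (-1 : ℝ) 1, |∑ i ∈ range (d + 1), b i * (t - 1) ^ i| ≤ M) :
    k.factorial * |b k| ≤ (d : ℝ) ^ (2 * k) * M := by
  set P : ℝ[X] := ∑ i ∈ range (d + 1), C (b i) * (X - C 1) ^ i with hP
  have hPe : ∀ t, P.eval t = ∑ i ∈ range (d + 1), b i * (t - 1) ^ i := fun t => by
    simp [hP, eval_finsetSum]
  have hdeg : P.degree ≤ d := by
    refine (degree_sum_le _ _).trans (Finset.sup_le fun i hi => ?_)
    refine degree_le_of_natDegree_le ((natDegree_C_mul_le _ _).trans ?_)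
    rw [natDegree_pow, natDegree_X_sub_C, mul_one]
    exact Nat.lt_succ_iff.1 (mem_range.1 hi)
  have hder : (derivative^[k] P).eval 1 = k.factorial * b k := by
    rw [hP, iterate_derivative_sum, eval_finsetSum, sum_eq_single_of_mem k
      (mem_range.2 (Nat.lt_succ_iff.2 hk))]
    · rw [iterate_derivative_C_mul, iterate_derivative_X_sub_pow_self]; simp [mul_comm]
    · intro i _ hik
      rw [iterate_derivative_C_mul, iterate_derivative_X_sub_pow]
      rcases lt_or_gt_of_ne hik with h | h
      · simp [Nat.descFactorial_eq_zero_iff_lt.2 h]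
      · simp [Nat.sub_ne_zero_of_lt h]
  have hT : (derivative^[k] (Chebyshev.T ℝ d)).eval 1 ≤ (d : ℝ) ^ (2 * k) := by
    rw [Chebyshev.iterate_derivative_T_eval_one_eq_div]
    push_cast
    rw [← prod_div_distrib, pow_mul, ← card_range k, ← prod_const, card_range]
    refine prod_le_prod (fun l hl => ?_) fun l hl => ?_
    · have : (l : ℝ) ≤ d := by exact_mod_cast (mem_range.1 hl).le.trans hk
      refine div_nonneg ?_ (by positivity)
      nlinarith [(Nat.cast_nonneg l : (0 : ℝ) ≤ l)]
    · rw [div_le_iff₀ (by positivity)]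
      nlinarith [sq_nonneg (l : ℝ), mul_nonneg (sq_nonneg (d : ℝ)) (Nat.cast_nonneg (α := ℝ) l)]
  have main : ∀ c : ℝ, |c| = 1 → c * (k.factorial * b k) ≤ (d : ℝ) ^ (2 * k) * M := fun c hc => by
    have h := Chebyshev.eval_iterate_derivative_le_of_forall_abs_le_one (n := d)
      (P := C (c / M) * P) (k := k) le_rfl (degree_le_of_natDegree_le ((natDegree_C_mul_le _ _).trans
        (natDegree_le_iff_degree_le.2 hdeg))) fun t ht => by
        rw [eval_mul, eval_C, hPe, abs_mul, abs_div, hc, abs_of_pos hM, one_div_mul_eq_div,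
          div_le_one hM]
        exact hb t ht
    rw [iterate_derivative_C_mul, eval_mul, eval_C, hder] at h
    have h := h.trans hT
    rwa [div_mul_eq_mul_div, div_le_iff₀ hM] at h
  have h1 := main 1 (by simp)
  have h2 := main (-1) (by simp)
  rw [← abs_of_nonneg (Nat.cast_nonneg (α := ℝ) k.factorial), ← abs_mul]
  exact abs_le.2 ⟨by linarith, by linarith⟩

variable {α : Type*} [Fintype α]

theorem sum_eq_sum_powersetCard {d : ℕ} {f : Finset α → ℝ} (hf : ∀ S, d < S.card → f S = 0) :
    ∑ S, f S = ∑ i ∈ range (d + 1), ∑ S ∈ powersetCard i univ, f S := by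
  rw [← sum_subset (filter_subset (fun S : Finset α => S.card ≤ d) univ)
      fun S _ hS => hf S (by simpa using hS),
    ← sum_fiberwise_of_maps_to (g := fun S : Finset α => S.card) (t := range (d + 1))
      fun S hS => mem_range.2 (Nat.lt_succ_iff.2 (mem_filter.1 hS).2)]
  refine sum_congr rfl fun i hi => sum_congr ?_ fun S _ => rfl
  have := Nat.lt_succ_iff.1 (mem_range.1 hi)
  ext S
  simp only [mem_filter, mem_univ, true_and, mem_powersetCard_univ]
  omega

/-- A bounded polynomial of degree one has absolutely summable coefficients. -/
theorem sum_abs_le_of_degree_one {a : Finset α → ℝ} (ha : ∀ S, 1 < S.card → a S = 0) {M : ℝ}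
    (hM : ∀ x : α → Bool, |walsh a (fun j => boolSign (x j))| ≤ M) : ∑ S, |a S| ≤ M := by
  obtain ⟨s, hs, hs0⟩ : ∃ s : ℝ, |s| = 1 ∧ s * a ∅ = |a ∅| := by
    rcases le_total 0 (a ∅) with h | h
    · exact ⟨1, by simp, by rw [abs_of_nonneg h, one_mul]⟩
    · exact ⟨-1, by simp, by rw [abs_of_nonpos h]; ring⟩
  set x : α → Bool := fun j => decide (0 ≤ s * a {j}) with hx
  have h : s * walsh a (fun j => boolSign (x j)) = ∑ S, |a S| := by
    rw [walsh, mul_sum]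
    refine sum_congr rfl fun S _ => ?_
    rcases Nat.lt_or_ge 1 S.card with h | h
    · simp [ha S h]
    rcases Nat.le_one_iff_eq_zero_or_eq_one.1 h with h | h
    · rw [card_eq_zero] at h
      subst h
      simpa using hs0
    · obtain ⟨j, rfl⟩ := card_eq_one.1 h
      rw [prod_singleton, ← mul_assoc]
      have e : |a {j}| = |s * a {j}| := by rw [abs_mul, hs, one_mul]
      rw [e]
      by_cases hj : 0 ≤ s * a {j}
      · simp [hx, boolSign, hj, abs_of_nonneg hj]
      · simp [hx, boolSign, hj, abs_of_neg (not_le.1 hj)]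
  rw [← h]
  refine (le_abs_self _).trans ?_
  rw [abs_mul, hs, one_mul]
  exact hM x

variable [DecidableEq α]

theorem sum_superset_eq (T : Finset α) (g : Finset α → ℝ) :
    ∑ S, (if T ⊆ S then g S else 0) = ∑ V, if Disjoint T V then g (T ∪ V) else 0 := by
  rw [← sum_filter, ← sum_filter]
  refine sum_nbij' (· \ T) (T ∪ ·) ?_ ?_ ?_ ?_ ?_
  · intro S _; simp [disjoint_sdiff]
  · intro V _; simp
  · intro S hS; simpa using (mem_filter.1 hS).2
  · intro V hV; exact union_sdiff_cancel_left (mem_filter.1 hV).2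
  · intro S hS; rw [union_sdiff_of_subset (mem_filter.1 hS).2]

theorem walsh_add (a : Finset α → ℝ) (u v : α → ℝ) :
    walsh a (fun j => v j + u j) = ∑ T, (∏ j ∈ T, v j) * walsh (linkSet T a) u := by
  have h1 : walsh a (fun j => v j + u j)
      = ∑ S : Finset α, ∑ T : Finset α, if T ⊆ S then a S * ((∏ j ∈ T, v j) * ∏ j ∈ S \ T, u j) else 0 := by
    unfold walsh
    refine sum_congr rfl fun S _ => ?_
    rw [prod_add, mul_sum, ← sum_filter]
    refine sum_congr ?_ fun _ _ => rfl
    ext T; simp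
  rw [h1, sum_comm]
  refine sum_congr rfl fun T _ => ?_
  rw [sum_superset_eq T, walsh, mul_sum]
  refine sum_congr rfl fun V _ => ?_
  unfold linkSet
  split_ifs with h
  · rw [union_sdiff_cancel_left h]; ring
  · simp

/-- The `k`-homogeneous part of the expansion of a bounded polynomial around a point of
`[-(1-δ), 1-δ]^n` is bounded on the cube. -/
theorem abs_sum_prod_mul_walsh_linkSet_le {d k : ℕ} (hk : k ≤ d) {a : Finset α → ℝ}
    (ha : ∀ S, d < S.card → a S = 0) {M : ℝ} (hM0 : 0 < M)
    (hM : ∀ x : α → Bool, |walsh a (fun j => boolSign (x j))| ≤ M) {δ : ℝ} (hδ : 0 < δ)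
    {u v : α → ℝ} (hu : ∀ j, |u j| ≤ 1 - δ) (hv : ∀ j, |v j| ≤ 1) :
    |∑ T ∈ powersetCard k univ, (∏ j ∈ T, v j) * walsh (linkSet T a) u|
      ≤ (2 * d ^ 2 / δ) ^ k * M := by
  set c : ℕ → ℝ := fun i => ∑ T ∈ powersetCard i univ, (∏ j ∈ T, v j) * walsh (linkSet T a) u
    with hc
  have hexp : ∀ t : ℝ, walsh a (fun j => (δ / 2 * (t - 1)) * v j + u j)
      = ∑ i ∈ range (d + 1), ((δ / 2) ^ i * c i) * (t - 1) ^ i := fun t => by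
    rw [walsh_add, sum_eq_sum_powersetCard (d := d) fun T hT => by
      rw [walsh, sum_eq_zero fun V _ => by rw [linkSet_eq_zero ha (by omega), zero_mul], mul_zero]]
    refine sum_congr rfl fun i _ => ?_
    rw [hc, mul_sum, sum_mul]
    refine sum_congr rfl fun T hT => ?_
    rw [prod_mul_distrib, prod_const, (mem_powersetCard.1 hT).2, mul_pow]; ring
  have h := factorial_mul_abs_coeff_le hk hM0 (b := fun i => (δ / 2) ^ i * c i) fun t ht => by
    rw [← hexp]
    refine abs_walsh_le hM fun j => ?_
    have h1 : |(δ / 2 * (t - 1)) * v j| ≤ δ := by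
      rw [abs_mul, abs_mul, abs_of_pos (half_pos hδ)]
      have h2 : |t - 1| ≤ 2 := abs_le.2 ⟨by linarith [ht.1], by linarith [ht.2]⟩
      calc δ / 2 * |t - 1| * |v j| ≤ δ / 2 * 2 * 1 := by gcongr; exact hv j
        _ = δ := by ring
    calc _ ≤ |(δ / 2 * (t - 1)) * v j| + |u j| := abs_add_le _ _
      _ ≤ 1 := by linarith [hu j]
  have hf : (1 : ℝ) ≤ k.factorial := by exact_mod_cast k.factorial_pos
  rw [abs_mul, abs_of_pos (by positivity : 0 < (δ / 2) ^ k)] at h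
  have h3 : (δ / 2) ^ k * |c k| ≤ (d : ℝ) ^ (2 * k) * M :=
    le_trans (le_mul_of_one_le_left (by positivity) hf) h
  have h4 : (2 * (d : ℝ) ^ 2 / δ) ^ k * M = ((d : ℝ) ^ (2 * k) * M) / (δ / 2) ^ k := by
    rw [show 2 * (d : ℝ) ^ 2 / δ = d ^ 2 / (δ / 2) by field_simp, div_pow, ← pow_mul]; ring
  rw [h4, le_div_iff₀ (by positivity), mul_comm]
  exact h3

end Extraction

section Bound

variable (α : Type*) [Fintype α]

/-- The Bohnenblust–Hille inequality, with constant `K`, for the `m`-homogeneous part of the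
polynomials of degree at most `d`. -/
def HasBHBound (d m : ℕ) (K : ℝ) : Prop :=
  ∀ a : Finset α → ℝ, (∀ S, d < S.card → a S = 0) → ∀ M : ℝ, 0 < M →
    (∀ x : α → Bool, |walsh a (fun j => boolSign (x j))| ≤ M) →
      ∑ S ∈ powersetCard m univ, |a S| ^ bhExp m ≤ (K * M) ^ bhExp m

variable {α}

theorem HasBHBound.mono {d m : ℕ} (hm : 1 ≤ m) {K K' : ℝ} (hK : 0 ≤ K) (h : HasBHBound α d m K)
    (hKK' : K ≤ K') : HasBHBound α d m K' := fun a ha M hM hb =>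
  (h a ha M hM hb).trans <| Real.rpow_le_rpow (by positivity)
    (mul_le_mul_of_nonneg_right hKK' hM.le) (bhExp_pos hm).le

theorem hasBHBound_one : HasBHBound α 1 1 1 := fun a ha M _ hb => by
  have e : bhExp 1 = 1 := by norm_num [bhExp]
  simp only [e, Real.rpow_one, one_mul]
  exact (sum_le_sum_of_subset_of_nonneg (subset_univ _) fun S _ _ => abs_nonneg _).trans
    (sum_abs_le_of_degree_one ha hb)

variable [DecidableEq α]

theorem HasBHBound.sum_walsh_linkSet_le {d k : ℕ} (hd : 1 ≤ d) (hk : k ≤ d) {H : ℝ}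
    (hH : HasBHBound α k k H) {a : Finset α → ℝ} (ha : ∀ S, d < S.card → a S = 0) {M : ℝ}
    (hM : 0 < M) (hb : ∀ x : α → Bool, |walsh a (fun j => boolSign (x j))| ≤ M) {δ : ℝ}
    (hδ : 0 < δ) {u : α → ℝ} (hu : ∀ j, |u j| ≤ 1 - δ) :
    ∑ T ∈ powersetCard k univ, |walsh (linkSet T a) u| ^ bhExp k
      ≤ (H * ((2 * d ^ 2 / δ) ^ k * M)) ^ bhExp k := by
  have hd0 : (0 : ℝ) < d := by exact_mod_cast hd
  have h := hH (fun T => if T ∈ powersetCard k univ then walsh (linkSet T a) u else 0)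
    (fun S hS => if_neg fun h => by rw [(mem_powersetCard.1 h).2] at hS; omega)
    ((2 * d ^ 2 / δ) ^ k * M) (by positivity) fun x => by
      refine (le_of_eq ?_).trans (abs_sum_prod_mul_walsh_linkSet_le hk ha hM hb hδ hu
        (v := fun j => boolSign (x j)) fun j => (abs_boolSign _).le)
      congr 1
      rw [walsh, ← sum_subset (subset_univ (powersetCard k univ))
        fun S _ hS => by rw [if_neg hS, zero_mul]]
      exact sum_congr rfl fun S hS => by rw [if_pos hS, mul_comm]
  rwa [sum_congr rfl fun S hS => by rw [if_pos hS]] at h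

/-- The bound for `k`-homogeneous polynomials yields one for every homogeneous part of higher
degree. -/
theorem HasBHBound.of_le {d k m : ℕ} (hk : 1 ≤ k) (hkm : k ≤ m) (hmd : m ≤ d) {H : ℝ} (hH0 : 0 ≤ H)
    (hH : HasBHBound α k k H) {δ : ℝ} (hδ : 0 < δ) (hδ1 : δ < 1) :
    HasBHBound α d m
      (k.factorial * (3 ^ ((d : ℝ) / k) * (H * (2 * d ^ 2 / δ) ^ k) / (1 - δ) ^ d)) := by
  intro a ha M hM hb
  have hd : 1 ≤ d := by omega
  have hk0 : (0 : ℝ) < k := by exact_mod_cast hk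
  have hq := bhExp_pos hk
  have hρ : 0 < 1 - δ := by linarith
  set R := H * ((2 * (d : ℝ) ^ 2 / δ) ^ k * M) with hR
  have hR0 : 0 ≤ R := by positivity
  set e : Finset α → Finset α → ℝ := fun T V => linkSet T a V * (1 - δ) ^ V.card with he
  have hce : ∀ (T : Finset α) (y : α → Bool), walsh (linkSet T a) (fun j => (1 - δ) * boolSign (y j))
      = walsh (e T) (fun j => boolSign (y j)) := fun T y => by
    unfold walsh
    refine sum_congr rfl fun V _ => ?_
    rw [prod_mul_distrib, prod_const]; ring
  have h1 : ∀ y : α → Bool, ∑ T ∈ powersetCard k univ,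
      |walsh (e T) (fun j => boolSign (y j))| ^ bhExp k ≤ R ^ bhExp k := fun y => by
    simp only [← hce]
    exact hH.sum_walsh_linkSet_le hd (hkm.trans hmd) ha hM hb hδ fun j => by
      rw [abs_mul, abs_boolSign, mul_one, abs_of_pos hρ]
  have h2 : ∀ T : Finset α, (1 - δ) ^ (2 * d) *
      ∑ V ∈ powersetCard (m - k) univ, linkSet T (fun S => a S ^ 2) V
        ≤ 𝔼 y : α → Bool, walsh (e T) (fun j => boolSign (y j)) ^ 2 := fun T => by
    rw [expect_walsh_sq, mul_sum]
    refine (sum_le_sum fun V hV => ?_).trans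
      (sum_le_sum_of_subset_of_nonneg (subset_univ _) fun V _ _ => sq_nonneg _)
    have e1 : linkSet T (fun S => a S ^ 2) V = linkSet T a V ^ 2 := by
      unfold linkSet; split_ifs <;> simp
    have hV : V.card ≤ d := by rw [(mem_powersetCard.1 hV).2]; omega
    rw [he, mul_pow, e1, mul_comm, ← pow_mul, mul_comm _ 2]
    exact mul_le_mul_of_nonneg_left
      (pow_le_pow_of_le_one hρ.le (by linarith) (by omega)) (sq_nonneg _)
  set X : Finset α → ℝ := fun T =>
    ∑ V ∈ powersetCard (m - k) univ, linkSet T (fun S => a S ^ 2) V with hX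
  have hX0 : ∀ T, 0 ≤ X T := fun T =>
    sum_nonneg fun V _ => linkSet_nonneg (fun S => sq_nonneg (a S)) T V
  have h3 : ∀ T : Finset α, ((1 - δ) ^ d) ^ bhExp k * X T ^ (bhExp k / 2)
      ≤ (3 ^ ((d : ℝ) / k)) ^ bhExp k *
        𝔼 y : α → Bool, |walsh (e T) (fun j => boolSign (y j))| ^ bhExp k := fun T => by
    have h := expect_sq_rpow_le hk (L := 3 ^ d) (by positivity) <| by
      have := expect_walsh_pow_four_le (a := e T) (d := d) fun V hV => by
        simp only [he, linkSet_eq_zero ha (show d < T.card + V.card by omega), zero_mul]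
      rwa [← expect_walsh_sq] at this
    have e3 : ((3 : ℝ) ^ d) ^ (2 / ((k : ℝ) + 1)) = (3 ^ ((d : ℝ) / k)) ^ bhExp k := by
      rw [← Real.rpow_natCast, ← Real.rpow_mul (by norm_num), ← Real.rpow_mul (by norm_num)]
      congr 1; unfold bhExp; field_simp
    rw [e3] at h
    refine le_trans ?_ h
    have e4 : ((1 - δ) ^ d) ^ bhExp k = ((1 - δ) ^ (2 * d)) ^ (bhExp k / 2) := by
      rw [mul_comm 2 d, pow_mul, ← Real.rpow_natCast ((1 - δ) ^ d) 2,
        ← Real.rpow_mul (by positivity)]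
      congr 1; push_cast; ring
    rw [e4, ← Real.mul_rpow (by positivity) (hX0 T)]
    exact Real.rpow_le_rpow (mul_nonneg (by positivity) (hX0 T)) (h2 T) (by positivity)
  have h4 : ((1 - δ) ^ d) ^ bhExp k * ∑ T ∈ powersetCard k univ, X T ^ (bhExp k / 2)
      ≤ (3 ^ ((d : ℝ) / k)) ^ bhExp k * R ^ bhExp k := by
    rw [mul_sum]
    refine (sum_le_sum fun T _ => h3 T).trans ?_
    rw [← mul_sum, ← expect_sum_comm]
    gcongr
    exact expect_le univ_nonempty fun y _ => h1 y
  have h5 := sum_rpow_le_of_mixed hk hkm a (N := 3 ^ ((d : ℝ) / k) * R / (1 - δ) ^ d)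
    (by positivity) (by
      rw [Real.div_rpow (by positivity) (by positivity), Real.mul_rpow (by positivity) hR0,
        le_div_iff₀ (by positivity), mul_comm]
      exact h4)
  refine h5.trans_eq ?_
  congr 1
  rw [hR]; ring

theorem hasBHBound_self {k : ℕ} (hk : 1 ≤ k) : HasBHBound α k k (4 * k ^ 2 * 6 ^ k) := by
  have h := (hasBHBound_one (α := α)).of_le le_rfl hk le_rfl (δ := 1 / 2) zero_le_one
    (by norm_num) (by norm_num)
  convert h using 1
  have h2 : (1 - 1 / 2 : ℝ) ^ k = 1 / 2 ^ k := by rw [← one_div_pow]; norm_num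
  have h6 : (6 : ℝ) ^ k = 3 ^ k * 2 ^ k := by rw [← mul_pow]; norm_num
  rw [h2, h6, Nat.cast_one, div_one, Real.rpow_natCast]
  norm_num
  ring

theorem hasBHBound_of_one_le {d m : ℕ} (hm : 1 ≤ m) (hmd : m ≤ d) :
    HasBHBound α d m (4 * m ^ 2 * 6 ^ m * (2 * d ^ 2) ^ m) := by
  intro a ha M hM hb
  have h := (hasBHBound_self (α := α) hm).sum_walsh_linkSet_le (hm.trans hmd) hmd ha hM hb
    (u := 0) one_pos (by simp)
  have e : ∀ T, walsh (linkSet T a) 0 = a T := fun T => by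
    rw [walsh, sum_eq_single_of_mem ∅ (mem_univ _)]
    · simp [linkSet]
    · intro V _ hV
      obtain ⟨j, hj⟩ := nonempty_iff_ne_empty.2 hV
      rw [prod_eq_zero hj rfl, mul_zero]
  simpa only [e, div_one, mul_assoc] using h

end Bound

section Assembly

variable {α : Type*} [Fintype α]

theorem HasBHBound.sum_rpow_le {d m : ℕ} (hm : 1 ≤ m) (hmd : m ≤ d) {K : ℝ} (hK : 0 < K)
    (h : HasBHBound α d m K) {a : Finset α → ℝ} (ha : ∀ S, d < S.card → a S = 0) {M : ℝ}
    (hM : 0 < M) (hb : ∀ x : α → Bool, |walsh a (fun j => boolSign (x j))| ≤ M) :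
    ∑ S ∈ powersetCard m univ, |a S| ^ bhExp d ≤ (K * M) ^ bhExp d := by
  have h := h a ha M hM hb
  have hq := bhExp_pos hm
  have hqd := bhExp_mono hmd
  have hB : 0 < K * M := by positivity
  have hle : ∀ S ∈ powersetCard m univ, |a S| ≤ K * M := fun S hS =>
    (Real.rpow_le_rpow_iff (abs_nonneg _) hB.le hq).1 <|
      (single_le_sum (f := fun S => |a S| ^ bhExp m) (fun S _ => by positivity) hS).trans h
  calc ∑ S ∈ powersetCard m univ, |a S| ^ bhExp d
      ≤ ∑ S ∈ powersetCard m univ, |a S| ^ bhExp m * (K * M) ^ (bhExp d - bhExp m) :=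
        sum_le_sum fun S hS => by
          rw [show bhExp d = bhExp m + (bhExp d - bhExp m) by ring,
            Real.rpow_add_of_nonneg (abs_nonneg _) hq.le (by linarith)]
          simp only [add_sub_cancel_left]
          exact mul_le_mul_of_nonneg_left
            (Real.rpow_le_rpow (abs_nonneg _) (hle S hS) (by linarith)) (by positivity)
    _ ≤ (K * M) ^ bhExp m * (K * M) ^ (bhExp d - bhExp m) := by
        rw [← sum_mul]; gcongr
    _ = (K * M) ^ bhExp d := by rw [← Real.rpow_add hB]; congr 1; ring

theorem sum_rpow_rpow_inv_le {d : ℕ} (hd : 1 ≤ d) {K : ℝ} (hK : 1 ≤ K)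
    (h : ∀ m, 1 ≤ m → m ≤ d → HasBHBound α d m K) {a : Finset α → ℝ}
    (ha : ∀ S, d < S.card → a S = 0) {M : ℝ} (hM : 0 < M)
    (hb : ∀ x : α → Bool, |walsh a (fun j => boolSign (x j))| ≤ M) :
    (∑ S, |a S| ^ bhExp d) ^ (bhExp d)⁻¹ ≤ (d + 1) * K * M := by
  classical
  have hq := bhExp_pos hd
  have hK0 : 0 < K := by linarith
  have hm : ∀ m ∈ range (d + 1),
      ∑ S ∈ powersetCard m univ, |a S| ^ bhExp d ≤ (K * M) ^ bhExp d := fun m hm => by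
    have hmd := Nat.lt_succ_iff.1 (mem_range.1 hm)
    rcases Nat.eq_zero_or_pos m with rfl | hm0
    · have h0 : |walsh a 0| ≤ M := abs_walsh_le hb (by simp)
      have e : walsh a 0 = a ∅ := by
        rw [walsh, sum_eq_single_of_mem ∅ (mem_univ _)]
        · simp
        · intro V _ hV
          obtain ⟨j, hj⟩ := nonempty_iff_ne_empty.2 hV
          rw [prod_eq_zero hj rfl, mul_zero]
      rw [e] at h0
      rw [powersetCard_zero, sum_singleton]
      exact Real.rpow_le_rpow (abs_nonneg _) (h0.trans (le_mul_of_one_le_left hM.le hK)) hq.le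
    · exact (h m hm0 hmd).sum_rpow_le hm0 hmd hK0 ha hM hb
  rw [Real.rpow_inv_le_iff_of_pos (sum_nonneg fun S _ => by positivity) (by positivity) hq,
    sum_eq_sum_powersetCard (d := d) fun S hS => by rw [ha S hS, abs_zero, Real.zero_rpow hq.ne']]
  refine (sum_le_sum hm).trans ?_
  rw [sum_const, card_range, nsmul_eq_mul, mul_assoc,
    Real.mul_rpow (x := (d : ℝ) + 1) (by positivity) (by positivity)]
  push_cast
  refine mul_le_mul_of_nonneg_right ?_ (by positivity)
  exact Real.self_le_rpow_of_one_le (by linarith [(Nat.cast_nonneg d : (0 : ℝ) ≤ d)])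
    (one_le_bhExp hd)

variable [DecidableEq α]

theorem hasBHBound_pow_mul_exp {d k m : ℕ} (hd : 2 ≤ d) (hk : 1 ≤ k) (hkd : k ≤ d) (hm : 1 ≤ m)
    (hmd : m ≤ d) : HasBHBound α d m ((d : ℝ) ^ (13 * k) * Real.exp (3 * (d / k))) := by
  have hd2 : (2 : ℝ) ≤ d := by exact_mod_cast hd
  have hd0 : (0 : ℝ) < d := by linarith
  have hd1 : (1 : ℝ) ≤ d := by linarith
  have hk1 : (1 : ℝ) ≤ k := by exact_mod_cast hk
  have hk0 : (0 : ℝ) < k := by linarith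
  have hkd' : (k : ℝ) ≤ d := by exact_mod_cast hkd
  have h4 : ∀ l : ℕ, 1 ≤ l → l ≤ k → (4 : ℝ) * l ^ 2 * 6 ^ l ≤ (d : ℝ) ^ (7 * k) := fun l hl hlk => by
    have hl' : (l : ℝ) ≤ d := by exact_mod_cast hlk.trans hkd
    calc (4 : ℝ) * l ^ 2 * 6 ^ l ≤ ((d : ℝ) ^ 2 * (d : ℝ) ^ 2) * ((d : ℝ) ^ 3) ^ l := by
          gcongr
          · nlinarith
          · nlinarith [pow_le_pow_left₀ (by norm_num) hd2 3]
      _ = (d : ℝ) ^ (4 + 3 * l) := by ring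
      _ ≤ (d : ℝ) ^ (7 * k) := pow_le_pow_right₀ hd1 (by omega)
  rcases Nat.lt_or_ge m k with hmk | hkm
  · refine (hasBHBound_of_one_le hm hmd).mono hm (by positivity) ?_
    calc (4 : ℝ) * m ^ 2 * 6 ^ m * (2 * (d : ℝ) ^ 2) ^ m ≤ (d : ℝ) ^ (7 * k) * ((d : ℝ) * (d : ℝ) ^ 2) ^ m := by
          gcongr
          exact h4 m hm hmk.le
      _ = (d : ℝ) ^ (7 * k + 3 * m) := by ring
      _ ≤ (d : ℝ) ^ (13 * k) := pow_le_pow_right₀ hd1 (by omega)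
      _ ≤ (d : ℝ) ^ (13 * k) * Real.exp (3 * ((d : ℝ) / k)) :=
          le_mul_of_one_le_right (by positivity) (Real.one_le_exp (by positivity))
  · refine ((hasBHBound_self hk).of_le hk hkm hmd (δ := 1 / (k + 1)) (by positivity)
      (by positivity) (by rw [div_lt_one (by positivity)]; linarith)).mono hm ?_ ?_
    · have : 0 ≤ 1 - 1 / ((k : ℝ) + 1) := by
        rw [sub_nonneg, div_le_one (by positivity)]; linarith
      positivity
    have h1 : (k.factorial : ℝ) ≤ (d : ℝ) ^ k := by
      have : (k.factorial : ℝ) ≤ k ^ k := by exact_mod_cast Nat.factorial_le_pow k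
      exact this.trans (by gcongr)
    have h2 : (3 : ℝ) ^ ((d : ℝ) / k) ≤ Real.exp (2 * ((d : ℝ) / k)) := by
      rw [Real.exp_mul]
      refine Real.rpow_le_rpow (by norm_num) ?_ (by positivity)
      linarith [Real.add_one_le_exp 2]
    have h3 : (2 * (d : ℝ) ^ 2 / (1 / (k + 1))) ^ k ≤ (d : ℝ) ^ (5 * k) := by
      rw [div_div_eq_mul_div, div_one, pow_mul]
      gcongr
      calc 2 * (d : ℝ) ^ 2 * (k + 1) ≤ (d : ℝ) * (d : ℝ) ^ 2 * (d * d) := by gcongr; nlinarith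
        _ = (d : ℝ) ^ 5 := by ring
    have h5 : ((1 - 1 / ((k : ℝ) + 1)) ^ d)⁻¹ ≤ Real.exp ((d : ℝ) / k) := by
      have e : (1 - 1 / ((k : ℝ) + 1))⁻¹ = 1 / k + 1 := by
        rw [one_sub_div (by positivity), add_sub_cancel_right, inv_div]; field_simp; ring
      rw [← inv_pow, e, div_eq_mul_one_div (d : ℝ), Real.exp_nat_mul]
      gcongr
      exact Real.add_one_le_exp _
    have h0 : 0 ≤ ((1 - 1 / ((k : ℝ) + 1)) ^ d)⁻¹ := by
      have : 0 ≤ 1 - 1 / ((k : ℝ) + 1) := by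
        rw [sub_nonneg, div_le_one (by positivity)]; linarith
      positivity
    rw [div_eq_mul_inv]
    calc _ ≤ (d : ℝ) ^ k * (Real.exp (2 * ((d : ℝ) / k)) * ((d : ℝ) ^ (7 * k) * (d : ℝ) ^ (5 * k))
          * Real.exp ((d : ℝ) / k)) := by
          gcongr
          exact h4 k hk le_rfl
      _ = (d : ℝ) ^ k * (d : ℝ) ^ (7 * k) * (d : ℝ) ^ (5 * k) * (Real.exp (2 * ((d : ℝ) / k)) * Real.exp ((d : ℝ) / k)) := by ring
      _ = _ := by
        rw [← Real.exp_add, ← pow_add, ← pow_add]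
        congr 2 <;> ring

end Assembly

theorem exists_nat_pow_mul_exp_le {d : ℕ} (hd : 2 ≤ d) :
    ∃ k : ℕ, 1 ≤ k ∧ k ≤ d ∧ ((d : ℝ) + 1) * (d ^ (13 * k) * Real.exp (3 * (d / k)))
      ≤ Real.exp 33 ^ Real.sqrt (d * Real.log d) := by
  have hd2 : (2 : ℝ) ≤ d := by exact_mod_cast hd
  have hd0 : (0 : ℝ) < d := by linarith
  have hL2 : 1 / 2 < Real.log d :=
    lt_of_lt_of_le (by linarith [Real.log_two_gt_d9]) (Real.log_le_log (by norm_num) hd2)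
  have hLd : Real.log d ≤ d := (Real.log_le_sub_one_of_pos hd0).trans (by linarith)
  set L := Real.log d with hL
  have hL0 : 0 < L := by linarith
  set s := Real.sqrt (d * L) with hs
  set r := Real.sqrt (d / L) with hr
  have hr0 : 0 < r := Real.sqrt_pos.2 (by positivity)
  have hrL : r * L = s := by
    rw [hr, hs, ← Real.sqrt_mul_self hL0.le, ← Real.sqrt_mul (by positivity),
      Real.sqrt_mul_self hL0.le]
    congr 1; field_simp
  have hrs : r * s = d := by
    rw [hr, hs, ← Real.sqrt_mul (by positivity), ← Real.sqrt_mul_self hd0.le]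
    congr 1; rw [Real.sqrt_mul_self hd0.le]; field_simp
  have hLs : L ≤ s := Real.le_sqrt_of_sq_le (by nlinarith)
  have hk1 : 1 ≤ ⌈r⌉₊ := Nat.one_le_iff_ne_zero.2 (Nat.ceil_pos.2 hr0).ne'
  refine ⟨⌈r⌉₊, hk1, ?_, ?_⟩
  · rw [Nat.ceil_le, hr]
    refine Real.sqrt_le_iff.2 ⟨hd0.le, ?_⟩
    rw [div_le_iff₀ hL0]
    nlinarith
  have hrk : r ≤ ⌈r⌉₊ := Nat.le_ceil r
  have hkr : (⌈r⌉₊ : ℝ) ≤ r + 1 := (Nat.ceil_lt_add_one hr0.le).le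
  set k := ⌈r⌉₊ with hk
  have hk0 : (0 : ℝ) < k := by linarith
  have hkL : k * L ≤ 2 * s := by nlinarith
  have hdk : d / k ≤ s := by rw [div_le_iff₀ hk0, ← hrs]; nlinarith [Real.sqrt_nonneg (d * L)]
  have h1 : (d : ℝ) + 1 ≤ d ^ (2 * k) :=
    calc (d : ℝ) + 1 ≤ (d : ℝ) ^ 2 := by nlinarith
      _ ≤ (d : ℝ) ^ (2 * k) := pow_le_pow_right₀ (by linarith) (by omega)
  have hpow : (d : ℝ) ^ (15 * k) = Real.exp (15 * (k * L)) := by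
    rw [← Real.exp_log (pow_pos hd0 _), Real.log_pow, hL]
    push_cast; congr 1; ring
  calc ((d : ℝ) + 1) * (d ^ (13 * k) * Real.exp (3 * ((d : ℝ) / k)))
      ≤ (d : ℝ) ^ (2 * k) * ((d : ℝ) ^ (13 * k) * Real.exp (3 * ((d : ℝ) / k))) := by gcongr
    _ = (d : ℝ) ^ (15 * k) * Real.exp (3 * ((d : ℝ) / k)) := by ring
    _ = Real.exp (15 * (k * L) + 3 * ((d : ℝ) / k)) := by rw [hpow, Real.exp_add]
    _ ≤ Real.exp (33 * s) := Real.exp_le_exp.2 (by linarith)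
    _ = Real.exp 33 ^ s := Real.exp_mul _ _

/-- Boolean Bohnenblust–Hille inequality: for every `d ≥ 1` there is a constant `C(d) > 0`
such that for all `n ≥ 1` and every `f : {-1,1}ⁿ → ℝ` of degree at most `d`
(given by its Fourier–Walsh coefficients `fhat`),
`‖f̂‖_{2d/(d+1)} ≤ C(d) · max_x |f(x)|`; moreover `C(d) ≤ C^√(d log d)` for a universal `C`. -/
theorem stmt0 :
    ∃ C : ℝ, 0 < C ∧ ∀ d : ℕ, 1 ≤ d →
      ∃ Cd : ℝ, 0 < Cd ∧ Cd ≤ C ^ Real.sqrt (d * Real.log d) ∧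
        ∀ n : ℕ, 1 ≤ n → ∀ fhat : Finset (Fin n) → ℝ,
          (∀ S : Finset (Fin n), d < S.card → fhat S = 0) →
          (∑ S : Finset (Fin n), |fhat S| ^ ((2 * (d : ℝ)) / ((d : ℝ) + 1)))
              ^ (((d : ℝ) + 1) / (2 * (d : ℝ)))
            ≤ Cd * ⨆ x : Fin n → Bool,
                |∑ S : Finset (Fin n), fhat S * ∏ j ∈ S, (if x j then (1 : ℝ) else -1)| := by
  have hbound : ∀ n : ℕ, ∀ fhat : Finset (Fin n) → ℝ, ∀ x : Fin n → Bool,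
      |walsh fhat (fun j => boolSign (x j))| ≤ ⨆ x : Fin n → Bool,
        |∑ S : Finset (Fin n), fhat S * ∏ j ∈ S, (if x j then (1 : ℝ) else -1)| :=
    fun n fhat x => le_ciSup (f := fun x : Fin n → Bool =>
      |∑ S : Finset (Fin n), fhat S * ∏ j ∈ S, (if x j then (1 : ℝ) else -1)|)
      (Set.finite_range _).bddAbove x
  refine ⟨Real.exp 33, Real.exp_pos _, fun d hd => ?_⟩
  rcases hd.eq_or_lt with rfl | hd2
  · refine ⟨1, one_pos, by simp, fun n _ fhat hdeg => ?_⟩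
    have := sum_abs_le_of_degree_one hdeg (hbound n fhat)
    norm_num
    exact this
  obtain ⟨k, hk, hkd, hC⟩ := exists_nat_pow_mul_exp_le hd2
  set K : ℝ := (d : ℝ) ^ (13 * k) * Real.exp (3 * (d / k)) with hK
  have hd1 : (1 : ℝ) ≤ d := by exact_mod_cast hd
  have hK1 : 1 ≤ K :=
    one_le_mul_of_one_le_of_one_le (one_le_pow₀ hd1) (Real.one_le_exp (by positivity))
  refine ⟨(d + 1) * K, by positivity, hC, fun n _ fhat hdeg => ?_⟩
  set M := ⨆ x : Fin n → Bool,
    |∑ S : Finset (Fin n), fhat S * ∏ j ∈ S, (if x j then (1 : ℝ) else -1)|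
  have hM : 0 ≤ M := (abs_nonneg _).trans (hbound n fhat fun _ => true)
  rw [← inv_div (2 * (d : ℝ))]
  have hlim : ∀ ε : ℝ, 0 < ε →
      (∑ S : Finset (Fin n), |fhat S| ^ bhExp d) ^ (bhExp d)⁻¹ ≤ (d + 1) * K * M + ε :=
    fun ε hε => by
      have h0 : 0 < (d + 1) * K := by positivity
      have h := sum_rpow_rpow_inv_le hd hK1
        (fun m hm hmd => hasBHBound_pow_mul_exp hd2 hk hkd hm hmd) hdeg
        (M := M + ε / ((d + 1) * K)) (by positivity)
        fun x => (hbound n fhat x).trans (le_add_of_nonneg_right (by positivity))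
      rwa [mul_add, mul_div_cancel₀ _ h0.ne'] at h
  exact le_of_forall_pos_le_add hlim
end

section
/- There exists a universal constant C > 0 such that for every n ≥ 1 and every complex matrix (a_{ij})_{1 ≤ i,j ≤ n}, one has (∑_{i,j=1}^{n} |a_{ij}|^{4/3})^{3/4} ≤ C · sup { |∑_{i,j=1}^{n} a_{ij} z_i w_j| : z, w ∈ ℂ^n with |z_i| ≤ 1 and |w_j| ≤ 1 for all i, j }. -/
open Finset

section Khintchine

theorem sum_units_fin_succ {n : ℕ} (f : (Fin (n + 1) → ℤˣ) → ℝ) :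
    ∑ ε, f ε = ∑ ε : Fin n → ℤˣ, (f (Fin.cons 1 ε) + f (Fin.cons (-1) ε)) := by
  rw [← (Fin.consEquiv fun _ : Fin (n + 1) => ℤˣ).sum_comp, Fintype.sum_prod_type, sum_comm]
  refine sum_congr rfl fun ε _ => ?_
  rw [show (univ : Finset ℤˣ) = {1, -1} from rfl, sum_pair (by decide)]
  rfl

theorem sum_norm_sq_rademacher {n : ℕ} (c : Fin n → ℂ) :
    ∑ ε : Fin n → ℤˣ, ‖∑ j, c j * ((ε j : ℤ) : ℂ)‖ ^ 2 = 2 ^ n * ∑ j, ‖c j‖ ^ 2 := by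
  induction n with
  | zero => simp
  | succ n ih =>
    have key : ∀ x y : ℂ, ‖x + y‖ ^ 2 + ‖-x + y‖ ^ 2 = 2 * ‖x‖ ^ 2 + 2 * ‖y‖ ^ 2 := by
      intro x y
      simp only [← Complex.normSq_eq_norm_sq, Complex.normSq_apply, Complex.add_re, Complex.add_im,
        Complex.neg_re, Complex.neg_im]
      ring
    rw [sum_units_fin_succ]
    simp only [Fin.sum_univ_succ, Fin.cons_zero, Fin.cons_succ, Units.val_one, Units.val_neg,
      Int.cast_one, Int.cast_neg, mul_one, mul_neg, key]
    rw [sum_add_distrib, ← mul_sum, ← mul_sum, ih fun j => c j.succ]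
    simp
    ring

theorem sum_norm_pow_four_rademacher_le {n : ℕ} (c : Fin n → ℂ) :
    ∑ ε : Fin n → ℤˣ, ‖∑ j, c j * ((ε j : ℤ) : ℂ)‖ ^ 4 ≤
      3 * 2 ^ n * (∑ j, ‖c j‖ ^ 2) ^ 2 := by
  induction n with
  | zero => simp
  | succ n ih =>
    have key : ∀ x y : ℂ, ‖x + y‖ ^ 4 + ‖-x + y‖ ^ 4 ≤
        2 * ‖x‖ ^ 4 + 12 * ‖x‖ ^ 2 * ‖y‖ ^ 2 + 2 * ‖y‖ ^ 4 := by
      intro x y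
      simp only [show ∀ z : ℂ, ‖z‖ ^ 4 = (‖z‖ ^ 2) ^ 2 from fun z => by ring,
        ← Complex.normSq_eq_norm_sq, Complex.normSq_apply, Complex.add_re, Complex.add_im,
        Complex.neg_re, Complex.neg_im]
      nlinarith [sq_nonneg (x.re * y.im - x.im * y.re)]
    rw [sum_units_fin_succ]
    simp only [Fin.sum_univ_succ, Fin.cons_zero, Fin.cons_succ, Units.val_one, Units.val_neg,
      Int.cast_one, Int.cast_neg, mul_one, mul_neg]
    refine (sum_le_sum fun ε _ => key _ _).trans ?_
    rw [sum_add_distrib, sum_add_distrib, ← mul_sum, ← mul_sum, ← mul_sum,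
      sum_norm_sq_rademacher fun j => c j.succ]
    have h4 := ih fun j => c j.succ
    simp only [sum_const, card_univ, Fintype.card_pi, prod_const, Fintype.card_units_int,
      Fintype.card_fin, nsmul_eq_mul, Nat.cast_pow, Nat.cast_ofNat]
    have : (0 : ℝ) ≤ 2 ^ n * ‖c 0‖ ^ 4 := by positivity
    rw [pow_succ (2 : ℝ) n]
    linarith

/-- Khintchine's inequality between the first and second moments of a Rademacher sum. -/
theorem sqrt_sum_norm_sq_le_rademacher {n : ℕ} (c : Fin n → ℂ) :
    2 ^ n * √(∑ j, ‖c j‖ ^ 2) ≤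
      2 * ∑ ε : Fin n → ℤˣ, ‖∑ j, c j * ((ε j : ℤ) : ℂ)‖ := by
  set σ := √(∑ j, ‖c j‖ ^ 2)
  have hσ2 : ∑ j, ‖c j‖ ^ 2 = σ ^ 2 := (Real.sq_sqrt (by positivity)).symm
  rcases (show 0 ≤ σ from Real.sqrt_nonneg _).eq_or_lt with h0 | hpos
  · rw [← h0, mul_zero]
    positivity
  have tangent : ∀ t : ℝ, 0 ≤ t → 12 * σ ^ 2 * t ^ 2 - t ^ 4 ≤ 16 * σ ^ 3 * t := by
    intro t ht
    have : 0 ≤ t * ((t - 2 * σ) ^ 2 * (t + 4 * σ)) := by positivity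
    linarith
  have h := sum_le_sum fun (ε : Fin n → ℤˣ) (_ : ε ∈ univ) =>
    tangent ‖∑ j, c j * ((ε j : ℤ) : ℂ)‖ (norm_nonneg _)
  rw [sum_sub_distrib, ← mul_sum, ← mul_sum, sum_norm_sq_rademacher, hσ2] at h
  have h4 := sum_norm_pow_four_rademacher_le c
  rw [hσ2] at h4
  have : 0 ≤ (2 : ℝ) ^ n * σ ^ 4 := by positivity
  refine le_of_mul_le_mul_left ?_ (pow_pos hpos 3)
  linarith

end Khintchine

theorem exists_norm_le_one_mul_eq_norm (s : ℂ) : ∃ u : ℂ, ‖u‖ ≤ 1 ∧ s * u = ‖s‖ := by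
  rcases eq_or_ne s 0 with rfl | hs
  · exact ⟨0, by simp, by simp⟩
  · have hs' : (‖s‖ : ℂ) ≠ 0 := by simpa using hs
    refine ⟨‖s‖ / s, ?_, by field_simp⟩
    simp [hs]

theorem sum_sqrt_sum_norm_sq_le {n : ℕ} {a : Fin n → Fin n → ℂ} {M : ℝ}
    (h : ∀ z w : Fin n → ℂ, (∀ i, ‖z i‖ ≤ 1) → (∀ j, ‖w j‖ ≤ 1) →
      ‖∑ i, ∑ j, a i j * z i * w j‖ ≤ M) :
    ∑ i, √(∑ j, ‖a i j‖ ^ 2) ≤ 2 * M := by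
  have row : ∀ ε : Fin n → ℤˣ, ∑ i, ‖∑ j, a i j * ((ε j : ℤ) : ℂ)‖ ≤ M := by
    intro ε
    choose u hu hsu using fun i => exists_norm_le_one_mul_eq_norm (∑ j, a i j * ((ε j : ℤ) : ℂ))
    have hε : ∀ j, ‖((ε j : ℤ) : ℂ)‖ ≤ 1 := fun j => by
      rcases Int.units_eq_one_or (ε j) with h | h <;> simp [h]
    have key := h u (fun j => ((ε j : ℤ) : ℂ)) hu hε
    have : ∑ i, ∑ j, a i j * u i * ((ε j : ℤ) : ℂ) =
        ((∑ i, ‖∑ j, a i j * ((ε j : ℤ) : ℂ)‖ : ℝ) : ℂ) := by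
      rw [Complex.ofReal_sum]
      refine sum_congr rfl fun i _ => ?_
      rw [← hsu, sum_mul]
      exact sum_congr rfl fun j _ => by ring
    rw [this, Complex.norm_of_nonneg (by positivity)] at key
    exact key
  have hM := sum_le_sum fun (ε : Fin n → ℤˣ) (_ : ε ∈ univ) => row ε
  rw [sum_comm] at hM
  simp only [sum_const, card_univ, Fintype.card_pi, prod_const, Fintype.card_units_int,
    Fintype.card_fin, nsmul_eq_mul, Nat.cast_pow, Nat.cast_ofNat] at hM
  have hK := sum_le_sum fun (i : Fin n) (_ : i ∈ univ) => sqrt_sum_norm_sq_le_rademacher (a i)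
  rw [← mul_sum, ← mul_sum] at hK
  refine le_of_mul_le_mul_left ?_ (pow_pos (two_pos : (0 : ℝ) < 2) n)
  linarith

theorem sum_rpow_third_mul_rpow_two_thirds_le {ι : Type*} (s : Finset ι) {f g : ι → ℝ}
    (hf : ∀ i, 0 ≤ f i) (hg : ∀ i, 0 ≤ g i) :
    ∑ i ∈ s, f i ^ ((1 : ℝ) / 3) * g i ^ ((2 : ℝ) / 3) ≤
      (∑ i ∈ s, f i) ^ ((1 : ℝ) / 3) * (∑ i ∈ s, g i) ^ ((2 : ℝ) / 3) := by
  have hpq : (3 : ℝ).HolderConjugate (3 / 2) := by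
    rw [Real.holderConjugate_iff]; norm_num
  have := Real.inner_le_Lp_mul_Lq_of_nonneg s hpq
    (fun i _ => Real.rpow_nonneg (hf i) ((1 : ℝ) / 3))
    (fun i _ => Real.rpow_nonneg (hg i) ((2 : ℝ) / 3))
  simp only [← Real.rpow_mul (hf _), ← Real.rpow_mul (hg _)] at this
  norm_num at this ⊢
  exact this

theorem sqrt_sum_sq_sum_le {ι κ : Type*} [Fintype ι] [Fintype κ] (b : ι → κ → ℝ) :
    √(∑ i, (∑ j, b i j) ^ 2) ≤ ∑ j, √(∑ i, b i j ^ 2) := by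
  have := norm_sum_le univ fun j => WithLp.toLp 2 fun i => b i j
  simpa [EuclideanSpace.norm_eq] using this

/-- Interpolation between the mixed `(1, 2)` norms by rows and by columns. -/
theorem sum_rpow_four_thirds_le {ι κ : Type*} [Fintype ι] [Fintype κ] {b : ι → κ → ℝ}
    (hb : ∀ i j, 0 ≤ b i j) {K : ℝ} (hrow : ∑ i, √(∑ j, b i j ^ 2) ≤ K)
    (hcol : ∑ j, √(∑ i, b i j ^ 2) ≤ K) :
    ∑ i, ∑ j, b i j ^ ((4 : ℝ) / 3) ≤ K ^ ((4 : ℝ) / 3) := by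
  have sq_rpow : ∀ x : ℝ, 0 ≤ x → (x ^ 2) ^ ((1 : ℝ) / 3) = x ^ ((2 : ℝ) / 3) := fun x hx => by
    rw [← Real.rpow_natCast_mul hx]; norm_num
  have split : ∀ x : ℝ, 0 ≤ x → x ^ ((4 : ℝ) / 3) = x ^ ((2 : ℝ) / 3) * x ^ ((2 : ℝ) / 3) :=
    fun x hx => by rw [← Real.rpow_add_of_nonneg hx] <;> norm_num
  have hK : 0 ≤ K := le_trans (by positivity) hrow
  have hβ : ∀ i, 0 ≤ ∑ j, b i j := fun i => sum_nonneg fun j _ => hb i j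
  calc ∑ i, ∑ j, b i j ^ ((4 : ℝ) / 3)
      ≤ ∑ i, ((∑ j, b i j) ^ 2) ^ ((1 : ℝ) / 3) * √(∑ j, b i j ^ 2) ^ ((2 : ℝ) / 3) := by
        refine sum_le_sum fun i _ => ?_
        have h := sum_rpow_third_mul_rpow_two_thirds_le univ
          (fun j => sq_nonneg (b i j)) (hb i)
        simp only [sq_rpow _ (hb i _), ← split _ (hb i _)] at h
        rwa [sq_rpow _ (hβ i), ← sq_rpow _ (Real.sqrt_nonneg _),
          Real.sq_sqrt (by positivity), mul_comm]
    _ ≤ (∑ i, (∑ j, b i j) ^ 2) ^ ((1 : ℝ) / 3) *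
          (∑ i, √(∑ j, b i j ^ 2)) ^ ((2 : ℝ) / 3) :=
        sum_rpow_third_mul_rpow_two_thirds_le univ (fun i => sq_nonneg _)
          fun i => Real.sqrt_nonneg _
    _ ≤ (K ^ 2) ^ ((1 : ℝ) / 3) * K ^ ((2 : ℝ) / 3) := by
        have : ∑ i, (∑ j, b i j) ^ 2 ≤ K ^ 2 :=
          (Real.sqrt_le_left hK).1 ((sqrt_sum_sq_sum_le b).trans hcol)
        gcongr
    _ = K ^ ((4 : ℝ) / 3) := by rw [sq_rpow K hK, split K hK]

theorem norm_bilin_le_iSup {n : ℕ} (a : Fin n → Fin n → ℂ) {z w : Fin n → ℂ}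
    (hz : ∀ i, ‖z i‖ ≤ 1) (hw : ∀ j, ‖w j‖ ≤ 1) :
    ‖∑ i, ∑ j, a i j * z i * w j‖ ≤
      ⨆ (z : Fin n → ℂ) (_ : ∀ i, ‖z i‖ ≤ 1) (w : Fin n → ℂ) (_ : ∀ j, ‖w j‖ ≤ 1),
        ‖∑ i : Fin n, ∑ j : Fin n, a i j * z i * w j‖ := by
  set K := ∑ i, ∑ j, ‖a i j‖
  have hK : 0 ≤ K := by positivity
  have bound : ∀ z w : Fin n → ℂ, (∀ i, ‖z i‖ ≤ 1) → (∀ j, ‖w j‖ ≤ 1) →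
      ‖∑ i, ∑ j, a i j * z i * w j‖ ≤ K := fun z w hz hw =>
    (norm_sum_le _ _).trans <| sum_le_sum fun i _ => (norm_sum_le _ _).trans <|
      sum_le_sum fun j _ => by
        rw [norm_mul, norm_mul, mul_assoc]
        exact mul_le_of_le_one_right (norm_nonneg _)
          (mul_le_one₀ (hz i) (norm_nonneg _) (hw j))
  have boundw : ∀ z : Fin n → ℂ, (∀ i, ‖z i‖ ≤ 1) → ∀ w : Fin n → ℂ,
      ⨆ (_ : ∀ j, ‖w j‖ ≤ 1), ‖∑ i, ∑ j, a i j * z i * w j‖ ≤ K :=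
    fun z hz w => Real.iSup_le (fun hw => bound z w hz hw) hK
  have boundz : ∀ z : Fin n → ℂ, ⨆ (_ : ∀ i, ‖z i‖ ≤ 1) (w : Fin n → ℂ) (_ : ∀ j, ‖w j‖ ≤ 1),
      ‖∑ i, ∑ j, a i j * z i * w j‖ ≤ K :=
    fun z => Real.iSup_le (fun hz => Real.iSup_le (boundw z hz) hK) hK
  refine le_trans ?_ (le_ciSup ⟨K, Set.forall_mem_range.2 boundz⟩ z)
  rw [ciSup_pos hz]
  refine le_trans ?_ (le_ciSup ⟨K, Set.forall_mem_range.2 (boundw z hz)⟩ w)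
  rw [ciSup_pos hw]

/-- Littlewood's 4/3 inequality: there is a universal constant `C > 0` such that for every
`n ≥ 1` and every complex matrix `(a i j)`,
`(∑_{i,j} |a i j|^{4/3})^{3/4} ≤ C · sup{|∑ a i j z i w j| : |z i| ≤ 1, |w j| ≤ 1}`. -/
theorem stmt3 :
    ∃ C : ℝ, 0 < C ∧ ∀ n : ℕ, 1 ≤ n → ∀ a : Fin n → Fin n → ℂ,
      (∑ i : Fin n, ∑ j : Fin n, ‖a i j‖ ^ ((4 : ℝ) / 3)) ^ ((3 : ℝ) / 4)
        ≤ C * ⨆ (z : Fin n → ℂ) (_ : ∀ i, ‖z i‖ ≤ 1) (w : Fin n → ℂ) (_ : ∀ j, ‖w j‖ ≤ 1),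
            ‖∑ i : Fin n, ∑ j : Fin n, a i j * z i * w j‖ := by
  refine ⟨2, two_pos, fun n _ a => ?_⟩
  have hM := fun z w hz hw => norm_bilin_le_iSup a (z := z) (w := w) hz hw
  set M := ⨆ (z : Fin n → ℂ) (_ : ∀ i, ‖z i‖ ≤ 1) (w : Fin n → ℂ) (_ : ∀ j, ‖w j‖ ≤ 1),
    ‖∑ i : Fin n, ∑ j : Fin n, a i j * z i * w j‖
  have hM' : ∀ z w : Fin n → ℂ, (∀ i, ‖z i‖ ≤ 1) → (∀ j, ‖w j‖ ≤ 1) →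
      ‖∑ i, ∑ j, a j i * z i * w j‖ ≤ M := fun z w hz hw => by
    rw [sum_comm]
    simpa only [mul_right_comm] using hM w z hw hz
  have hM0 : 0 ≤ M := (norm_nonneg _).trans (hM 0 0 (by simp) (by simp))
  calc (∑ i, ∑ j, ‖a i j‖ ^ ((4 : ℝ) / 3)) ^ ((3 : ℝ) / 4)
      ≤ ((2 * M) ^ ((4 : ℝ) / 3)) ^ ((3 : ℝ) / 4) := by
        gcongr
        exact sum_rpow_four_thirds_le (fun i j => norm_nonneg (a i j))
          (sum_sqrt_sum_norm_sq_le hM) (sum_sqrt_sum_norm_sq_le hM')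
    _ = 2 * M := by
        rw [← Real.rpow_mul (by positivity)]
        norm_num
end

section
/- Fix an integer d ≥ 1. There exists a constant C(d) > 0, depending only on d, such that for every n ≥ 1 and every analytic polynomial f(z) = ∑_{α ∈ ℕ_0^n, |α| ≤ d} c_α z^α of degree at most d, one has (∑_{|α| ≤ d} |c_α|^{2d/(d+1)})^{(d+1)/(2d)} ≤ C(d) · sup_{z ∈ 𝕋^n} |f(z)|. Moreover, there is a universal constant C > 0 such that C(d) can be taken at most C^{√(d log d)}. -/
open Finset

/-- A weighted form of Blei's inequality: if every index `a` is determined by its components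
`π B a`, then `ℓ²` control along the fibres of each component yields control of an `ℓ^q` sum. -/
lemma sum_rpow_le_prod_of_fiber_sum_sq_le {A X K : Type*} [Fintype K] [DecidableEq K]
    [DecidableEq X] (s : Finset A) (π : K → A → X) (T : K → Finset X)
    (hT : ∀ B, ∀ a ∈ s, π B a ∈ T B)
    (hinj : Set.InjOn (fun a B => π B a) s) (k : K → ℕ) (m : ℕ)
    (hk : ∑ B, k B = m) (x : A → ℝ) (hx : ∀ a ∈ s, 0 < x a) (u : K → X → ℝ)
    (hu0 : ∀ B y, 0 ≤ u B y)
    (hu : ∀ B y, ∑ a ∈ s with π B a = y, x a ^ 2 ≤ u B y ^ 2)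
    (V : K → ℝ) (hV : ∀ B, 0 < V B)
    (hUV : ∀ B, ∑ y ∈ T B, u B y ^ (2 * (k B : ℝ) / (k B + 1)) ≤ V B) :
    ∑ a ∈ s, x a ^ (2 * (m : ℝ) / (m + 1)) ≤ ∏ B, V B ^ (((k B : ℝ) + 1) / (m + 1)) := by
  have hm0 : (0 : ℝ) < m + 1 := by positivity
  have hkR : ∑ B, (k B : ℝ) = m := by exact_mod_cast hk
  have hupos : ∀ B, ∀ a ∈ s, 0 < u B (π B a) := by
    intro B a ha
    refine (hu0 B _).lt_of_ne' fun h0 => ?_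
    have h1 : x a ^ 2 ≤ ∑ a' ∈ s with π B a' = π B a, x a' ^ 2 :=
      single_le_sum (f := fun a' => x a' ^ 2) (fun _ _ => sq_nonneg _) (by simp [ha])
    have h2 := h1.trans (hu B (π B a))
    rw [h0] at h2
    nlinarith [hx a ha]
  let p : K → ℝ := fun B => 2 * (k B : ℝ) / (k B + 1)
  let Y : A → ℝ := fun a => ∏ B, (u B (π B a) ^ p B / V B)
  let Z : K → A → ℝ := fun B a => x a ^ 2 * u B (π B a) ^ (p B - 2) / V B
  have hYpos : ∀ a ∈ s, 0 < Y a := fun a ha =>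
    prod_pos fun B _ => div_pos (Real.rpow_pos_of_pos (hupos B a ha) _) (hV B)
  have hZpos : ∀ B, ∀ a ∈ s, 0 < Z B a := fun B a ha =>
    div_pos (mul_pos (pow_pos (hx a ha) 2) (Real.rpow_pos_of_pos (hupos B a ha) _)) (hV B)
  set P : ℝ := ∏ B, V B ^ (((k B : ℝ) + 1) / (m + 1)) with hP
  have hPpos : 0 < P := prod_pos fun B _ => Real.rpow_pos_of_pos (hV B) _
  have hid : ∀ a ∈ s, x a ^ (2 * (m : ℝ) / (m + 1)) =
      P * (Y a ^ (1 / ((m : ℝ) + 1)) * ∏ B, Z B a ^ ((k B : ℝ) / (m + 1))) := by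
    intro a ha
    have hY : Y a ^ (1 / ((m : ℝ) + 1)) =
        ∏ B, (u B (π B a) ^ p B / V B) ^ (1 / ((m : ℝ) + 1)) :=
      (Real.finsetProd_rpow _ _ (fun B _ =>
        (div_pos (Real.rpow_pos_of_pos (hupos B a ha) _) (hV B)).le) _).symm
    rw [hY, hP, ← prod_mul_distrib, ← prod_mul_distrib]
    have hfac : ∀ B, V B ^ (((k B : ℝ) + 1) / (m + 1)) *
        ((u B (π B a) ^ p B / V B) ^ (1 / ((m : ℝ) + 1)) * Z B a ^ ((k B : ℝ) / (m + 1))) =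
        x a ^ (2 * (k B : ℝ) / (m + 1)) := by
      intro B
      have hk0 : (0 : ℝ) < k B + 1 := by positivity
      simp only [Z, p]
      rw [← Real.exp_log (hV B), ← Real.exp_log (hupos B a ha), ← Real.exp_log (hx a ha)]
      generalize Real.log (V B) = v
      generalize Real.log (u B (π B a)) = w
      generalize Real.log (x a) = y
      simp only [← Real.exp_mul, ← Real.exp_nat_mul, ← Real.exp_add, ← Real.exp_sub]
      congr 1
      push_cast
      field_simp
      ring
    rw [prod_congr rfl fun B _ => hfac B, ← Real.rpow_sum_of_pos (hx a ha), ← sum_div,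
      ← mul_sum, hkR]
  have hamgm : ∀ a ∈ s, Y a ^ (1 / ((m : ℝ) + 1)) * ∏ B, Z B a ^ ((k B : ℝ) / (m + 1)) ≤
      1 / ((m : ℝ) + 1) * Y a + ∑ B, (k B : ℝ) / (m + 1) * Z B a := by
    intro a ha
    have := Real.geom_mean_le_arith_mean_weighted (univ : Finset (Option K))
      (fun o => o.elim (1 / ((m : ℝ) + 1)) fun B => (k B : ℝ) / (m + 1))
      (fun o => o.elim (Y a) fun B => Z B a)
      (by rintro (_ | B) _ <;> simp only [Option.elim] <;> positivity)
      (by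
        rw [Fintype.sum_option]
        simp only [Option.elim]
        rw [← sum_div, hkR]
        field_simp
        ring)
      (by
        rintro (_ | B) _
        · exact (hYpos a ha).le
        · exact (hZpos B a ha).le)
    simpa [Fintype.sum_option, Fintype.prod_option] using this
  have hYsum : ∑ a ∈ s, Y a ≤ 1 := by
    have h1 : ∑ a ∈ s, Y a ≤
        ∑ y ∈ Fintype.piFinset T, ∏ B, (u B (y B) ^ p B / V B) := by
      calc ∑ a ∈ s, Y a = ∑ y ∈ s.image (fun a B => π B a), ∏ B, (u B (y B) ^ p B / V B) :=
            (sum_image (f := fun y : K → X => ∏ B, (u B (y B) ^ p B / V B)) hinj).symm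
        _ ≤ _ := sum_le_sum_of_subset_of_nonneg
            (by
              intro y hy
              obtain ⟨a, ha, rfl⟩ := mem_image.1 hy
              exact Fintype.mem_piFinset.2 fun B => hT B a ha)
            (fun y _ _ => prod_nonneg fun B _ =>
              div_nonneg (Real.rpow_nonneg (hu0 B _) _) (hV B).le)
    rw [← prod_univ_sum T fun B y => u B y ^ p B / V B] at h1
    refine h1.trans (prod_le_one (fun B _ => sum_nonneg fun y _ =>
      div_nonneg (Real.rpow_nonneg (hu0 B _) _) (hV B).le) fun B _ => ?_)
    rw [← sum_div]
    exact (div_le_one (hV B)).2 (hUV B)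
  have hZsum : ∀ B, ∑ a ∈ s, Z B a ≤ 1 := by
    intro B
    simp only [Z]
    rw [← sum_div, div_le_one (hV B)]
    refine le_trans ?_ (hUV B)
    rw [← sum_fiberwise_of_maps_to (hT B)]
    refine sum_le_sum fun y _ => ?_
    have h1 : ∑ a ∈ s with π B a = y, x a ^ 2 * u B (π B a) ^ (p B - 2) =
        (∑ a ∈ s with π B a = y, x a ^ 2) * u B y ^ (p B - 2) := by
      rw [sum_mul]
      refine sum_congr rfl fun a ha => ?_
      rw [(mem_filter.1 ha).2]
    rw [h1]
    rcases (hu0 B y).eq_or_lt with h0 | h0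
    · have h2 : ∑ a ∈ s with π B a = y, x a ^ 2 = 0 :=
        le_antisymm (by simpa [← h0] using hu B y) (sum_nonneg fun _ _ => sq_nonneg _)
      rw [h2, zero_mul]
      exact Real.rpow_nonneg (hu0 B y) _
    · calc _ ≤ u B y ^ 2 * u B y ^ (p B - 2) :=
            mul_le_mul_of_nonneg_right (hu B y) (Real.rpow_nonneg (hu0 B y) _)
        _ = u B y ^ p B := by
            rw [← Real.rpow_natCast, ← Real.rpow_add h0]
            congr 1
            push_cast
            ring
  calc ∑ a ∈ s, x a ^ (2 * (m : ℝ) / (m + 1))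
      ≤ ∑ a ∈ s, P * (1 / ((m : ℝ) + 1) * Y a + ∑ B, (k B : ℝ) / (m + 1) * Z B a) := by
        refine sum_le_sum fun a ha => ?_
        rw [hid a ha]
        exact mul_le_mul_of_nonneg_left (hamgm a ha) hPpos.le
    _ = P * (1 / ((m : ℝ) + 1) * ∑ a ∈ s, Y a +
          ∑ B, (k B : ℝ) / (m + 1) * ∑ a ∈ s, Z B a) := by
        rw [← mul_sum, sum_add_distrib, ← mul_sum, sum_comm]
        simp only [mul_sum]
    _ ≤ P * (1 / ((m : ℝ) + 1) * 1 + ∑ B, (k B : ℝ) / (m + 1) * 1) := by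
        gcongr with B _
        exact hZsum B
    _ = P := by
        simp only [mul_one]
        rw [← sum_div, hkR]
        field_simp
        ring

/-- The multi-indices in `n` variables of total degree at most `m`. -/
def multiIndices (n m : ℕ) : Finset (Fin n → ℕ) :=
  (Fintype.piFinset fun _ => range (m + 1)).filter fun α => ∑ i, α i ≤ m

lemma mem_multiIndices {n m : ℕ} {α : Fin n → ℕ} :
    α ∈ multiIndices n m ↔ ∑ i, α i ≤ m := by
  simp only [multiIndices, mem_filter, Fintype.mem_piFinset, mem_range, and_iff_right_iff_imp]
  intro h i
  have := single_le_sum (f := α) (fun _ _ => Nat.zero_le _) (mem_univ i)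
  omega

lemma le_of_mem_multiIndices {n m : ℕ} {α : Fin n → ℕ} (h : α ∈ multiIndices n m) (i : Fin n) :
    α i ≤ m :=
  (single_le_sum (f := α) (fun _ _ => Nat.zero_le _) (mem_univ i)).trans (mem_multiIndices.1 h)

/-- The standard primitive `N`-th root of unity. -/
noncomputable def unityRoot (N : ℕ) : ℂ := Complex.exp (2 * Real.pi * Complex.I / N)

lemma isPrimitiveRoot_unityRoot {N : ℕ} (hN : N ≠ 0) : IsPrimitiveRoot (unityRoot N) N :=
  Complex.isPrimitiveRoot_exp N hN

lemma norm_unityRoot {N : ℕ} (hN : N ≠ 0) : ‖unityRoot N‖ = 1 :=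
  (isPrimitiveRoot_unityRoot hN).norm'_eq_one hN

lemma sum_unityRoot_pow_mul_conj {N a b : ℕ} (ha : a < N) (hb : b < N) :
    ∑ l : Fin N, (unityRoot N ^ (l : ℕ)) ^ a * starRingEnd ℂ ((unityRoot N ^ (l : ℕ)) ^ b) =
      if a = b then (N : ℂ) else 0 := by
  have hN : N ≠ 0 := by omega
  have hω := isPrimitiveRoot_unityRoot hN
  have hn := norm_unityRoot hN
  set ω := unityRoot N
  have hω0 : ω ≠ 0 := hω.ne_zero hN
  have hconj : starRingEnd ℂ ω = ω⁻¹ := (Complex.inv_eq_conj hn).symm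
  have hterm : ∀ l : ℕ, (ω ^ l) ^ a * starRingEnd ℂ ((ω ^ l) ^ b) = (ω ^ a * (ω ^ b)⁻¹) ^ l := by
    intro l
    simp only [map_pow, hconj]
    rw [mul_pow, ← inv_pow, ← pow_mul, ← pow_mul, ← pow_mul, ← pow_mul, mul_comm a, mul_comm b]
  simp only [hterm]
  rw [Fin.sum_univ_eq_sum_range (fun l => (ω ^ a * (ω ^ b)⁻¹) ^ l) N]
  split_ifs with h
  · subst h
    simp [mul_inv_cancel₀ (pow_ne_zero a hω0)]
  · have hne : ω ^ a * (ω ^ b)⁻¹ ≠ 1 := by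
      intro h1
      rw [mul_inv_eq_one₀ (pow_ne_zero _ hω0)] at h1
      exact h (hω.pow_inj ha hb h1)
    rw [geom_sum_eq hne, mul_pow, inv_pow, ← pow_mul, ← pow_mul, mul_comm a, mul_comm b, pow_mul,
      pow_mul, hω.pow_eq_one]
    simp

/-- The grid points with `N`-th roots of unity as coordinates. -/
noncomputable def unityPoint {n N : ℕ} (l : Fin n → Fin N) : Fin n → ℂ :=
  fun i => unityRoot N ^ (l i : ℕ)

lemma norm_unityPoint {n N : ℕ} (l : Fin n → Fin N) (i : Fin n) : ‖unityPoint l i‖ = 1 := by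
  rw [unityPoint, norm_pow, norm_unityRoot (by have := (l i).2; omega), one_pow]

/-- Parseval's identity on the grid of roots of unity. -/
lemma sum_norm_sq_unityPoint {n N : ℕ} (s : Finset (Fin n → ℕ)) (hs : ∀ α ∈ s, ∀ i, α i < N)
    (b : (Fin n → ℕ) → ℂ) :
    ∑ l : Fin n → Fin N, ‖∑ α ∈ s, b α * ∏ i, unityPoint l i ^ α i‖ ^ 2 =
      (N : ℝ) ^ n * ∑ α ∈ s, ‖b α‖ ^ 2 := by
  have horth : ∀ α ∈ s, ∀ β ∈ s, ∑ l : Fin n → Fin N, (∏ i, unityPoint l i ^ α i) *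
      starRingEnd ℂ (∏ i, unityPoint l i ^ β i) = if α = β then (N : ℂ) ^ n else 0 := by
    intro α hα β hβ
    simp only [map_prod, ← prod_mul_distrib, unityPoint]
    have h1 := Fintype.prod_sum fun (i : Fin n) (l : Fin N) =>
      (unityRoot N ^ (l : ℕ)) ^ α i * starRingEnd ℂ ((unityRoot N ^ (l : ℕ)) ^ β i)
    rw [← h1, prod_congr rfl fun i _ => sum_unityRoot_pow_mul_conj (hs α hα i) (hs β hβ i)]
    split_ifs with h
    · subst h
      simp
    · obtain ⟨i, hi⟩ := Function.ne_iff.1 h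
      exact prod_eq_zero (mem_univ i) (if_neg hi)
  have hC : (∑ l : Fin n → Fin N, ((‖∑ α ∈ s, b α * ∏ i, unityPoint l i ^ α i‖ ^ 2 : ℝ) : ℂ)) =
      (N : ℂ) ^ n * ∑ α ∈ s, ((‖b α‖ ^ 2 : ℝ) : ℂ) := by
    simp only [Complex.ofReal_pow, ← Complex.mul_conj', map_sum, map_mul, sum_mul_sum]
    rw [sum_comm, mul_sum]
    refine sum_congr rfl fun α hα => ?_
    rw [sum_comm]
    rw [sum_eq_single_of_mem α hα]
    · have := horth α hα α hα
      rw [if_pos rfl] at this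
      rw [← this, sum_mul]
      refine sum_congr rfl fun l _ => ?_
      ring
    · intro β hβ hne
      have := horth α hα β hβ
      rw [if_neg hne.symm] at this
      calc _ = b α * starRingEnd ℂ (b β) * ∑ l : Fin n → Fin N, (∏ i, unityPoint l i ^ α i) *
            starRingEnd ℂ (∏ i, unityPoint l i ^ β i) := by
              rw [mul_sum]
              exact sum_congr rfl fun l _ => by ring
        _ = 0 := by rw [this, mul_zero]
  exact_mod_cast hC

lemma card_filter_add_eq_le {n : ℕ} (s : Finset (Fin n → ℕ)) (δ : Fin n → ℕ) :
    #{q ∈ s ×ˢ s | q.1 + q.2 = δ} ≤ 2 ^ ∑ i, δ i := by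
  calc #{q ∈ s ×ˢ s | q.1 + q.2 = δ}
      ≤ #(Fintype.piFinset fun i => range (δ i + 1)) := by
        refine card_le_card_of_injOn Prod.fst ?_ ?_
        · intro q hq
          have h := (mem_filter.1 hq).2
          refine mem_coe.2 (Fintype.mem_piFinset.2 fun i => mem_range.2 ?_)
          have := congrFun h i
          simp only [Pi.add_apply] at this
          omega
        · intro q hq q' hq' h
          have h1 := (mem_filter.1 hq).2
          have h2 := (mem_filter.1 hq').2
          refine Prod.ext h ?_
          rw [h, ← h2] at h1
          exact add_left_cancel h1
    _ = ∏ i, (δ i + 1) := by simp [Fintype.card_piFinset]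
    _ ≤ ∏ i, 2 ^ δ i := prod_le_prod' fun i _ => Nat.succ_le_of_lt Nat.lt_two_pow_self
    _ = _ := prod_pow_eq_pow_sum _ _ _

/-- The fourth moment of a polynomial of degree at most `m` is controlled by its second moment. -/
lemma sum_norm_pow_four_unityPoint_le {n m N : ℕ} (hN : 2 * m < N) (b : (Fin n → ℕ) → ℂ) :
    ∑ l : Fin n → Fin N, ‖∑ α ∈ multiIndices n m, b α * ∏ i, unityPoint l i ^ α i‖ ^ 4 ≤
      (N : ℝ) ^ n * (4 ^ m * (∑ α ∈ multiIndices n m, ‖b α‖ ^ 2) ^ 2) := by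
  set s := multiIndices n m
  let d : (Fin n → ℕ) → ℂ := fun δ => ∑ q ∈ s ×ˢ s with q.1 + q.2 = δ, b q.1 * b q.2
  have hmaps : ∀ q ∈ s ×ˢ s, q.1 + q.2 ∈ multiIndices n (2 * m) := by
    intro q hq
    have h1 := mem_multiIndices.1 (mem_product.1 hq).1
    have h2 := mem_multiIndices.1 (mem_product.1 hq).2
    rw [mem_multiIndices]
    simp only [Pi.add_apply, sum_add_distrib]
    omega
  have hsq : ∀ z : Fin n → ℂ, (∑ α ∈ s, b α * ∏ i, z i ^ α i) ^ 2 =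
      ∑ δ ∈ multiIndices n (2 * m), d δ * ∏ i, z i ^ δ i := by
    intro z
    rw [sq, sum_mul_sum, ← sum_product', ← sum_fiberwise_of_maps_to hmaps]
    refine sum_congr rfl fun δ _ => ?_
    rw [sum_mul]
    refine sum_congr rfl fun q hq => ?_
    rw [← (mem_filter.1 hq).2]
    simp only [Pi.add_apply, pow_add, prod_mul_distrib]
    ring
  have hd : ∀ δ ∈ multiIndices n (2 * m), ‖d δ‖ ^ 2 ≤
      4 ^ m * ∑ q ∈ s ×ˢ s with q.1 + q.2 = δ, ‖b q.1‖ ^ 2 * ‖b q.2‖ ^ 2 := by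
    intro δ hδ
    have hcard : (#{q ∈ s ×ˢ s | q.1 + q.2 = δ} : ℝ) ≤ 4 ^ m := by
      have h1 := (card_filter_add_eq_le s δ).trans
        (Nat.pow_le_pow_right two_pos (mem_multiIndices.1 hδ))
      rw [pow_mul] at h1
      exact_mod_cast h1
    calc ‖d δ‖ ^ 2 ≤ (∑ q ∈ s ×ˢ s with q.1 + q.2 = δ, ‖b q.1 * b q.2‖) ^ 2 := by
          gcongr
          exact norm_sum_le _ _
      _ ≤ _ := sq_sum_le_card_mul_sum_sq
      _ ≤ _ := by
          simp only [norm_mul, mul_pow]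
          gcongr
  have h4 : ∀ l : Fin n → Fin N, ‖∑ α ∈ s, b α * ∏ i, unityPoint l i ^ α i‖ ^ 4 =
      ‖∑ δ ∈ multiIndices n (2 * m), d δ * ∏ i, unityPoint l i ^ δ i‖ ^ 2 := by
    intro l
    rw [← hsq, norm_pow, ← pow_mul]
  rw [sum_congr rfl fun l _ => h4 l, sum_norm_sq_unityPoint _
    (fun α hα i => (le_of_mem_multiIndices hα i).trans_lt hN)]
  gcongr
  calc _ ≤ ∑ δ ∈ multiIndices n (2 * m),
        4 ^ m * ∑ q ∈ s ×ˢ s with q.1 + q.2 = δ, ‖b q.1‖ ^ 2 * ‖b q.2‖ ^ 2 := sum_le_sum hd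
    _ = _ := by
      rw [← mul_sum, sum_fiberwise_of_maps_to hmaps (fun q => ‖b q.1‖ ^ 2 * ‖b q.2‖ ^ 2),
        sum_product' s s (fun α β => ‖b α‖ ^ 2 * ‖b β‖ ^ 2), ← sum_mul_sum, sq]

/-- A hypercontractive estimate: the `ℓ²` norm of the coefficients of a polynomial of degree at
most `m` is controlled by its `L^p` norm on the grid, where `p = 2k/(k+1)`. -/
lemma sum_sq_rpow_le_sum_norm_rpow {n m N k : ℕ} (hk : 1 ≤ k) (hN : 2 * m < N)
    (b : (Fin n → ℕ) → ℂ) :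
    (N : ℝ) ^ n * (∑ α ∈ multiIndices n m, ‖b α‖ ^ 2) ^ ((k : ℝ) / (k + 1)) ≤
      (4 : ℝ) ^ ((m : ℝ) / (k + 1)) * ∑ l : Fin n → Fin N,
        ‖∑ α ∈ multiIndices n m, b α * ∏ i, unityPoint l i ^ α i‖ ^ (2 * (k : ℝ) / (k + 1)) := by
  have hk0 : (0 : ℝ) < k := by exact_mod_cast hk
  have hNpos : (0 : ℝ) < (N : ℝ) ^ n := by
    have : (0 : ℝ) < N := by exact_mod_cast (by omega : 0 < N)
    positivity
  set W := (N : ℝ) ^ n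
  have h2 := sum_norm_sq_unityPoint (N := N) (multiIndices n m)
    (fun α hα i => by have := le_of_mem_multiIndices hα i; omega) b
  have h4 := sum_norm_pow_four_unityPoint_le hN b
  set Q : (Fin n → Fin N) → ℝ :=
    fun l => ‖∑ α ∈ multiIndices n m, b α * ∏ i, unityPoint l i ^ α i‖
  set S := ∑ α ∈ multiIndices n m, ‖b α‖ ^ 2
  set p : ℝ := 2 * (k : ℝ) / (k + 1)
  have hQ0 : ∀ l, 0 ≤ Q l := fun l => norm_nonneg _
  have hS0 : 0 ≤ S := sum_nonneg fun _ _ => sq_nonneg _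
  set Ap := ∑ l, Q l ^ p
  have hAp0 : 0 ≤ Ap := sum_nonneg fun l _ => Real.rpow_nonneg (hQ0 l) _
  have hol := Real.inner_le_Lp_mul_Lq_of_nonneg (univ : Finset (Fin n → Fin N))
    (f := fun l => Q l ^ (p * ((k + 1) / (k + 2)))) (g := fun l => Q l ^ (4 * (1 / ((k : ℝ) + 2))))
    (p := ((k : ℝ) + 2) / (k + 1)) (q := (k : ℝ) + 2)
    (by
      rw [Real.holderConjugate_iff]
      refine ⟨?_, ?_⟩
      · rw [lt_div_iff₀ (by positivity)]
        linarith
      · field_simp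
        ring)
    (fun l _ => Real.rpow_nonneg (hQ0 l) _) (fun l _ => Real.rpow_nonneg (hQ0 l) _)
  have e1 : ∀ l, Q l ^ (p * ((k + 1) / (k + 2))) * Q l ^ (4 * (1 / ((k : ℝ) + 2))) =
      Q l ^ 2 := by
    intro l
    rw [← Real.rpow_add_of_nonneg (hQ0 l) (by positivity) (by positivity), ← Real.rpow_natCast]
    congr 1
    simp only [p]
    push_cast
    field_simp
    ring
  have e2 : ∀ l, (Q l ^ (p * ((k + 1) / (k + 2)))) ^ (((k : ℝ) + 2) / (k + 1)) = Q l ^ p := by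
    intro l
    rw [← Real.rpow_mul (hQ0 l)]
    congr 1
    field_simp
  have e3 : ∀ l, (Q l ^ (4 * (1 / ((k : ℝ) + 2)))) ^ ((k : ℝ) + 2) = Q l ^ 4 := by
    intro l
    rw [← Real.rpow_mul (hQ0 l), ← Real.rpow_natCast]
    congr 1
    push_cast
    field_simp
  simp only [e1, e2, e3] at hol
  rw [h2] at hol
  rcases hS0.eq_or_lt with hS | hS
  · rw [← hS, Real.zero_rpow (by positivity), mul_zero]
    positivity
  have hol' : W * S ≤ Ap ^ (1 / (((k : ℝ) + 2) / (k + 1))) *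
      (W * (4 ^ m * S ^ 2)) ^ (1 / ((k : ℝ) + 2)) := by
    refine hol.trans ?_
    gcongr
  have hpow := Real.rpow_le_rpow (by positivity) hol' (by positivity : (0:ℝ) ≤ (k + 2) / (k + 1))
  rw [Real.mul_rpow (Real.rpow_nonneg hAp0 _) (by positivity), ← Real.rpow_mul hAp0,
    ← Real.rpow_mul (by positivity)] at hpow
  have x1 : 1 / (((k : ℝ) + 2) / (k + 1)) * ((k + 2) / (k + 1)) = 1 := by field_simp
  have x2 : 1 / ((k : ℝ) + 2) * ((k + 2) / (k + 1)) = 1 / (k + 1) := by field_simp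
  rw [x1, x2, Real.rpow_one] at hpow
  have y1 : (W * S) ^ (((k : ℝ) + 2) / (k + 1)) =
      (W * S ^ ((k : ℝ) / (k + 1))) * (W ^ (1 / ((k : ℝ) + 1)) * S ^ (2 / ((k : ℝ) + 1))) := by
    rw [← Real.exp_log hS, ← Real.exp_log hNpos]
    simp only [← Real.exp_mul, ← Real.exp_add]
    congr 1
    field_simp
    ring
  have y2 : (W * (4 ^ m * S ^ 2)) ^ (1 / ((k : ℝ) + 1)) =
      4 ^ ((m : ℝ) / (k + 1)) * (W ^ (1 / ((k : ℝ) + 1)) * S ^ (2 / ((k : ℝ) + 1))) := by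
    rw [Real.mul_rpow hNpos.le (by positivity), Real.mul_rpow (by positivity) (by positivity),
      ← Real.rpow_natCast, ← Real.rpow_natCast, ← Real.rpow_mul (by positivity),
      ← Real.rpow_mul (by positivity)]
    push_cast
    rw [mul_one_div, mul_one_div]
    ring
  rw [y1, y2] at hpow
  refine le_of_mul_le_mul_right (a := W ^ (1 / ((k : ℝ) + 1)) * S ^ (2 / ((k : ℝ) + 1))) ?_
    (by positivity)
  calc _ ≤ _ := hpow
    _ = _ := by ring

/-- The polynomial of degree at most `m` with coefficients `c`, evaluated at `z`. -/
noncomputable def multiEval {n : ℕ} (m : ℕ) (c : (Fin n → ℕ) → ℂ) (z : Fin n → ℂ) : ℂ :=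
  ∑ α ∈ multiIndices n m, c α * ∏ i, z i ^ α i

/-- The supremum of a polynomial over the closed polydisc is attained on the torus. -/
lemma norm_multiEval_le_of_torus {n m : ℕ} {c : (Fin n → ℕ) → ℂ} {M : ℝ}
    (h : ∀ z : Fin n → ℂ, (∀ i, ‖z i‖ = 1) → ‖multiEval m c z‖ ≤ M)
    {z : Fin n → ℂ} (hz : ∀ i, ‖z i‖ ≤ 1) : ‖multiEval m c z‖ ≤ M := by
  have key : ∀ S : Finset (Fin n), ∀ z : Fin n → ℂ, (∀ i ∈ S, ‖z i‖ ≤ 1) →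
      (∀ i ∉ S, ‖z i‖ = 1) → ‖multiEval m c z‖ ≤ M := by
    intro S
    induction S using Finset.induction_on with
    | empty => exact fun z _ hz => h z fun i => hz i (notMem_empty i)
    | insert j S hj ih =>
      intro z hz1 hz2
      have hd : Differentiable ℂ fun ζ : ℂ => multiEval m c (Function.update z j ζ) := by
        unfold multiEval
        refine Differentiable.fun_sum fun α _ => Differentiable.const_mul ?_ _
        refine Differentiable.fun_finsetProd fun i _ => Differentiable.pow ?_ _
        by_cases hi : i = j
        · subst hi
          simp
        · simp [Function.update_of_ne hi]
      have := Complex.norm_le_of_forall_mem_frontier_norm_le (U := Metric.ball (0 : ℂ) 1)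
        Metric.isBounded_ball hd.diffContOnCl (C := M) (z := z j)
        (by
          intro ζ hζ
          rw [frontier_ball _ one_ne_zero, mem_sphere_zero_iff_norm] at hζ
          refine ih _ (fun i hi => ?_) fun i hi => ?_
          · rw [Function.update_of_ne (ne_of_mem_of_not_mem hi hj)]
            exact hz1 i (mem_insert_of_mem hi)
          · by_cases hij : i = j
            · subst hij
              simpa using hζ
            · rw [Function.update_of_ne hij]
              exact hz2 i (by simp [hij, hi]))
        (by
          rw [closure_ball _ one_ne_zero, mem_closedBall_zero_iff]
          exact hz1 j (mem_insert_self _ _))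
      simpa using this
  exact key univ z (fun i _ => hz i) fun i hi => absurd (mem_univ i) hi

lemma nonneg_of_norm_multiEval_le {n m : ℕ} {c : (Fin n → ℕ) → ℂ} {M : ℝ}
    (h : ∀ z : Fin n → ℂ, (∀ i, ‖z i‖ = 1) → ‖multiEval m c z‖ ≤ M) : 0 ≤ M :=
  (norm_nonneg _).trans (h (fun _ => 1) fun _ => norm_one)

/-- The homogeneous parts of a polynomial are bounded on the torus by the polynomial itself. -/
lemma norm_homogeneousPart_le {n m : ℕ} {c : (Fin n → ℕ) → ℂ} {M : ℝ}
    (h : ∀ z : Fin n → ℂ, (∀ i, ‖z i‖ = 1) → ‖multiEval m c z‖ ≤ M) (j : ℕ)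
    {z : Fin n → ℂ} (hz : ∀ i, ‖z i‖ = 1) :
    ‖∑ α ∈ multiIndices n m with ∑ i, α i = j, c α * ∏ i, z i ^ α i‖ ≤ M := by
  have hM := nonneg_of_norm_multiEval_le h
  rcases lt_or_ge m j with hj | hj
  · rw [filter_eq_empty_iff.2 fun α hα => by have := mem_multiIndices.1 hα; omega]
    simpa using hM
  set H := ∑ α ∈ multiIndices n m with ∑ i, α i = j, c α * ∏ i, z i ^ α i
  have hsum : ∑ l : Fin (m + 1), multiEval m c (fun i => unityRoot (m + 1) ^ (l : ℕ) * z i) *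
      starRingEnd ℂ ((unityRoot (m + 1) ^ (l : ℕ)) ^ j) = ((m + 1 : ℕ) : ℂ) * H := by
    simp only [multiEval, sum_mul]
    rw [sum_comm, mul_sum, sum_filter]
    refine sum_congr rfl fun α hα => ?_
    have h1 := sum_unityRoot_pow_mul_conj (N := m + 1) (a := ∑ i, α i) (b := j)
      (Nat.lt_succ_of_le (mem_multiIndices.1 hα)) (Nat.lt_succ_of_le hj)
    calc _ = c α * (∏ i, z i ^ α i) * ∑ l : Fin (m + 1),
          (unityRoot (m + 1) ^ (l : ℕ)) ^ (∑ i, α i) *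
            starRingEnd ℂ ((unityRoot (m + 1) ^ (l : ℕ)) ^ j) := by
          rw [mul_sum]
          refine sum_congr rfl fun l _ => ?_
          simp only [mul_pow, prod_mul_distrib, prod_pow_eq_pow_sum]
          ring
      _ = _ := by
          rw [h1]
          split_ifs <;> ring
  have hω := norm_unityRoot (N := m + 1) (Nat.succ_ne_zero m)
  have hle : ((m + 1 : ℕ) : ℝ) * ‖H‖ ≤ ((m + 1 : ℕ) : ℝ) * M := by
    have hH : ((m + 1 : ℕ) : ℝ) * ‖H‖ = ‖((m + 1 : ℕ) : ℂ) * H‖ := by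
      rw [norm_mul, Complex.norm_natCast]
    rw [hH, ← hsum]
    refine (norm_sum_le _ _).trans ?_
    calc _ ≤ ∑ l : Fin (m + 1), M := by
          refine sum_le_sum fun l _ => ?_
          rw [norm_mul, RCLike.norm_conj, norm_pow, norm_pow, hω, one_pow, one_pow, mul_one]
          exact h _ fun i => by rw [norm_mul, norm_pow, hω, hz i, one_pow, one_mul]
      _ = _ := by simp
  exact le_of_mul_le_mul_left hle (by positivity)

/-- The coefficients of the normalised partial derivative of order `β`. -/
def taylorCoeff {n : ℕ} (c : (Fin n → ℕ) → ℂ) (β γ : Fin n → ℕ) : ℂ :=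
  c (γ + β) * ∏ i, ((γ i + β i).choose (β i) : ℂ)

lemma multiEval_add {n m : ℕ} {c : (Fin n → ℕ) → ℂ} (hc : ∀ α ∉ multiIndices n m, c α = 0)
    (x y : Fin n → ℂ) :
    multiEval m c (x + y) = multiEval m (fun β => multiEval m (taylorCoeff c β) x) y := by
  have hpow : ∀ α ∈ multiIndices n m, ∏ i, (x i + y i) ^ α i =
      ∑ β ∈ Fintype.piFinset fun _ => range (m + 1),
        ∏ i, (((α i).choose (β i) : ℂ) * x i ^ (α i - β i) * y i ^ β i) := by
    intro α hα
    rw [← prod_univ_sum (fun _ => range (m + 1))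
      fun i b => ((α i).choose b : ℂ) * x i ^ (α i - b) * y i ^ b]
    refine prod_congr rfl fun i _ => ?_
    rw [add_comm, add_pow]
    have hi := le_of_mem_multiIndices hα i
    refine (sum_congr rfl fun b _ => ?_).trans (sum_subset (range_mono (Nat.succ_le_succ hi))
      fun b _ hb => ?_)
    · ring
    · rw [Nat.choose_eq_zero_of_lt (by simpa using hb)]
      simp
  have hinner : ∀ β : Fin n → ℕ, ∑ α ∈ multiIndices n m,
      c α * ∏ i, (((α i).choose (β i) : ℂ) * x i ^ (α i - β i)) =
        multiEval m (taylorCoeff c β) x := by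
    intro β
    have hfilter : ∑ γ ∈ multiIndices n m with γ + β ∈ multiIndices n m,
        taylorCoeff c β γ * ∏ i, x i ^ γ i = multiEval m (taylorCoeff c β) x := by
      refine sum_filter_of_ne fun γ _ hne => ?_
      by_contra hmem
      exact hne (by rw [taylorCoeff, hc _ hmem]; simp)
    rw [← hfilter]
    symm
    refine sum_of_injOn (fun γ => γ + β) (fun _ _ _ _ h => add_right_cancel h)
      (fun γ hγ => (mem_filter.1 hγ).2) ?_ ?_
    · intro α hα hni
      suffices ∃ i, α i < β i by
        obtain ⟨i, hi⟩ := this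
        rw [prod_eq_zero (mem_univ i) (by rw [Nat.choose_eq_zero_of_lt hi]; simp), mul_zero]
      by_contra! hle
      refine hni ⟨α - β, ?_, tsub_add_cancel_of_le hle⟩
      refine mem_coe.2 (mem_filter.2 ⟨?_, ?_⟩)
      · rw [mem_multiIndices]
        exact (sum_le_sum fun i _ => Nat.sub_le _ _).trans (mem_multiIndices.1 hα)
      · rwa [tsub_add_cancel_of_le hle]
    · intro γ _
      simp only [taylorCoeff, Pi.add_apply, Nat.add_sub_cancel, prod_mul_distrib]
      ring
  calc multiEval m c (x + y)
      = ∑ β ∈ Fintype.piFinset fun _ => range (m + 1),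
          multiEval m (taylorCoeff c β) x * ∏ i, y i ^ β i := by
        rw [multiEval]
        simp only [Pi.add_apply]
        rw [sum_congr rfl fun α hα => by rw [hpow α hα, mul_sum], sum_comm]
        refine sum_congr rfl fun β _ => ?_
        rw [← hinner β, sum_mul]
        refine sum_congr rfl fun α _ => ?_
        rw [prod_mul_distrib]
        ring
    _ = _ := by
        symm
        refine sum_subset (filter_subset _ _) fun β _ hβ => ?_
        have h0 : multiEval m (taylorCoeff c β) x = 0 := by
          refine sum_eq_zero fun γ _ => ?_
          rw [taylorCoeff, hc, zero_mul, zero_mul]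
          intro hmem
          refine hβ (mem_multiIndices.2 (le_trans ?_ (mem_multiIndices.1 hmem)))
          exact sum_le_sum fun i _ => Nat.le_add_left _ _
        exact mul_eq_zero_of_left h0 _

lemma multiEval_smul {n m : ℕ} (c : (Fin n → ℕ) → ℂ) (t : ℂ) (z : Fin n → ℂ) :
    multiEval m c (fun i => t * z i) = multiEval m (fun α => c α * t ^ ∑ i, α i) z := by
  refine sum_congr rfl fun α _ => ?_
  simp only [mul_pow, prod_mul_distrib, prod_pow_eq_pow_sum]
  ring

/-- Bound for the part of degree at most `k` of the Taylor expansion at a point of the polydisc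
of radius `1 - 1/(2m)`. -/
lemma norm_truncated_taylor_le {n m k : ℕ} (hm : 1 ≤ m) (hkm : k ≤ m) {c : (Fin n → ℕ) → ℂ}
    (hc : ∀ α ∉ multiIndices n m, c α = 0) {M : ℝ}
    (h : ∀ z : Fin n → ℂ, (∀ i, ‖z i‖ = 1) → ‖multiEval m c z‖ ≤ M)
    {z w : Fin n → ℂ} (hz : ∀ i, ‖z i‖ = 1) (hw : ∀ i, ‖w i‖ = 1) :
    ‖multiEval k (fun β => multiEval m (taylorCoeff c β)
      fun i => ((1 - 1 / (2 * m) : ℝ) : ℂ) * z i) w‖ ≤ (k + 1) * (2 * m) ^ k * M := by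
  have hM := nonneg_of_norm_multiEval_le h
  have hmR : (1 : ℝ) ≤ m := by exact_mod_cast hm
  set ρ : ℝ := 1 / (2 * m) with hρ
  have hρ0 : 0 < ρ := by positivity
  have hρ1 : ρ ≤ 1 := by
    rw [hρ, div_le_one (by positivity)]
    linarith
  set x : Fin n → ℂ := fun i => ((1 - ρ : ℝ) : ℂ) * z i
  set q : (Fin n → ℕ) → ℂ := fun β => multiEval m (taylorCoeff c β) x
  have hbd : ∀ w : Fin n → ℂ, (∀ i, ‖w i‖ = 1) →
      ‖multiEval m (fun β => q β * (ρ : ℂ) ^ ∑ i, β i) w‖ ≤ M := by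
    intro w hw
    rw [← multiEval_smul, ← multiEval_add hc]
    refine norm_multiEval_le_of_torus h fun i => ?_
    refine (norm_add_le _ _).trans ?_
    simp only [x, norm_mul, hz i, hw i, Complex.norm_real, Real.norm_eq_abs, mul_one]
    rw [abs_of_nonneg (by linarith), abs_of_pos hρ0]
    linarith
  have hpart : ∀ j ∈ range (k + 1),
      ‖∑ β ∈ multiIndices n k with ∑ i, β i = j, q β * ∏ i, w i ^ β i‖ ≤ (2 * m) ^ k * M := by
    intro j hj
    have hjk : j ≤ k := Nat.lt_succ_iff.1 (mem_range.1 hj)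
    have h1 := norm_homogeneousPart_le hbd j hw
    have hset : {β ∈ multiIndices n k | ∑ i, β i = j} = {β ∈ multiIndices n m | ∑ i, β i = j} := by
      ext β
      simp only [mem_filter, mem_multiIndices]
      omega
    have h2 : ∑ β ∈ multiIndices n m with ∑ i, β i = j,
        q β * (ρ : ℂ) ^ (∑ i, β i) * ∏ i, w i ^ β i =
        (ρ : ℂ) ^ j * ∑ β ∈ multiIndices n k with ∑ i, β i = j, q β * ∏ i, w i ^ β i := by
      rw [hset, mul_sum]
      refine sum_congr rfl fun β hβ => ?_
      rw [(mem_filter.1 hβ).2]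
      ring
    rw [h2, norm_mul, norm_pow, Complex.norm_real, Real.norm_eq_abs, abs_of_pos hρ0] at h1
    have hinv : (2 * (m : ℝ)) ^ j * ρ ^ j = 1 := by
      rw [← mul_pow, hρ, mul_one_div_cancel (by positivity), one_pow]
    calc _ = (2 * (m : ℝ)) ^ j * (ρ ^ j *
          ‖∑ β ∈ multiIndices n k with ∑ i, β i = j, q β * ∏ i, w i ^ β i‖) := by
          rw [← mul_assoc, hinv, one_mul]
      _ ≤ (2 * (m : ℝ)) ^ j * M := by gcongr
      _ ≤ _ := by
          gcongr
          linarith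
  have hmaps : ∀ β ∈ multiIndices n k, ∑ i, β i ∈ range (k + 1) := fun β hβ =>
    mem_range.2 (Nat.lt_succ_of_le (mem_multiIndices.1 hβ))
  rw [multiEval, ← sum_fiberwise_of_maps_to hmaps]
  refine (norm_sum_le _ _).trans ((sum_le_sum hpart).trans_eq ?_)
  simp only [sum_const, card_range, nsmul_eq_mul]
  push_cast
  ring

/-- The Bohnenblust–Hille inequality for polynomials of degree at most `k` with constant `D`. -/
def BohnenblustHille (k : ℕ) (D : ℝ) : Prop :=
  ∀ (n : ℕ) (c : (Fin n → ℕ) → ℂ) (M : ℝ),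
    (∀ z : Fin n → ℂ, (∀ i, ‖z i‖ = 1) → ‖multiEval k c z‖ ≤ M) →
      ∑ α ∈ multiIndices n k, ‖c α‖ ^ (2 * (k : ℝ) / (k + 1)) ≤
        (D * M) ^ (2 * (k : ℝ) / (k + 1))

lemma BohnenblustHille.mono {k : ℕ} {D D' : ℝ} (h : BohnenblustHille k D) (hD : 0 ≤ D)
    (hDD' : D ≤ D') : BohnenblustHille k D' := by
  intro n c M hM
  have hM0 := nonneg_of_norm_multiEval_le hM
  refine (h n c M hM).trans ?_
  gcongr

/-- Every complex number is its modulus times a unimodular number. -/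
lemma exists_norm_eq_one_and_eq_norm_mul (x : ℂ) : ∃ u : ℂ, ‖u‖ = 1 ∧ x = ‖x‖ * u := by
  by_cases hx : x = 0
  · exact ⟨1, by simp, by simp [hx]⟩
  · have h : (‖x‖ : ℂ) ≠ 0 := by simpa using hx
    exact ⟨x / ‖x‖, by simp [hx], by field_simp⟩

lemma bohnenblustHille_one : BohnenblustHille 1 1 := by
  intro n c M h
  have he : 2 * ((1 : ℕ) : ℝ) / ((1 : ℕ) + 1) = 1 := by norm_num
  simp only [he, Real.rpow_one, one_mul]
  choose u hu1 hu using fun α => exists_norm_eq_one_and_eq_norm_mul (c α)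
  let z : Fin n → ℂ := fun i => u 0 * starRingEnd ℂ (u (Pi.single i 1))
  have hz : ∀ i, ‖z i‖ = 1 := fun i => by simp [z, hu1]
  have hterm : ∀ α ∈ multiIndices n 1, c α * ∏ i, z i ^ α i = u 0 * ‖c α‖ := by
    intro α hα
    rw [mem_multiIndices] at hα
    by_cases h0 : α = 0
    · subst h0
      conv_lhs => rw [hu 0]
      simp [mul_comm]
    · obtain ⟨i, hi⟩ := Function.ne_iff.1 h0
      have hs : α = Pi.single i 1 := by
        rw [← add_sum_erase _ _ (mem_univ i)] at hα
        simp only [Pi.zero_apply] at hi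
        have h1 : α i = 1 := by omega
        have h2 : ∑ j ∈ univ.erase i, α j = 0 := by omega
        rw [sum_eq_zero_iff] at h2
        ext j
        by_cases hj : j = i
        · subst hj
          simpa using h1
        · simpa [hj] using h2 j (by simp [hj])
      have hprod : ∏ j, z j ^ α j = z i := by
        rw [prod_eq_single i]
        · simp [hs]
        · intro j _ hj
          simp [hs, hj]
        · simp
      have huu : u α * starRingEnd ℂ (u α) = 1 := by
        rw [Complex.mul_conj', hu1]
        simp
      rw [hprod]
      simp only [z]
      rw [← hs]
      conv_lhs => rw [hu α]
      linear_combination (‖c α‖ : ℂ) * u 0 * huu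
  have hz' := h z hz
  rw [multiEval, sum_congr rfl hterm, ← mul_sum, norm_mul, hu1, one_mul, ← Complex.ofReal_sum,
    Complex.norm_real] at hz'
  exact (le_abs_self _).trans hz'

lemma exists_le_sum_eq {ι : Type*} [Fintype ι] [DecidableEq ι] (α : ι → ℕ) (t : ℕ)
    (ht : t ≤ ∑ i, α i) : ∃ β ≤ α, ∑ i, β i = t := by
  induction t with
  | zero => exact ⟨0, fun _ => Nat.zero_le _, by simp⟩
  | succ t ih =>
    obtain ⟨β, hβ, hs⟩ := ih (by omega)
    obtain ⟨i, -, hi⟩ := exists_lt_of_sum_lt (show ∑ i, β i < ∑ i, α i by omega)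
    refine ⟨β + Pi.single i 1, fun j => ?_, ?_⟩
    · by_cases hj : j = i
      · subst hj
        simpa using hi
      · simpa [hj] using hβ j
    · simp [sum_add_distrib, hs]

/-- A multi-index of degree at most `∑ B ∈ s, k B` splits into pieces of degrees at most `k B`. -/
lemma exists_sum_eq_of_sum_le {ι K : Type*} [Fintype ι] [DecidableEq ι] [DecidableEq K]
    (k : K → ℕ) (s : Finset K) (α : ι → ℕ) (hα : ∑ i, α i ≤ ∑ B ∈ s, k B) :
    ∃ β : K → ι → ℕ, (∀ B ∈ s, ∑ i, β B i ≤ k B) ∧ ∑ B ∈ s, β B = α := by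
  induction s using Finset.induction_on generalizing α with
  | empty =>
    refine ⟨0, by simp, ?_⟩
    ext i
    have := single_le_sum (f := α) (fun _ _ => Nat.zero_le _) (mem_univ i)
    simp only [sum_empty] at hα ⊢
    simp only [Pi.zero_apply]
    omega
  | insert b s hb ih =>
    rw [sum_insert hb] at hα
    obtain ⟨β₀, hle, hs⟩ := exists_le_sum_eq α (min (∑ i, α i) (k b)) (min_le_left _ _)
    have hsub : ∑ i, (α - β₀) i + ∑ i, β₀ i = ∑ i, α i := by
      rw [← sum_add_distrib]
      exact sum_congr rfl fun i _ => Nat.sub_add_cancel (hle i)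
    obtain ⟨β, h1, h2⟩ := ih (α - β₀) (by omega)
    refine ⟨Function.update β b β₀, fun B hB => ?_, ?_⟩
    · rcases mem_insert.1 hB with rfl | hB
      · rw [Function.update_self]
        omega
      · rw [Function.update_of_ne (ne_of_mem_of_not_mem hB hb)]
        exact h1 B hB
    · rw [sum_insert hb, Function.update_self]
      rw [sum_congr rfl fun B hB => Function.update_of_ne (ne_of_mem_of_not_mem hB hb) _ _, h2]
      exact add_tsub_cancel_of_le hle

/-- Mixed norm estimate for the coefficients along a block of degree `k`. -/
lemma sum_block_rpow_le {n m k : ℕ} (hm : 1 ≤ m) (hk : 1 ≤ k) (hkm : k ≤ m)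
    {c : (Fin n → ℕ) → ℂ} (hc : ∀ α ∉ multiIndices n m, c α = 0) {M : ℝ}
    (h : ∀ z : Fin n → ℂ, (∀ i, ‖z i‖ = 1) → ‖multiEval m c z‖ ≤ M)
    {D : ℝ} (hD : 0 ≤ D) (hBH : BohnenblustHille k D) :
    ∑ β ∈ multiIndices n k,
        √(∑ γ ∈ multiIndices n m, ‖c (γ + β)‖ ^ 2) ^ (2 * (k : ℝ) / (k + 1)) ≤
      (4 : ℝ) ^ ((m : ℝ) / (k + 1)) *
        (2 * D * (k + 1) * (2 * m) ^ k * M) ^ (2 * (k : ℝ) / (k + 1)) := by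
  have hM := nonneg_of_norm_multiEval_le h
  have hmR : (1 : ℝ) ≤ m := by exact_mod_cast hm
  have hk0 : (0 : ℝ) < k := by exact_mod_cast hk
  set N := 2 * m + 1 with hN
  have hNpos : (0 : ℝ) < (N : ℝ) ^ n := by positivity
  set p : ℝ := 2 * (k : ℝ) / (k + 1) with hp
  set σ : ℝ := 1 - 1 / (2 * m) with hσ
  have hle1 : 1 / (2 * (m : ℝ)) ≤ 1 := by
    rw [div_le_one (by positivity)]
    linarith
  have hσ0 : 0 ≤ σ := by linarith
  have hσ1 : σ ≤ 1 := by
    have : 0 ≤ 1 / (2 * (m : ℝ)) := by positivity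
    linarith
  have hσm : 1 / 2 ≤ σ ^ m := by
    have h1 := one_add_mul_le_pow (a := -(1 / (2 * (m : ℝ)))) (by linarith) m
    calc (1 : ℝ) / 2 = 1 + m * (-(1 / (2 * (m : ℝ)))) := by
          field_simp
          norm_num
      _ ≤ _ := h1
      _ = _ := by rw [hσ, sub_eq_add_neg]
  let b : (Fin n → ℕ) → (Fin n → ℕ) → ℂ := fun β γ => taylorCoeff c β γ * (σ : ℂ) ^ ∑ i, γ i
  have hcb : ∀ β, ∀ γ ∈ multiIndices n m, ‖c (γ + β)‖ ≤ 2 * ‖b β γ‖ := by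
    intro β γ hγ
    simp only [b, taylorCoeff, norm_mul, norm_prod, Complex.norm_natCast, norm_pow,
      Complex.norm_real, Real.norm_eq_abs, abs_of_nonneg hσ0]
    have h1 : (1 : ℝ) ≤ ∏ i, ((γ i + β i).choose (β i) : ℝ) :=
      one_le_prod fun i _ => by exact_mod_cast Nat.choose_pos (Nat.le_add_left _ _)
    have h2 : 1 / 2 ≤ σ ^ ∑ i, γ i :=
      hσm.trans (pow_le_pow_of_le_one hσ0 hσ1 (mem_multiIndices.1 hγ))
    calc ‖c (γ + β)‖ = 2 * (‖c (γ + β)‖ * 1 * (1 / 2)) := by ring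
      _ ≤ _ := by gcongr
  have hS : ∀ β, √(∑ γ ∈ multiIndices n m, ‖c (γ + β)‖ ^ 2) ^ p ≤
      (2 : ℝ) ^ p * (∑ γ ∈ multiIndices n m, ‖b β γ‖ ^ 2) ^ ((k : ℝ) / (k + 1)) := by
    intro β
    have h1 : √(∑ γ ∈ multiIndices n m, ‖c (γ + β)‖ ^ 2) ≤
        2 * √(∑ γ ∈ multiIndices n m, ‖b β γ‖ ^ 2) := by
      refine Real.sqrt_le_iff.2 ⟨by positivity, ?_⟩
      rw [mul_pow, Real.sq_sqrt (by positivity), mul_sum]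
      refine sum_le_sum fun γ hγ => ?_
      rw [← mul_pow]
      exact pow_le_pow_left₀ (norm_nonneg _) (hcb β γ hγ) 2
    calc _ ≤ (2 * √(∑ γ ∈ multiIndices n m, ‖b β γ‖ ^ 2)) ^ p := by gcongr
      _ = _ := by
        rw [Real.mul_rpow (by norm_num) (by positivity), Real.sqrt_eq_rpow,
          ← Real.rpow_mul (by positivity)]
        congr 2
        rw [hp]
        field_simp
  have hhyp : ∀ β, (N : ℝ) ^ n *
      (∑ γ ∈ multiIndices n m, ‖b β γ‖ ^ 2) ^ ((k : ℝ) / (k + 1)) ≤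
      (4 : ℝ) ^ ((m : ℝ) / (k + 1)) * ∑ l : Fin n → Fin N,
        ‖multiEval m (taylorCoeff c β) fun i => (σ : ℂ) * unityPoint l i‖ ^ p := by
    intro β
    simp only [multiEval_smul]
    exact sum_sq_rpow_le_sum_norm_rpow hk (by omega) (b β)
  have hgrid : ∀ l : Fin n → Fin N, ∑ β ∈ multiIndices n k,
      ‖multiEval m (taylorCoeff c β) fun i => (σ : ℂ) * unityPoint l i‖ ^ p ≤
        (D * ((k + 1) * (2 * m) ^ k * M)) ^ p := fun l =>
    hBH n (fun β => multiEval m (taylorCoeff c β) fun i => (σ : ℂ) * unityPoint l i) _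
      fun w hw => norm_truncated_taylor_le hm hkm hc h (norm_unityPoint l) hw
  have htotal : (N : ℝ) ^ n * ∑ β ∈ multiIndices n k,
      (∑ γ ∈ multiIndices n m, ‖b β γ‖ ^ 2) ^ ((k : ℝ) / (k + 1)) ≤
      (N : ℝ) ^ n * ((4 : ℝ) ^ ((m : ℝ) / (k + 1)) * (D * ((k + 1) * (2 * m) ^ k * M)) ^ p) := by
    rw [mul_sum]
    refine (sum_le_sum fun β _ => hhyp β).trans ?_
    rw [← mul_sum, sum_comm]
    calc _ ≤ (4 : ℝ) ^ ((m : ℝ) / (k + 1)) *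
          ∑ l : Fin n → Fin N, (D * ((k + 1) * (2 * m) ^ k * M)) ^ p := by
          gcongr with l _
          exact hgrid l
      _ = _ := by
          rw [sum_const, card_univ, Fintype.card_fun, Fintype.card_fin, Fintype.card_fin,
            nsmul_eq_mul]
          push_cast
          ring
  have htotal' := le_of_mul_le_mul_left htotal hNpos
  refine (sum_le_sum fun β _ => hS β).trans ?_
  rw [← mul_sum]
  calc _ ≤ (2 : ℝ) ^ p *
        ((4 : ℝ) ^ ((m : ℝ) / (k + 1)) * (D * ((k + 1) * (2 * m) ^ k * M)) ^ p) := by gcongr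
    _ = (4 : ℝ) ^ ((m : ℝ) / (k + 1)) * (2 * (D * ((k + 1) * (2 * m) ^ k * M))) ^ p := by
        rw [Real.mul_rpow (x := 2) (by norm_num) (by positivity)]
        ring
    _ = _ := by
        congr 2
        ring

/-- The Bohnenblust–Hille inequality in degree `m` follows from those in the degrees of the parts
of a partition of `m`. -/
theorem BohnenblustHille.of_partition {K : Type*} [Fintype K] [DecidableEq K] {k : K → ℕ}
    {m R : ℕ} (hm : 1 ≤ m) (hk : ∀ B, 1 ≤ k B) (hkR : ∀ B, k B ≤ R) (hsum : ∑ B, k B = m)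
    {D : ℝ} (hD : 0 < D) (hBH : ∀ B, BohnenblustHille (k B) D) :
    BohnenblustHille m (2 ^ Fintype.card K * (2 * D * (R + 1) * (2 * m) ^ R)) := by
  classical
  intro n c₀ M h₀
  have hmR : (1 : ℝ) ≤ m := by exact_mod_cast hm
  set c : (Fin n → ℕ) → ℂ := fun α => if α ∈ multiIndices n m then c₀ α else 0 with hcdef
  have hcc : ∀ α ∈ multiIndices n m, c₀ α = c α := fun α hα => by simp [hcdef, hα]
  have hc : ∀ α ∉ multiIndices n m, c α = 0 := fun α hα => by simp [hcdef, hα]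
  have h : ∀ z : Fin n → ℂ, (∀ i, ‖z i‖ = 1) → ‖multiEval m c z‖ ≤ M := by
    intro z hz
    have : multiEval m c z = multiEval m c₀ z :=
      sum_congr rfl fun α hα => by rw [hcc α hα]
    rw [this]
    exact h₀ z hz
  rw [sum_congr rfl fun α hα => by rw [hcc α hα]]
  set F : ℝ := 2 * D * (R + 1) * (2 * m) ^ R with hF
  have hF0 : 0 < F := by positivity
  set q : ℝ := 2 * (m : ℝ) / (m + 1) with hq
  have hq0 : 0 < q := by positivity
  have hsupp : ∑ α ∈ multiIndices n m, ‖c α‖ ^ q =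
      ∑ α ∈ multiIndices n m with c α ≠ 0, ‖c α‖ ^ q := by
    symm
    refine sum_filter_of_ne fun α _ hne h0 => hne ?_
    rw [h0, norm_zero, Real.zero_rpow hq0.ne']
  rcases (nonneg_of_norm_multiEval_le h).eq_or_lt with hM | hM
  · have hpar := sum_norm_sq_unityPoint (N := m + 1) (multiIndices n m)
      (fun α hα i => Nat.lt_succ_of_le (le_of_mem_multiIndices hα i)) c
    have hzero : ∀ l : Fin n → Fin (m + 1),
        ∑ α ∈ multiIndices n m, c α * ∏ i, unityPoint l i ^ α i = 0 := fun l =>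
      norm_le_zero_iff.1 (by rw [hM]; exact h _ (norm_unityPoint l))
    simp only [hzero, norm_zero, ne_eq, OfNat.ofNat_ne_zero, not_false_eq_true, zero_pow,
      sum_const_zero] at hpar
    have hS : ∑ α ∈ multiIndices n m, ‖c α‖ ^ 2 = 0 := by
      rcases mul_eq_zero.1 hpar.symm with h1 | h1
      · exact absurd h1 (by positivity)
      · exact h1
    rw [sum_eq_zero_iff_of_nonneg fun _ _ => by positivity] at hS
    rw [sum_eq_zero fun α hα => by
      rw [pow_eq_zero_iff two_ne_zero |>.1 (hS α hα), Real.zero_rpow hq0.ne']]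
    rw [← hM, mul_zero]
    exact Real.rpow_nonneg le_rfl _
  rw [hsupp]
  have hdec : ∀ α : Fin n → ℕ, ∃ β : K → Fin n → ℕ, α ∈ multiIndices n m →
      (∀ B, β B ∈ multiIndices n (k B)) ∧ ∑ B, β B = α := by
    intro α
    by_cases hα : α ∈ multiIndices n m
    · obtain ⟨β, h1, h2⟩ := exists_sum_eq_of_sum_le k univ α (by
        rw [hsum]
        exact mem_multiIndices.1 hα)
      exact ⟨β, fun _ => ⟨fun B => mem_multiIndices.2 (h1 B (mem_univ B)), h2⟩⟩
    · exact ⟨0, fun h => absurd h hα⟩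
  choose π hπ using hdec
  have hle : ∀ α ∈ multiIndices n m, ∀ B, π α B ≤ α := by
    intro α hα B
    conv_rhs => rw [← (hπ α hα).2]
    exact single_le_sum (f := fun B => π α B) (fun _ _ _ => Nat.zero_le _) (mem_univ B)
  have hkm : ∀ B, k B ≤ m := fun B => by
    rw [← hsum]
    exact single_le_sum (f := k) (fun _ _ => Nat.zero_le _) (mem_univ B)
  let V : K → ℝ := fun B =>
    (4 : ℝ) ^ ((m : ℝ) / (k B + 1)) * (F * M) ^ (2 * (k B : ℝ) / (k B + 1))
  have hblei := sum_rpow_le_prod_of_fiber_sum_sq_le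
    (s := {α ∈ multiIndices n m | c α ≠ 0}) (π := fun B α => π α B)
    (T := fun B => multiIndices n (k B))
    (fun B α hα => (hπ α (mem_filter.1 hα).1).1 B)
    (by
      intro α hα α' hα' heq
      rw [← (hπ α (mem_filter.1 hα).1).2, ← (hπ α' (mem_filter.1 hα').1).2]
      exact sum_congr rfl fun B _ => congrFun heq B)
    k m hsum (x := fun α => ‖c α‖) (fun α hα => norm_pos_iff.2 (mem_filter.1 hα).2)
    (u := fun _ y => √(∑ γ ∈ multiIndices n m, ‖c (γ + y)‖ ^ 2))
    (fun _ _ => Real.sqrt_nonneg _)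
    (by
      intro B y
      rw [Real.sq_sqrt (by positivity), filter_filter]
      set S := {α ∈ multiIndices n m | c α ≠ 0 ∧ π α B = y}
      have hy : ∀ α ∈ S, α - y + y = α := by
        intro α hα
        obtain ⟨h1, -, h2⟩ := mem_filter.1 hα
        exact tsub_add_cancel_of_le (h2 ▸ hle α h1 B)
      have hinj : Set.InjOn (fun α => α - y) (S : Set (Fin n → ℕ)) := by
        intro α hα α' hα' heq
        rw [← hy α hα, ← hy α' hα']
        exact congrArg (· + y) heq
      calc ∑ α ∈ S, ‖c α‖ ^ 2 = ∑ α ∈ S, ‖c (α - y + y)‖ ^ 2 :=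
            sum_congr rfl fun α hα => by rw [hy α hα]
        _ = ∑ γ ∈ S.image fun α => α - y, ‖c (γ + y)‖ ^ 2 :=
            (sum_image (f := fun γ => ‖c (γ + y)‖ ^ 2) hinj).symm
        _ ≤ _ := by
            refine sum_le_sum_of_subset_of_nonneg (fun γ hγ => ?_) fun _ _ _ => by positivity
            obtain ⟨α, hα, rfl⟩ := mem_image.1 hγ
            exact mem_multiIndices.2 ((sum_le_sum fun i _ => Nat.sub_le _ _).trans
              (mem_multiIndices.1 (mem_filter.1 hα).1)))
    V (fun B => by positivity)
    (by
      intro B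
      refine (sum_block_rpow_le hm (hk B) (hkm B) hc h hD.le (hBH B)).trans ?_
      have hkR' : (k B : ℝ) ≤ R := by exact_mod_cast hkR B
      simp only [V]
      gcongr
      rw [hF]
      gcongr
      · linarith
      · exact hkR B)
  refine hblei.trans_eq ?_
  have hVB : ∀ B, V B ^ (((k B : ℝ) + 1) / (m + 1)) =
      (4 : ℝ) ^ ((m : ℝ) / (m + 1)) * (F * M) ^ (2 * (k B : ℝ) / (m + 1)) := by
    intro B
    simp only [V]
    rw [Real.mul_rpow (by positivity) (by positivity), ← Real.rpow_mul (by positivity),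
      ← Real.rpow_mul (by positivity)]
    congr 2 <;> field_simp
  have h4 : ((4 : ℝ) ^ ((m : ℝ) / (m + 1))) ^ Fintype.card K =
      ((2 : ℝ) ^ Fintype.card K) ^ (2 * (m : ℝ) / (m + 1)) := by
    rw [← Real.rpow_natCast, ← Real.rpow_natCast, ← Real.rpow_mul (by positivity),
      ← Real.rpow_mul (by positivity), show (4 : ℝ) = 2 ^ (2 : ℝ) by norm_num,
      ← Real.rpow_mul (by positivity)]
    congr 1
    ring
  rw [prod_congr rfl fun B _ => hVB B, prod_mul_distrib, prod_const, card_univ,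
    ← Real.rpow_sum_of_pos (by positivity), ← sum_div, ← mul_sum, ← Nat.cast_sum, hsum, h4,
    ← Real.mul_rpow (by positivity) (by positivity), ← mul_assoc]

lemma bohnenblustHille_of_one_le {m : ℕ} (hm : 1 ≤ m) : BohnenblustHille m (2 ^ m * (8 * m)) := by
  have h := BohnenblustHille.of_partition (K := Fin m) (k := fun _ => 1) (R := 1) hm
    (fun _ => le_rfl) (fun _ => le_rfl) (by simp) one_pos fun _ => bohnenblustHille_one
  convert h using 1
  rw [Fintype.card_fin]
  push_cast
  ring

/-- The constant obtained by cutting the degree `m` into about `m / k` blocks. -/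
lemma bohnenblustHille_of_le {m k : ℕ} (hk : 1 ≤ k) (hkm : k ≤ m) :
    BohnenblustHille m (2 ^ (m / k + 5 + 7 * k) * m ^ (2 * k)) := by
  have hr : 0 < m / k := Nat.div_pos hkm hk
  have hmod := Nat.mod_lt m hk
  have hmR : (1 : ℝ) ≤ m := by exact_mod_cast hk.trans hkm
  have hkR : (k : ℝ) ≤ 2 ^ k := by exact_mod_cast Nat.lt_two_pow_self.le
  have hk2 : (2 * k : ℝ) + 1 ≤ 2 ^ (2 * k) := by
    exact_mod_cast Nat.succ_le_of_lt (Nat.lt_two_pow_self (n := 2 * k))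
  let s : Fin (m / k) → ℕ := fun B => k + if B = ⟨0, hr⟩ then m % k else 0
  have hs2 : ∀ B, s B ≤ 2 * k := fun B => by
    simp only [s]
    split_ifs <;> omega
  have hs1 : ∀ B, 1 ≤ s B := fun B => hk.trans (Nat.le_add_right _ _)
  have hsum : ∑ B, s B = m := by
    simp only [s, sum_add_distrib, sum_const, card_univ, Fintype.card_fin, smul_eq_mul,
      sum_ite_eq', mem_univ, if_true]
    rw [mul_comm]
    exact Nat.div_add_mod m k
  have h := BohnenblustHille.of_partition (hk.trans hkm) hs1 hs2 hsum
    (D := 2 ^ (2 * k) * (8 * (2 * k : ℕ))) (by positivity) fun B =>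
      (bohnenblustHille_of_one_le (hs1 B)).mono (by positivity) (by
        have := hs2 B
        gcongr
        norm_num)
  refine h.mono (by positivity) ?_
  rw [Fintype.card_fin]
  push_cast
  calc (2 : ℝ) ^ (m / k) * (2 * (2 ^ (2 * k) * (8 * (2 * k))) * (2 * k + 1) * (2 * m) ^ (2 * k))
      ≤ (2 : ℝ) ^ (m / k) *
        (2 * (2 ^ (2 * k) * (8 * (2 * 2 ^ k))) * 2 ^ (2 * k) * (2 * m) ^ (2 * k)) := by gcongr
    _ = _ := by
        rw [mul_pow]
        ring

/-- A suitable number of blocks gives a constant that is subexponential in the degree. -/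
lemma bohnenblustHille_subexponential {m : ℕ} (hm : 2 ≤ m) :
    BohnenblustHille m (Real.exp 24 ^ √(m * Real.log m)) := by
  have hmR : (2 : ℝ) ≤ m := by exact_mod_cast hm
  have hlog2 := Real.log_two_gt_d9
  have hlogm : Real.log 2 ≤ Real.log m := Real.log_le_log two_pos hmR
  set l := Real.log m with hl
  have hl0 : 0 < l := by linarith
  have hlm : l ≤ m := (Real.log_le_sub_one_of_pos (by linarith)).trans (by linarith)
  set a := √(m : ℝ)
  set b := √l
  have ha : 0 < a := Real.sqrt_pos.2 (by linarith)
  have hb : 0 < b := Real.sqrt_pos.2 hl0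
  have ha2 : a ^ 2 = m := Real.sq_sqrt (by linarith)
  have hb2 : b ^ 2 = l := Real.sq_sqrt hl0.le
  have hba : b ≤ a := Real.sqrt_le_sqrt hlm
  have hL : √(m * l) = a * b := Real.sqrt_mul (by linarith) _
  have hL1 : 1 ≤ a * b := by
    rw [← hL, Real.one_le_sqrt]
    nlinarith
  set k := ⌈a / b⌉₊
  have hk : 1 ≤ k := Nat.one_le_iff_ne_zero.2 (Nat.ceil_pos.2 (by positivity)).ne'
  have hk_ge : a / b ≤ k := Nat.le_ceil _
  have hk_lt : (k : ℝ) < a / b + 1 := Nat.ceil_lt_add_one (by positivity)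
  have hkm : k ≤ m := by
    refine Nat.ceil_le.2 ?_
    rw [div_le_iff₀ hb, ← ha2]
    nlinarith
  have hkl : k * l ≤ 2 * (a * b) := by
    have h1 : k * l ≤ (a / b + 1) * l := by gcongr
    have h2 : (a / b + 1) * l = a * b + b * b := by
      rw [← hb2]
      field_simp
    nlinarith
  have hr : ((m / k : ℕ) : ℝ) ≤ a * b := by
    refine Nat.cast_div_le.trans ?_
    rw [div_le_iff₀ (by positivity)]
    calc (m : ℝ) = a * b * (a / b) := by
          rw [← ha2]
          field_simp
      _ ≤ _ := by gcongr
  refine (bohnenblustHille_of_le hk hkm).mono (by positivity) ?_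
  rw [hL, ← Real.exp_mul, ← Real.log_le_iff_le_exp (by positivity), Real.log_mul (by positivity)
    (by positivity), Real.log_pow, Real.log_pow, ← hl]
  push_cast
  have h2lt := Real.log_two_lt_d9
  have h1 : (k : ℝ) * Real.log 2 ≤ k * l := by gcongr
  have h2 : ((m / k : ℕ) : ℝ) * Real.log 2 ≤ ((m / k : ℕ) : ℝ) * 1 := by
    gcongr
    linarith
  nlinarith

/-- Bohnenblust–Hille inequality on the polytorus: for every `d ≥ 1` there is `C(d) > 0` such
that for all `n ≥ 1` and every analytic polynomial `f(z) = ∑_{|α| ≤ d} c_α z^α` of degree at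
most `d`, `(∑_α |c_α|^{2d/(d+1)})^{(d+1)/(2d)} ≤ C(d) · sup_{z ∈ 𝕋ⁿ} |f(z)|`; moreover
`C(d) ≤ C^√(d log d)` for some universal constant `C`. -/
theorem stmt4 :
    ∃ C : ℝ, 0 < C ∧ ∀ d : ℕ, 1 ≤ d →
      ∃ Cd : ℝ, 0 < Cd ∧ Cd ≤ C ^ Real.sqrt (d * Real.log d) ∧
        ∀ n : ℕ, 1 ≤ n → ∀ c : (Fin n → Fin (d + 1)) → ℂ,
          (∀ α : Fin n → Fin (d + 1), d < ∑ j, (α j : ℕ) → c α = 0) →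
          (∑ α : Fin n → Fin (d + 1), ‖c α‖ ^ ((2 * (d : ℝ)) / ((d : ℝ) + 1)))
              ^ (((d : ℝ) + 1) / (2 * (d : ℝ)))
            ≤ Cd * ⨆ (z : Fin n → ℂ) (_ : ∀ i, ‖z i‖ = 1),
                ‖∑ α : Fin n → Fin (d + 1), c α * ∏ j, z j ^ (α j : ℕ)‖ := by
  refine ⟨Real.exp 24, Real.exp_pos _, fun d hd =>
    ⟨Real.exp 24 ^ √(d * Real.log d), by positivity, le_rfl, fun n _ c hc => ?_⟩⟩
  have hBH : BohnenblustHille d (Real.exp 24 ^ √(d * Real.log d)) := by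
    rcases hd.eq_or_lt with rfl | hd'
    · simpa using bohnenblustHille_one
    · exact bohnenblustHille_subexponential hd'
  have hd0 : (0 : ℝ) < d := by exact_mod_cast hd
  have hq0 : 2 * (d : ℝ) / (d + 1) ≠ 0 := by positivity
  let val : (Fin n → Fin (d + 1)) → Fin n → ℕ := fun α i => α i
  have hval : Function.Injective val := fun α β h => funext fun i => Fin.ext (congrFun h i)
  let c' : (Fin n → ℕ) → ℂ := Function.extend val c 0
  have hc' : ∀ α, c' (val α) = c α := fun α => hval.extend_apply _ _ _
  have hsum : ∀ {E : Type} [AddCommMonoid E] (f : (Fin n → ℕ) → E), (∀ α, c' α = 0 → f α = 0) →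
      ∑ α : Fin n → Fin (d + 1), f (val α) = ∑ α ∈ multiIndices n d, f α := by
    intro E _ f hf
    have hfilter : ∑ α : Fin n → Fin (d + 1) with val α ∈ multiIndices n d, f (val α) =
        ∑ α : Fin n → Fin (d + 1), f (val α) := by
      refine sum_filter_of_ne fun α _ hne => ?_
      by_contra hmem
      rw [mem_multiIndices, not_le] at hmem
      exact hne (hf _ (by rw [hc', hc α hmem]))
    rw [← hfilter]
    refine sum_of_injOn val hval.injOn (fun α hα => (mem_filter.1 hα).2) (fun α hα hni => ?_)
      fun _ _ => rfl
    refine absurd ⟨fun i => ⟨α i, Nat.lt_succ_of_le (le_of_mem_multiIndices hα i)⟩, ?_, rfl⟩ hni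
    exact mem_coe.2 (mem_filter.2 ⟨mem_univ _, hα⟩)
  have heval : ∀ z : Fin n → ℂ,
      ∑ α : Fin n → Fin (d + 1), c α * ∏ j, z j ^ (α j : ℕ) = multiEval d c' z := by
    intro z
    rw [multiEval, ← hsum (fun α => c' α * ∏ j, z j ^ α j) fun α h => by simp [h]]
    exact sum_congr rfl fun α _ => by rw [hc']
  have hnorm : ∑ α : Fin n → Fin (d + 1), ‖c α‖ ^ (2 * (d : ℝ) / (d + 1)) =
      ∑ α ∈ multiIndices n d, ‖c' α‖ ^ (2 * (d : ℝ) / (d + 1)) := by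
    rw [← hsum (fun α => ‖c' α‖ ^ (2 * (d : ℝ) / (d + 1))) fun α h => by
      simp [h, Real.zero_rpow hq0]]
    exact sum_congr rfl fun α _ => by rw [hc']
  simp only [heval, hnorm]
  set M := ⨆ (z : Fin n → ℂ) (_ : ∀ i, ‖z i‖ = 1), ‖multiEval d c' z‖
  have hbdd : BddAbove (Set.range fun z : Fin n → ℂ =>
      ⨆ _ : ∀ i, ‖z i‖ = 1, ‖multiEval d c' z‖) := by
    refine ⟨∑ α ∈ multiIndices n d, ‖c' α‖, ?_⟩
    rintro _ ⟨z, rfl⟩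
    refine Real.iSup_le (fun hz => ?_) (sum_nonneg fun _ _ => norm_nonneg _)
    refine (norm_sum_le _ _).trans (sum_le_sum fun α _ => ?_)
    simp [hz]
  have hM : ∀ z : Fin n → ℂ, (∀ i, ‖z i‖ = 1) → ‖multiEval d c' z‖ ≤ M := by
    intro z hz
    have h1 := le_ciSup hbdd z
    rwa [ciSup_pos hz] at h1
  have hM0 := nonneg_of_norm_multiEval_le hM
  calc _ ≤ ((Real.exp 24 ^ √(d * Real.log d) * M) ^ (2 * (d : ℝ) / (d + 1))) ^
        (((d : ℝ) + 1) / (2 * d)) := by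
        gcongr
        exact hBH n c' M hM
    _ = _ := by
        rw [← Real.rpow_mul (by positivity)]
        have h1 : 2 * (d : ℝ) / (d + 1) * ((d + 1) / (2 * d)) = 1 := by field_simp
        rw [h1, Real.rpow_one]
end

section
/- Fix integers n ≥ 1 and 1 ≤ k ≤ d. For any complex array (a_𝐢)_{𝐢 ∈ [n]^d}, one has (∑_{𝐢 ∈ [n]^d} |a_𝐢|^{2d/(d+1)})^{(d+1)/(2d)} ≤ ∏_{S ⊆ [d], |S| = k} [ ( ∑_{𝐢_S} ( ∑_{𝐢_{S^c}} |a_𝐢|^2 )^{(1/2)·(2k/(k+1))} )^{(k+1)/(2k)} ]^{1/binom(d,k)}, where for S ⊆ [d] the inner sum ∑_{𝐢_{S^c}} runs over the coordinates i_j with j ∉ S and the outer sum ∑_{𝐢_S} runs over the coordinates i_j with j ∈ S. -/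
open Finset

section
open scoped BigOperators

/-- Hölder's inequality for finitely many functions, with weights that sum to one. -/
theorem sum_mul_prod_rpow_le_prod_sum_mul_rpow {α σ : Type*} (u : Finset α) (t : Finset σ)
    (μ : α → ℝ) (w : σ → ℝ) (f : σ → α → ℝ) (hμ : ∀ i ∈ u, 0 ≤ μ i) (hw : ∀ s ∈ t, 0 < w s)
    (hw1 : ∑ s ∈ t, w s = 1) (hf : ∀ s ∈ t, ∀ i ∈ u, 0 ≤ f s i) :
    ∑ i ∈ u, μ i * ∏ s ∈ t, f s i ^ w s ≤ ∏ s ∈ t, (∑ i ∈ u, μ i * f s i) ^ w s := by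
  have hF : ∀ s ∈ t, 0 ≤ ∑ i ∈ u, μ i * f s i := fun s hs =>
    sum_nonneg fun i hi => mul_nonneg (hμ i hi) (hf s hs i hi)
  by_cases h0 : ∃ s ∈ t, ∑ i ∈ u, μ i * f s i = 0
  · obtain ⟨s, hs, h0⟩ := h0
    rw [sum_eq_zero_iff_of_nonneg fun i hi => mul_nonneg (hμ i hi) (hf s hs i hi)] at h0
    refine (sum_nonpos fun i hi => le_of_eq ?_).trans
      (prod_nonneg fun s hs => Real.rpow_nonneg (hF s hs) _)
    rcases mul_eq_zero.1 (h0 i hi) with h | h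
    · rw [h, zero_mul]
    · rw [prod_eq_zero hs (by rw [h, Real.zero_rpow (hw s hs).ne']), mul_zero]
  · push Not at h0
    have hpos : ∀ s ∈ t, 0 < ∑ i ∈ u, μ i * f s i := fun s hs =>
      lt_of_le_of_ne (hF s hs) (h0 s hs).symm
    set F : σ → ℝ := fun s => ∑ i ∈ u, μ i * f s i
    calc ∑ i ∈ u, μ i * ∏ s ∈ t, f s i ^ w s
        = (∏ s ∈ t, F s ^ w s) * ∑ i ∈ u, μ i * ∏ s ∈ t, (f s i / F s) ^ w s := by
          rw [mul_sum]
          refine sum_congr rfl fun i hi => ?_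
          rw [mul_left_comm, ← prod_mul_distrib]
          congr 1
          refine prod_congr rfl fun s hs => ?_
          rw [← Real.mul_rpow (hF s hs) (div_nonneg (hf s hs i hi) (hF s hs)),
            mul_div_cancel₀ _ (hpos s hs).ne']
      _ ≤ (∏ s ∈ t, F s ^ w s) * ∑ i ∈ u, μ i * ∑ s ∈ t, w s * (f s i / F s) := by
          refine mul_le_mul_of_nonneg_left (sum_le_sum fun i hi =>
            mul_le_mul_of_nonneg_left ?_ (hμ i hi))
            (prod_nonneg fun s hs => Real.rpow_nonneg (hF s hs) _)
          exact Real.geom_mean_le_arith_mean_weighted t w _ (fun s hs => (hw s hs).le) hw1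
            fun s hs => div_nonneg (hf s hs i hi) (hF s hs)
      _ = (∏ s ∈ t, F s ^ w s) * ∑ s ∈ t, w s * ((∑ i ∈ u, μ i * f s i) / F s) := by
          simp_rw [mul_sum, sum_div, mul_sum]
          rw [sum_comm]
          exact sum_congr rfl fun s _ => sum_congr rfl fun i _ => by ring
      _ = ∏ s ∈ t, F s ^ w s := by
          rw [sum_congr rfl fun s hs => by
            rw [show ∑ i ∈ u, μ i * f s i = F s from rfl, div_self (hpos s hs).ne', mul_one],
            hw1, mul_one]

/-- Hölder's inequality for averages of finitely many functions. -/
theorem expect_prod_rpow_le_prod_expect_rpow {α σ : Type*} [Fintype α] (t : Finset σ)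
    (w : σ → ℝ) (f : σ → α → ℝ) (hw : ∀ s ∈ t, 0 < w s)
    (hw1 : ∑ s ∈ t, w s = 1) (hf : ∀ s ∈ t, ∀ i, 0 ≤ f s i) :
    𝔼 i, ∏ s ∈ t, f s i ^ w s ≤ ∏ s ∈ t, (𝔼 i, f s i) ^ w s := by
  simp_rw [Fintype.expect_eq_sum_div_card, div_eq_inv_mul, mul_sum]
  exact sum_mul_prod_rpow_le_prod_sum_mul_rpow univ t (fun _ => (Fintype.card α : ℝ)⁻¹) w f
    (fun _ _ => by positivity) hw hw1 fun s hs i _ => hf s hs i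

theorem expect_fin_succ {α : Type*} [Fintype α] {d : ℕ} (f : (Fin (d + 1) → α) → ℝ) :
    𝔼 i, f i = 𝔼 i' : Fin d → α, 𝔼 x : α, f (Fin.cons x i') := by
  rw [← Fintype.expect_equiv (Fin.consEquiv fun _ : Fin (d + 1) => α)
    (fun p => f (Fin.cons p.1 p.2)) f fun _ => rfl, ← univ_product_univ, expect_product,
    expect_comm]

/-- Finner's inequality on a finite probability space: each `f s` depends only on the coordinates
in `S s`, and the weights of the sets containing any given coordinate sum to one. -/
theorem expect_prod_rpow_le_of_dependsOn {α σ : Type*} [Fintype α] [Nonempty α] (t : Finset σ)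
    (w : σ → ℝ) (hw : ∀ s ∈ t, 0 < w s) {d : ℕ} (S : σ → Finset (Fin d))
    (hS : ∀ j, ∑ s ∈ t with j ∈ S s, w s = 1) (f : σ → (Fin d → α) → ℝ)
    (hf : ∀ s ∈ t, ∀ i, 0 ≤ f s i) (hdep : ∀ s ∈ t, DependsOn (f s) (S s : Set (Fin d))) :
    𝔼 i, ∏ s ∈ t, f s i ^ w s ≤ ∏ s ∈ t, (𝔼 i, f s i) ^ w s := by
  induction d with
  | zero => simp
  | succ d ih =>
    have hg : ∀ s ∈ t, ∀ i' : Fin d → α, 0 ≤ 𝔼 x, f s (Fin.cons x i') := fun s hs i' =>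
      expect_nonneg fun x _ => hf s hs _
    simp_rw [expect_fin_succ]
    refine le_trans (expect_le_expect fun i' _ => ?_)
      (ih (fun s => univ.filter fun j => j.succ ∈ S s) (fun j => by simpa using hS j.succ)
        (fun s i' => 𝔼 x, f s (Fin.cons x i')) hg fun s hs i' i'' h => ?_)
    · rw [← prod_filter_mul_prod_filter_not t (fun s => 0 ∈ S s)]
      have hconst : ∀ s ∈ t.filter (fun s => 0 ∉ S s), ∀ x,
          f s (Fin.cons x i') = 𝔼 y, f s (Fin.cons y i') := by
        intro s hs x
        rw [mem_filter] at hs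
        rw [← Fintype.expect_const (ι := α) (f s (Fin.cons x i'))]
        refine expect_congr rfl fun y _ => hdep s hs.1 fun j hj => ?_
        induction j using Fin.cases with
        | zero => exact absurd hj hs.2
        | succ j => simp
      have hsplit : ∀ x, ∏ s ∈ t, f s (Fin.cons x i') ^ w s =
          (∏ s ∈ t with 0 ∈ S s, f s (Fin.cons x i') ^ w s) *
            ∏ s ∈ t with 0 ∉ S s, (𝔼 y, f s (Fin.cons y i')) ^ w s := fun x => by
        rw [← prod_filter_mul_prod_filter_not t (fun s => 0 ∈ S s)]
        congr 1
        exact prod_congr rfl fun s hs => by rw [hconst s hs x]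
      simp_rw [hsplit]
      rw [← expect_mul]
      refine mul_le_mul_of_nonneg_right ?_ (prod_nonneg fun s hs =>
        Real.rpow_nonneg (hg s (mem_filter.1 hs).1 i') _)
      exact expect_prod_rpow_le_prod_expect_rpow _ w (fun s x => f s (Fin.cons x i'))
        (fun s hs => hw s (mem_filter.1 hs).1) (hS 0) fun s hs x => hf s (mem_filter.1 hs).1 _
    · refine expect_congr rfl fun x _ => hdep s hs fun j hj => ?_
      induction j using Fin.cases with
      | zero => simp
      | succ j => simpa using h j (by simpa using hj)

/-- Sums over `ι → α` split into sums over the coordinates in `S` and those outside `S`. -/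
theorem sum_eq_sum_sum_glue {ι α : Type*} [Fintype ι] [DecidableEq ι] [Fintype α] (S : Finset ι)
    (F : (ι → α) → ℝ) :
    ∑ i, F i = ∑ b : {j // j ∈ S} → α, ∑ c : {j // j ∉ S} → α,
      F (fun j => if h : j ∈ S then b ⟨j, h⟩ else c ⟨j, h⟩) := by
  rw [← Fintype.sum_prod_type']
  exact (Fintype.sum_equiv (Equiv.piEquivPiSubtypeProd (· ∈ S) fun _ => α).symm _ _
    fun _ => rfl).symm

/-- Finner's inequality for the counting measure. -/
theorem sum_prod_rpow_le_prod_sum_rpow {α σ : Type*} [Fintype α] [Nonempty α] (t : Finset σ)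
    (w : σ → ℝ) (hw : ∀ s ∈ t, 0 < w s) {d : ℕ} (S : σ → Finset (Fin d))
    (hS : ∀ j, ∑ s ∈ t with j ∈ S s, w s = 1) (f : ∀ s, ({j // j ∈ S s} → α) → ℝ)
    (hf : ∀ s ∈ t, ∀ b, 0 ≤ f s b) :
    ∑ i : Fin d → α, ∏ s ∈ t, f s (fun j => i j) ^ w s ≤ ∏ s ∈ t, (∑ b, f s b) ^ w s := by
  have hn : (0 : ℝ) < Fintype.card α := by exact_mod_cast Fintype.card_pos
  have hexp : ∀ s ∈ t, 𝔼 i : Fin d → α, f s (fun j => i j) =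
      (∑ b, f s b) * ((Fintype.card α : ℝ) ^ (#(S s) : ℝ))⁻¹ := by
    intro s _
    rw [Fintype.expect_eq_sum_div_card, sum_eq_sum_sum_glue (S s)]
    simp only [Subtype.coe_eta, coe_mem, dite_true, sum_const, card_univ, Fintype.card_fun,
      nsmul_eq_mul, ← mul_sum, Fintype.card_fin]
    have hle : #(S s) ≤ d := by simpa using card_le_univ (S s)
    have hc : Fintype.card {j // j ∉ S s} = d - #(S s) := by
      rw [Fintype.card_subtype_compl]; simp
    rw [hc, Real.rpow_natCast]
    push_cast
    rw [pow_sub₀ _ hn.ne' hle]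
    field_simp
  have hcard : ∑ s ∈ t, (#(S s) : ℝ) * w s = d := by
    have h : ∀ s ∈ t, (#(S s) : ℝ) * w s = ∑ j, if j ∈ S s then w s else 0 := by
      intro s _
      rw [← sum_filter, sum_const, nsmul_eq_mul]
      simp
    rw [sum_congr rfl h, sum_comm]
    simp_rw [← sum_filter, hS]
    simp
  have key := expect_prod_rpow_le_of_dependsOn t w hw S hS (fun s i => f s (fun j => i j))
    (fun s hs i => hf s hs _) fun s hs i i' h => 
      congrArg (f s) (funext fun j => h j.1 j.2)
  rw [prod_congr rfl fun s hs => by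
    rw [hexp s hs, Real.mul_rpow (sum_nonneg fun b _ => hf s hs b) (by positivity),
      Real.inv_rpow (by positivity), ← Real.rpow_mul hn.le], prod_mul_distrib, prod_inv_distrib,
    ← Real.rpow_sum_of_pos hn, hcard, Fintype.expect_eq_sum_div_card, ← div_eq_mul_inv,
    Real.rpow_natCast, Fintype.card_fun, Fintype.card_fin, Nat.cast_pow] at key
  exact (div_le_div_iff_of_pos_right (by positivity)).1 key

/-- The number of `k`-element subsets of `Fin d` containing a given element. -/
theorem card_filter_mem_powersetCard {d k : ℕ} (hk : 1 ≤ k) (j : Fin d) :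
    #{S ∈ powersetCard k (univ : Finset (Fin d)) | j ∈ S} = (d - 1).choose (k - 1) := by
  simpa [hk] using card_filter_powersetCard_subset {j} (univ : Finset (Fin d)) k

theorem rpow_le_mul_of_le {x X q v w w₀ : ℝ} (hx : 0 ≤ x) (hxX : x ≤ X) (hw : 0 < w)
    (h : q * (v * w₀ + w) = w) :
    x ^ w ≤ ((X ^ q) ^ v) ^ w₀ * (x / X * X ^ q) ^ w := by
  rcases hx.eq_or_lt with rfl | hx
  · rw [Real.zero_rpow hw.ne']
    positivity
  · have hX : 0 < X := hx.trans_le hxX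
    rw [Real.mul_rpow (by positivity) (by positivity), Real.div_rpow hx.le hX.le,
      ← Real.rpow_mul hX.le, ← Real.rpow_mul hX.le, ← Real.rpow_mul hX.le,
      show X ^ (q * v * w₀) * (x ^ w / X ^ w * X ^ (q * w)) =
        x ^ w * (X ^ (q * v * w₀) * X ^ (q * w)) / X ^ w by ring, ← Real.rpow_add hX,
      show q * v * w₀ + q * w = w by linarith, mul_div_cancel_right₀ _ (by positivity)]

/-- A Hölder bound interpolating between an array `x` and majorants `X s` of it. -/
theorem sum_rpow_le_of_le {α σ : Type*} [Fintype α] (t : Finset σ) (x : α → ℝ) (X : σ → α → ℝ)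
    {q v w w₀ : ℝ} (hx : ∀ i, 0 ≤ x i) (hxX : ∀ s i, x i ≤ X s i) (hw : 0 < w) (hw₀ : 0 < w₀)
    (hq : q * (v * w₀ + w) = w) (hsum : w₀ + #t * w = 1) :
    ∑ i, x i ^ (#t * w) ≤ (∑ i, ∏ s ∈ t, (X s i ^ q) ^ v) ^ w₀ *
      ∏ s ∈ t, (∑ i, x i / X s i * X s i ^ q) ^ w := by
  have hX0 : ∀ s i, 0 ≤ X s i := fun s i => (hx i).trans (hxX s i)
  have hXq : ∀ s i, 0 ≤ (X s i ^ q) ^ v := fun s i =>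
    Real.rpow_nonneg (Real.rpow_nonneg (hX0 s i) _) _
  have hG0 : ∀ i, 0 ≤ ∏ s ∈ t, (X s i ^ q) ^ v := fun i => prod_nonneg fun s _ => hXq s i
  have hF0 : ∀ s i, 0 ≤ x i / X s i * X s i ^ q :=
    fun s i => mul_nonneg (div_nonneg (hx i) (hX0 s i)) (Real.rpow_nonneg (hX0 s i) _)
  have hholder := sum_mul_prod_rpow_le_prod_sum_mul_rpow univ (insertNone t) (fun _ => 1)
    (fun o => o.elim w₀ fun _ => w)
    (fun o i => o.elim (∏ s ∈ t, (X s i ^ q) ^ v) fun s => x i / X s i * X s i ^ q)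
    (fun _ _ => zero_le_one)
    (fun o _ => by cases o <;> assumption)
    (by simpa [sum_insertNone] using hsum)
    (fun o _ i _ => by
      cases o with
      | none => exact hG0 i
      | some s => exact hF0 s i)
  simp only [prod_insertNone, Option.elim, one_mul] at hholder
  refine le_trans (sum_le_sum fun i _ => ?_) hholder
  rw [← Real.finsetProd_rpow _ _ fun s _ => hXq s i, ← prod_mul_distrib, mul_comm,
    Real.rpow_mul (hx i), Real.rpow_natCast, ← prod_const]
  exact prod_le_prod (fun s _ => Real.rpow_nonneg (hx i) w)
    fun s _ => rpow_le_mul_of_le (hx i) (hxX s i) hw hq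

/-- Blei's inequality for a nonnegative array `x`, which plays the role of `|a|²`. -/
theorem sum_rpow_le_prod_sum_rpow_sum {α : Type*} [Fintype α] [Nonempty α] {d k : ℕ}
    (hk : 1 ≤ k) (hkd : k ≤ d) (x : (Fin d → α) → ℝ) (hx : ∀ i, 0 ≤ x i) :
    ∑ i, x i ^ ((d : ℝ) / (d + 1)) ≤
      ∏ S ∈ powersetCard k (univ : Finset (Fin d)),
        (∑ b : {j // j ∈ S} → α, (∑ c : {j // j ∉ S} → α,
          x (fun j => if h : j ∈ S then b ⟨j, h⟩ else c ⟨j, h⟩)) ^ ((k : ℝ) / (k + 1))) ^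
            ((d : ℝ) / (d + 1) * ((k + 1) / (k * d.choose k))) := by
  have hk0 : (0 : ℝ) < k := by exact_mod_cast hk
  have hd0 : (0 : ℝ) < d := by exact_mod_cast hk.trans hkd
  have hC : (0 : ℝ) < d.choose k := by exact_mod_cast Nat.choose_pos hkd
  have hB : (0 : ℝ) < (d - 1).choose (k - 1) := by exact_mod_cast Nat.choose_pos (by omega)
  have hBC : (d : ℝ) * (d - 1).choose (k - 1) = d.choose k * k := by
    obtain ⟨k, rfl⟩ := Nat.exists_eq_add_of_le' hk
    obtain ⟨d, rfl⟩ := Nat.exists_eq_add_of_le' (hk.trans hkd)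
    exact_mod_cast Nat.add_one_mul_choose_eq d k
  set T := powersetCard k (univ : Finset (Fin d)) with hT
  have hTcard : (#T : ℝ) = d.choose k := by simp [hT]
  set X : ∀ S : Finset (Fin d), ({j // j ∈ S} → α) → ℝ := fun S b =>
    ∑ c : {j // j ∉ S} → α, x (fun j => if h : j ∈ S then b ⟨j, h⟩ else c ⟨j, h⟩)
  have hXdef : ∀ S b, ∑ c : {j // j ∉ S} → α,
      x (fun j => if h : j ∈ S then b ⟨j, h⟩ else c ⟨j, h⟩) = X S b := fun S b => rfl
  clear_value X
  have hX0 : ∀ S b, 0 ≤ X S b := fun S b => hXdef S b ▸ sum_nonneg fun c _ => hx _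
  have hxX : ∀ S (i : Fin d → α), x i ≤ X S (fun j => i j) := fun S i => by
    have h := single_le_sum (f := fun c : {j // j ∉ S} → α =>
      x (fun j => if h : j ∈ S then i j else c ⟨j, h⟩)) (fun c _ => hx _)
      (mem_univ fun j : {j // j ∉ S} => i j)
    rw [← hXdef]
    simpa using h
  set q : ℝ := k / (k + 1) with hq
  set v : ℝ := 1 / (d - 1).choose (k - 1) with hv
  set w : ℝ := d / ((d + 1) * d.choose k) with hw
  set w₀ : ℝ := 1 / (d + 1) with hw₀
  have hq0 : 0 < q := by positivity
  have hv0 : 0 < v := by positivity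
  have hwpos : 0 < w := by positivity
  have hw₀pos : 0 < w₀ := by positivity
  have hvC : v = d / (d.choose k * k) := by
    rw [hv, ← hBC]; field_simp
  have hexp : v * w₀ + w = d / (d + 1) * ((k + 1) / (k * d.choose k)) := by
    rw [hvC, hw, hw₀]; field_simp; ring
  have hqexp : q * (v * w₀ + w) = w := by
    rw [hexp, hq, hw]; field_simp
  clear_value q v w w₀ T
  set A : Finset (Fin d) → ℝ := fun S => ∑ b, X S b ^ q
  have hA0 : ∀ S, 0 ≤ A S := fun S => sum_nonneg fun b _ => Real.rpow_nonneg (hX0 S b) _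
  have hXq : ∀ S, S ∈ T → ∀ b, 0 ≤ X S b ^ q := fun S _ b => Real.rpow_nonneg (hX0 S b) q
  have hv1 : ∀ j, ∑ S ∈ T with j ∈ S, v = 1 := fun j => by
    rw [sum_const, hT, card_filter_mem_powersetCard hk, nsmul_eq_mul, hv]
    field_simp
  have hG := sum_prod_rpow_le_prod_sum_rpow (α := α) T (fun _ => v) (fun _ _ => hv0) (fun S => S)
    hv1 (fun S b => X S b ^ q) hXq
  have hG0 : ∀ i : Fin d → α, 0 ≤ ∏ S ∈ T, (X S (fun j => i j) ^ q) ^ v := fun i =>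
    prod_nonneg fun S _ => Real.rpow_nonneg (Real.rpow_nonneg (hX0 S _) _) _
  have hsum : ∀ S, ∑ i : Fin d → α, x i / X S (fun j => i j) * X S (fun j => i j) ^ q = A S := by
    intro S
    rw [sum_eq_sum_sum_glue S]
    refine sum_congr rfl fun b _ => ?_
    simp only [Subtype.coe_eta, coe_mem, dite_true]
    rw [← sum_mul, ← sum_div, hXdef]
    rcases (hX0 S b).eq_or_lt with h | h
    · rw [← h, Real.zero_rpow hq0.ne', mul_zero]
    · rw [div_self h.ne', one_mul]
  have hTw : #T * w = (d : ℝ) / (d + 1) := by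
    rw [hTcard, hw]; field_simp
  have hcore := sum_rpow_le_of_le T x (fun S i => X S (fun j => i j)) hx hxX hwpos hw₀pos hqexp
    (by rw [hTw, hw₀]; field_simp; ring)
  simp only [hsum, hTw] at hcore
  simp_rw [hXdef]
  calc ∑ i, x i ^ ((d : ℝ) / (d + 1))
      ≤ _ := hcore
    _ ≤ (∏ S ∈ T, A S ^ v) ^ w₀ * ∏ S ∈ T, A S ^ w := by
        refine mul_le_mul_of_nonneg_right
          (Real.rpow_le_rpow (sum_nonneg fun i _ => hG0 i) hG hw₀pos.le)
          (prod_nonneg fun S _ => Real.rpow_nonneg (hA0 S) _)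
    _ = ∏ S ∈ T, A S ^ ((d : ℝ) / (d + 1) * ((k + 1) / (k * d.choose k))) := by
        rw [← Real.finsetProd_rpow _ _ fun S _ => Real.rpow_nonneg (hA0 S) _, ← prod_mul_distrib]
        refine prod_congr rfl fun S _ => ?_
        rw [← Real.rpow_mul (hA0 S), ← Real.rpow_add_of_nonneg (hA0 S) (by positivity) hwpos.le,
          hexp]

end

/-- Blei's inequality: for `1 ≤ k ≤ d` and any array `(a_𝐢)_{𝐢 ∈ [n]^d}`,
`(∑_𝐢 |a_𝐢|^{2d/(d+1)})^{(d+1)/(2d)}` is bounded by the geometric mean over all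
`S ⊆ [d]` with `|S| = k` of the mixed norms
`(∑_{𝐢_S} (∑_{𝐢_{Sᶜ}} |a_𝐢|²)^{(1/2)·(2k/(k+1))})^{(k+1)/(2k)}`. -/
theorem stmt5 (n d k : ℕ) (hn : 1 ≤ n) (hk : 1 ≤ k) (hkd : k ≤ d)
    (a : (Fin d → Fin n) → ℂ) :
    (∑ i : Fin d → Fin n, ‖a i‖ ^ ((2 * (d : ℝ)) / ((d : ℝ) + 1)))
        ^ (((d : ℝ) + 1) / (2 * (d : ℝ)))
      ≤ ∏ S ∈ Finset.univ.filter (fun S : Finset (Fin d) => S.card = k),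
          ((∑ b : {j : Fin d // j ∈ S} → Fin n,
              (∑ c : {j : Fin d // j ∉ S} → Fin n,
                  ‖a (fun j => if h : j ∈ S then b ⟨j, h⟩ else c ⟨j, h⟩)‖ ^ 2)
                ^ ((1 : ℝ) / 2 * (2 * (k : ℝ) / ((k : ℝ) + 1))))
            ^ (((k : ℝ) + 1) / (2 * (k : ℝ))))
          ^ ((1 : ℝ) / (d.choose k)) := by
  have : Nonempty (Fin n) := ⟨⟨0, hn⟩⟩
  have hk0 : (0 : ℝ) < k := by exact_mod_cast hk
  have hd0 : (0 : ℝ) < d := by exact_mod_cast hk.trans hkd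
  have hC : (0 : ℝ) < d.choose k := by exact_mod_cast Nat.choose_pos hkd
  have hsq : ∀ i, ‖a i‖ ^ ((2 * (d : ℝ)) / ((d : ℝ) + 1)) =
      (‖a i‖ ^ 2) ^ ((d : ℝ) / (d + 1)) := fun i => by
    rw [← Real.rpow_natCast, ← Real.rpow_mul (norm_nonneg _)]
    congr 1
    push_cast
    ring
  have hT : univ.filter (fun S : Finset (Fin d) => #S = k) = powersetCard k univ := by
    ext S
    simp
  have hq : (1 : ℝ) / 2 * (2 * (k : ℝ) / ((k : ℝ) + 1)) = k / (k + 1) := by ring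
  simp_rw [hsq, hT, hq]
  refine (Real.rpow_le_rpow (by positivity)
    (sum_rpow_le_prod_sum_rpow_sum hk hkd (fun i => ‖a i‖ ^ 2) fun i => by positivity)
    (by positivity)).trans_eq ?_
  rw [← Real.finsetProd_rpow _ _ fun S _ => by positivity]
  refine prod_congr rfl fun S _ => ?_
  rw [← Real.rpow_mul (by positivity), ← Real.rpow_mul (by positivity)]
  congr 1
  field_simp
end
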